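/- Under the growth condition ψ(tₙ)²/√(n·ψ′(tₙ)) → 0 as n → ∞, where tₙ := m⁻¹(aₙ), the total variation distance between P_{aₙ} and G_{aₙ} tends to 0 as n → ∞: sup over Borel sets C ⊆ ℝ of |P_{aₙ}(C) − G_{aₙ}(C)| → 0; equivalently (by Scheffé's lemma), ∫ |p_{aₙ}(y) − π^{aₙ}(y)| dy → 0 as n → ∞. -/

import Mathlib

open Real Filter Topology MeasureTheory Set

noncomputable section

/-- A representation of a function `l` in class `R₀`:
`l x = exp (∫_1^x ε u / u du)` for `x ≥ 1`, where `ε` is twice differentiable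
(with first and second derivatives `ε'`, `ε''`) and `ε x → 0` as `x → ∞`. -/
def IsR0Rep (l ε ε' ε'' : ℝ → ℝ) : Prop :=
  (∀ x, HasDerivAt ε (ε' x) x) ∧ (∀ x, HasDerivAt ε' (ε'' x) x) ∧
    Tendsto ε atTop (𝓝 0) ∧
    ∀ x ≥ (1 : ℝ), l x = Real.exp (∫ u in (1:ℝ)..x, ε u / u)

/-- The generalized inverse `ψ u = inf {x | h x ≥ u}` of `h`. -/
def geninv (h : ℝ → ℝ) (u : ℝ) : ℝ := sInf {x : ℝ | u ≤ h x}

/-- Class `R_β` (`β > 0`): `h x = x ^ β * l x` for large `x`, with `l ∈ R₀` whose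
representing `ε` satisfies `limsup x * |ε' x| < ∞` and `limsup x ^ 2 * |ε'' x| < ∞`. -/
def MemRbeta (h : ℝ → ℝ) (β : ℝ) : Prop :=
  0 < β ∧ ∃ l ε ε' ε'' : ℝ → ℝ, IsR0Rep l ε ε' ε'' ∧
    (∀ᶠ x in atTop, h x = x ^ β * l x) ∧
    (∃ C : ℝ, ∀ᶠ x in atTop, x * |ε' x| ≤ C) ∧
    (∃ C : ℝ, ∀ᶠ x in atTop, x ^ (2 : ℕ) * |ε'' x| ≤ C)

/-- Class `R_∞`: `h` is increasing and strictly monotone and its generalized inverse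
`ψ` satisfies `ψ x = exp (∫_1^x ε u / u du)` with `ψ x → ∞`, `x ε' x / ε x → 0`,
`x ^ 2 ε'' x / ε x → 0` and `liminf x ^ η * ε x > 0` for some `η ∈ (0, 1/4)`. -/
def MemRinfty (h : ℝ → ℝ) : Prop :=
  StrictMonoOn h (Set.Ici 0) ∧
  ∃ ε ε' ε'' : ℝ → ℝ,
    (∀ x, HasDerivAt ε (ε' x) x) ∧ (∀ x, HasDerivAt ε' (ε'' x) x) ∧
    (∀ x ≥ (1 : ℝ), geninv h x = Real.exp (∫ u in (1:ℝ)..x, ε u / u)) ∧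
    Tendsto (geninv h) atTop atTop ∧
    Tendsto (fun x => x * ε' x / ε x) atTop (𝓝 0) ∧
    Tendsto (fun x => x ^ (2 : ℕ) * ε'' x / ε x) atTop (𝓝 0) ∧
    ∃ η : ℝ, η ∈ Set.Ioo (0 : ℝ) (1/4) ∧ ∃ c > (0 : ℝ), ∀ᶠ x in atTop, c ≤ x ^ η * ε x

/-- The class `𝔯 = R_β ∪ R_∞`. -/
def MemFrakR (h : ℝ → ℝ) : Prop := (∃ β : ℝ, MemRbeta h β) ∨ MemRinfty h

/-- The moment generating function `Φ t = ∫_0^∞ e^{t x} p x dx`. -/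
def mgfFun (p : ℝ → ℝ) (t : ℝ) : ℝ := ∫ x in Set.Ici (0:ℝ), Real.exp (t * x) * p x

/-- `m = (log Φ)'`, the mean of the tilted density. -/
def mFun (p : ℝ → ℝ) : ℝ → ℝ := deriv fun t => Real.log (mgfFun p t)

/-- `s² = m'`, the variance of the tilted density. -/
def s2Fun (p : ℝ → ℝ) : ℝ → ℝ := deriv (mFun p)

/-- `μ₃ = (log Φ)'''`, the third centered moment of the tilted density. -/
def mu3Fun (p : ℝ → ℝ) : ℝ → ℝ := deriv (s2Fun p)

/-- The tilted density `π^a x = e^{t x} p x / Φ t` (with `t` the tilting parameter). -/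
def tilt (p : ℝ → ℝ) (t x : ℝ) : ℝ := Real.exp (t * x) * p x / mgfFun p t

/-- `convPow f n` is the `n`-fold convolution of the density `f` with itself. -/
def convPow (f : ℝ → ℝ) : ℕ → ℝ → ℝ
  | 0 => fun _ => 0
  | 1 => f
  | n + 2 => fun x => ∫ y : ℝ, f y * convPow f (n + 1) (x - y)

/-- The conditional density of `X₁` given `Sₙ = n aₙ`:
`p_{aₙ}(y) = p y · p^{*(n-1)}(n aₙ - y) / p^{*n}(n aₙ)`. -/
def condDensity (p : ℝ → ℝ) (a : ℕ → ℝ) (n : ℕ) (y : ℝ) : ℝ :=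
  p y * convPow p (n - 1) ((n : ℝ) * a n - y) / convPow p n ((n : ℝ) * a n)

open FourierTransform in
lemma integral_fourier_mul_flip {f g : ℝ → ℂ} (hf : Integrable f) (hg : Integrable g) :
    ∫ x, 𝓕 f x * g x = ∫ x, f x * 𝓕 g x := by
  have := VectorFourier.integral_fourierIntegral_smul_eq_flip (L := innerₗ ℝ) (μ := volume)
    (ν := volume) (f := f) (g := g) Real.continuous_fourierChar (by fun_prop) hf hg
  simpa [flip_innerₗ] using! this

open FourierTransform in
lemma ae_eq_fourierInv_fourier {f : ℝ → ℂ} (hf : Integrable f) (hF : Integrable (𝓕 f)) :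
    ∀ᵐ x, f x = 𝓕⁻ (𝓕 f) x := by
  have hcont : Continuous (𝓕⁻ (𝓕 f)) := by
    rw [fourierInv_eq_fourier_comp_neg]
    exact VectorFourier.fourierIntegral_continuous Real.continuous_fourierChar
      (by exact continuous_inner) hF.comp_neg
  refine ae_eq_of_integral_contDiff_smul_eq hf.locallyIntegrable hcont.locallyIntegrable ?_
  intro g hg hgc
  let χ : SchwartzMap ℝ ℂ := HasCompactSupport.toSchwartzMap (f := fun x => (g x : ℂ))
    (hgc.comp_left (g := fun y : ℝ => (y : ℂ)) (by simp)) (Complex.ofRealCLM.contDiff.comp hg)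
  have hχ : ∀ x, (χ : ℝ → ℂ) x = g x := fun x => rfl
  let θ : SchwartzMap ℝ ℂ := 𝓕⁻ χ
  have hθ : (χ : ℝ → ℂ) = 𝓕 (θ : ℝ → ℂ) := by
    rw [← SchwartzMap.fourier_coe, FourierTransform.fourier_fourierInv_eq]
  have h1 : ∫ x, g x • f x = ∫ x, θ x * 𝓕 f x := by
    rw [← integral_fourier_mul_flip θ.integrable hf, ← hθ]
    simp [hχ]
  have h2 : ∫ x, g x • 𝓕⁻ (𝓕 f) x = ∫ x, θ x * 𝓕 f x := by
    have : ∫ x, g x • 𝓕⁻ (𝓕 f) x = ∫ x, (fun y => χ (-y)) x * 𝓕 (𝓕 f) x := by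
      rw [← integral_neg_eq_self]
      simp [fourierInv_eq_fourier_neg, hχ]
    have hn : Integrable (fun y => χ (-y)) := χ.integrable.comp_neg
    rw [this, ← integral_fourier_mul_flip hn hF]
    have h3 : 𝓕 (fun y => χ (-y)) = (θ : ℝ → ℂ) := by
      rw [← fourierInv_eq_fourier_comp_neg, SchwartzMap.fourierInv_coe]
    rw [h3]
  rw [h1, h2]

open FourierTransform in
lemma integrable_norm_fourier_sq {f : ℝ → ℂ} (hf : Integrable f) (hf2 : MemLp f 2) :
    Integrable (fun ξ => ‖𝓕 f ξ‖ ^ 2) ∧ ∫ ξ, ‖𝓕 f ξ‖ ^ 2 = ∫ x, ‖f x‖ ^ 2 := by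
  set F : Lp ℂ 2 (volume : Measure ℝ) := hf2.toLp f with hFdef
  have hcont : Continuous (𝓕 f) :=
    VectorFourier.fourierIntegral_continuous Real.continuous_fourierChar
      (by exact continuous_inner) hf
  have hae : ∀ᵐ x, 𝓕 f x = (𝓕 F : Lp ℂ 2 (volume : Measure ℝ)) x := by
    refine ae_eq_of_integral_contDiff_smul_eq hcont.locallyIntegrable
      ((Lp.memLp (𝓕 F)).locallyIntegrable (by norm_num)) ?_
    intro g hg hgc
    let χ : SchwartzMap ℝ ℂ := HasCompactSupport.toSchwartzMap (f := fun x => (g x : ℂ))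
      (hgc.comp_left (g := fun y : ℝ => (y : ℂ)) (by simp)) (Complex.ofRealCLM.contDiff.comp hg)
    have hχ : ∀ x, (χ : ℝ → ℂ) x = g x := fun x => rfl
    have h1 : ∫ x, g x • 𝓕 f x = ∫ x, 𝓕 (χ : ℝ → ℂ) x * f x := by
      rw [integral_fourier_mul_flip χ.integrable hf]
      simp [hχ]
    have h2 := congrArg (fun T => T χ) (Lp.fourier_toTemperedDistribution_eq F)
    simp only [TemperedDistribution.fourier_apply, Lp.toTemperedDistribution_apply] at h2
    have h3 : ∫ x, 𝓕 (χ : ℝ → ℂ) x * f x = ∫ x, (𝓕 χ) x • F x := by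
      apply integral_congr_ae
      filter_upwards [hf2.coeFn_toLp] with x hx
      rw [hFdef, hx, SchwartzMap.fourier_coe, smul_eq_mul]
    rw [h1, h3, h2]
    simp [hχ]
  have hm : MemLp (𝓕 f) 2 := (memLp_congr_ae hae).2 (Lp.memLp _)
  refine ⟨by simpa using (hm.integrable_norm_pow (p := 2) (by norm_num)), ?_⟩
  have hn := Lp.norm_fourier_eq F
  have e1 : ∀ G : Lp ℂ 2 (volume : Measure ℝ), ∫ x, ‖G x‖ ^ 2 = ‖G‖ ^ 2 := by
    intro G
    have := L2.inner_def (𝕜 := ℂ) G G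
    rw [inner_self_eq_norm_sq_to_K] at this
    have h4 : ∀ x, inner ℂ (G x) (G x) = ((‖G x‖ ^ 2 : ℝ) : ℂ) := by
      intro x; rw [inner_self_eq_norm_sq_to_K]; push_cast; rfl
    simp_rw [h4] at this
    rw [integral_complex_ofReal] at this
    rw [← RCLike.ofReal_pow] at this
    exact (Complex.ofReal_injective this).symm
  calc ∫ ξ, ‖𝓕 f ξ‖ ^ 2 = ∫ x, ‖(𝓕 F : Lp ℂ 2 (volume : Measure ℝ)) x‖ ^ 2 := by
        apply integral_congr_ae; filter_upwards [hae] with x hx; rw [hx]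
    _ = ∫ x, ‖F x‖ ^ 2 := by rw [e1, e1, hn]
    _ = ∫ x, ‖f x‖ ^ 2 := by
        apply integral_congr_ae; filter_upwards [hf2.coeFn_toLp] with x hx; rw [hFdef, hx]

lemma integral_comp_affine (F : ℝ → ℝ) {σ : ℝ} (hσ : 0 < σ) (a : ℝ) :
    ∫ x, F x = σ * ∫ u, F (a + σ * u) := by
  have := Measure.integral_comp_mul_left (fun x => F (a + x)) σ
  rw [this, integral_add_left_eq_self, abs_of_pos (inv_pos.2 hσ), smul_eq_mul]
  field_simp

lemma integrable_conv {f g : ℝ → ℝ} (hf : Integrable f) (hg : Integrable g) :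
    Integrable (fun x => ∫ y, f y * g (x - y)) :=
  hf.integrable_convolution (ContinuousLinearMap.mul ℝ ℝ) hg

lemma integral_conv {f g : ℝ → ℝ} (hf : Integrable f) (hg : Integrable g) :
    ∫ x, ∫ y, f y * g (x - y) = (∫ x, f x) * ∫ x, g x :=
  integral_convolution (ContinuousLinearMap.mul ℝ ℝ) hf hg

/-- The Fourier transform of a real-valued function. -/
def fourierR (f : ℝ → ℝ) : ℝ → ℂ := FourierTransform.fourier (fun x => (f x : ℂ))

lemma fourierR_apply (f : ℝ → ℝ) (ξ : ℝ) :
    fourierR f ξ = ∫ x, Complex.exp (((-2 * π * ξ * x : ℝ) : ℂ) * Complex.I) * f x := by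
  rw [fourierR, fourier_real_eq_integral_exp_smul]
  simp only [smul_eq_mul]
  congr with x
  congr 4
  ring

lemma fourierR_conv {f g : ℝ → ℝ} (hf : Integrable f) (hg : Integrable g) (ξ : ℝ) :
    fourierR (fun x => ∫ y, f y * g (x - y)) ξ = fourierR f ξ * fourierR g ξ := by
  have := Real.fourier_mul_convolution_eq (R := ℂ) hf.ofReal hg.ofReal ξ
  refine Eq.trans ?_ this
  refine congrArg (fun F : ℝ → ℂ => FourierTransform.fourier F ξ) (funext fun x => ?_)
  rw [← integral_complex_ofReal]
  simp [convolution]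

lemma integrable_exp_mul {f : ℝ → ℝ} (hf : Integrable f) (ξ : ℝ) :
    Integrable (fun x => Complex.exp (((-2 * π * ξ * x : ℝ) : ℂ) * Complex.I) * f x) := by
  refine hf.ofReal.bdd_mul (c := 1) (Continuous.aestronglyMeasurable (by fun_prop)) ?_
  filter_upwards with x
  rw [Complex.norm_exp_ofReal_mul_I]

lemma fourierR_add {f g : ℝ → ℝ} (hf : Integrable f) (hg : Integrable g) (ξ : ℝ) :
    fourierR (fun x => f x + g x) ξ = fourierR f ξ + fourierR g ξ := by
  simp only [fourierR_apply]
  rw [← integral_add (integrable_exp_mul hf ξ) (integrable_exp_mul hg ξ)]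
  congr with x
  push_cast; ring

lemma fourierR_const_mul {f : ℝ → ℝ} (c : ℝ) (ξ : ℝ) :
    fourierR (fun x => c * f x) ξ = c * fourierR f ξ := by
  simp only [fourierR_apply]
  rw [← integral_const_mul]
  congr with x
  push_cast; ring

lemma continuous_fourierR {f : ℝ → ℝ} (hf : Integrable f) : Continuous (fourierR f) :=
  VectorFourier.fourierIntegral_continuous Real.continuous_fourierChar
    (by exact continuous_inner) hf.ofReal

lemma norm_fourierR_le {f : ℝ → ℝ} (hf : ∀ x, 0 ≤ f x) (ξ : ℝ) :
    ‖fourierR f ξ‖ ≤ ∫ x, f x := by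
  rw [fourierR_apply]
  refine (norm_integral_le_integral_norm _).trans_eq ?_
  congr with x
  rw [norm_mul, Complex.norm_exp_ofReal_mul_I, one_mul, Complex.norm_real, norm_of_nonneg (hf x)]

lemma fourierR_norm_sq_le {f : ℝ → ℝ} {C : ℝ} (hf : Integrable f) (h0 : ∀ x, 0 ≤ f x)
    (hC : ∀ x, f x ≤ C) :
    Integrable (fun ξ => ‖fourierR f ξ‖ ^ 2) ∧ ∫ ξ, ‖fourierR f ξ‖ ^ 2 ≤ C * ∫ x, f x := by
  have hsq : Integrable (fun x => ‖(f x : ℂ)‖ ^ 2) := by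
    have : Integrable (fun x => f x * f x) := by
      refine hf.bdd_mul (c := C) hf.1 ?_
      filter_upwards with x
      rw [norm_of_nonneg (h0 x)]; exact hC x
    refine this.congr ?_
    filter_upwards with x
    simp [pow_two]
  have hm : MemLp (fun x => (f x : ℂ)) 2 :=
    (memLp_two_iff_integrable_sq_norm hf.ofReal.1).2 hsq
  obtain ⟨h1, h2⟩ := integrable_norm_fourier_sq hf.ofReal hm
  refine ⟨h1, ?_⟩
  rw [← integral_const_mul]
  refine h2.trans_le (integral_mono hsq (hf.const_mul C) fun x => ?_)
  change ‖(f x : ℂ)‖ ^ 2 ≤ C * f x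
  rw [Complex.norm_real, norm_of_nonneg (h0 x), pow_two]
  exact mul_le_mul_of_nonneg_right (hC x) (h0 x)

lemma convPow_succ (f : ℝ → ℝ) {n : ℕ} (hn : 1 ≤ n) (x : ℝ) :
    convPow f (n + 1) x = ∫ y, f y * convPow f n (x - y) := by
  obtain ⟨k, rfl⟩ : ∃ k, n = k + 1 := ⟨n - 1, by omega⟩
  rfl

lemma convPow_nonneg {f : ℝ → ℝ} (hf : ∀ x, 0 ≤ f x) (n : ℕ) (x : ℝ) : 0 ≤ convPow f n x := by
  induction n generalizing x with
  | zero => exact le_rfl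
  | succ n ih =>
    rcases Nat.eq_zero_or_pos n with rfl | hn
    · exact hf x
    · rw [convPow_succ f hn]
      exact integral_nonneg fun y => mul_nonneg (hf y) (ih _)

lemma integrable_convPow {f : ℝ → ℝ} (hf : Integrable f) (n : ℕ) : Integrable (convPow f n) := by
  induction n with
  | zero => exact integrable_zero _ _ _
  | succ n ih =>
    rcases Nat.eq_zero_or_pos n with rfl | hn
    · exact hf
    · rw [show convPow f (n + 1) = _ from funext (convPow_succ f hn)]
      exact integrable_conv hf ih

lemma integral_convPow {f : ℝ → ℝ} (hf : Integrable f) {n : ℕ} (hn : 1 ≤ n) :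
    ∫ x, convPow f n x = (∫ x, f x) ^ n := by
  induction n, hn using Nat.le_induction with
  | base => simp [convPow]
  | succ n hn ih =>
    rw [show convPow f (n + 1) = _ from funext (convPow_succ f hn),
      integral_conv hf (integrable_convPow hf n), ih, pow_succ']

lemma fourierR_convPow {f : ℝ → ℝ} (hf : Integrable f) {n : ℕ} (hn : 1 ≤ n) (ξ : ℝ) :
    fourierR (convPow f n) ξ = fourierR f ξ ^ n := by
  induction n, hn using Nat.le_induction with
  | base => simp [convPow]
  | succ n hn ih =>
    rw [show convPow f (n + 1) = _ from funext (convPow_succ f hn),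
      fourierR_conv hf (integrable_convPow hf n), ih, pow_succ']

lemma convPow_eq_zero_of_nonneg {f : ℝ → ℝ} (hf : ∀ x, 0 ≤ x → f x = 0) (n : ℕ) {x : ℝ}
    (hx : 0 ≤ x) : convPow f n x = 0 := by
  induction n generalizing x with
  | zero => rfl
  | succ n ih =>
    rcases Nat.eq_zero_or_pos n with rfl | hn
    · exact hf x hx
    · rw [convPow_succ f hn]
      refine integral_eq_zero_of_ae ?_
      filter_upwards with y
      rcases le_total 0 y with hy | hy
      · simp [hf y hy]
      · simp [ih (x := x - y) (by linarith)]

lemma conv_le {f g : ℝ → ℝ} {C : ℝ} (hf : ∀ x, 0 ≤ f x) (hC : ∀ x, f x ≤ C)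
    (hg : Integrable g) (h0 : ∀ x, 0 ≤ g x) (x : ℝ) :
    ∫ y, f y * g (x - y) ≤ C * ∫ y, g y := by
  rw [← integral_sub_left_eq_self g volume x, ← integral_const_mul]
  refine integral_mono_of_nonneg ?_ ((hg.comp_sub_left x).const_mul C) ?_
  · filter_upwards with y using mul_nonneg (hf y) (h0 _)
  · filter_upwards with y using mul_le_mul_of_nonneg_right (hC y) (h0 _)

/-- The affine change of variables `x = a + σ u` for tilted convolution powers. -/
lemma convPow_tilt (p : ℝ → ℝ) {σ : ℝ} (hσ : 0 < σ) (a t Φ : ℝ) {n : ℕ} (hn : 1 ≤ n) (v : ℝ) :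
    convPow (fun u => σ * (exp (t * (a + σ * u)) * p (a + σ * u) / Φ)) n v =
      σ * (exp (t * (n * a + σ * v)) * convPow p n (n * a + σ * v) / Φ ^ n) := by
  induction n, hn using Nat.le_induction generalizing v with
  | base => simp [convPow]
  | succ n hn ih =>
    rw [convPow_succ _ hn, convPow_succ _ hn]
    simp_rw [ih]
    have h2 := integral_comp_affine
      (fun x => p x * convPow p n (((n + 1 : ℕ) : ℝ) * a + σ * v - x)) hσ a
    rw [h2, show ∀ E I K : ℝ, σ * (E * (σ * I) / K) = (σ * σ * E / K) * I by intros; ring,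
      ← integral_const_mul]
    congr with y
    have e1 : (n : ℝ) * a + σ * (v - y) = ((n + 1 : ℕ) : ℝ) * a + σ * v - (a + σ * y) := by
      push_cast; ring
    rw [e1]
    have e2 : exp (t * (((n + 1 : ℕ) : ℝ) * a + σ * v)) = exp (t * (a + σ * y)) *
      exp (t * (((n + 1 : ℕ) : ℝ) * a + σ * v - (a + σ * y))) := by
      rw [← exp_add]; ring_nf
    rw [e2, pow_succ]
    simp only [div_eq_mul_inv, mul_inv]
    ring

lemma norm_exp_mul_I_sub_taylor_le (x : ℝ) :
    ‖Complex.exp (x * Complex.I) - (1 + x * Complex.I - x ^ 2 / 2)‖ ≤ 4 * |x| ^ 3 := by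
  rcases le_total |x| 1 with hx | hx
  · have h := Complex.norm_exp_sub_sum_le_norm_mul_exp (x * Complex.I) 3
    have e1 : ∑ m ∈ Finset.range 3, (x * Complex.I) ^ m / (m.factorial : ℂ)
        = 1 + x * Complex.I - x ^ 2 / 2 := by
      simp only [Finset.sum_range_succ, Finset.sum_range_zero, Nat.factorial]
      push_cast
      ring_nf
      rw [Complex.I_sq]; ring
    rw [e1] at h
    have e2 : ‖(x : ℂ) * Complex.I‖ = |x| := by simp
    rw [e2] at h
    refine h.trans ?_
    have : rexp |x| ≤ 4 := (exp_le_exp.2 hx).trans (by linarith [Real.exp_one_lt_d9])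
    rw [mul_comm]
    gcongr
  · have h1 : ‖Complex.exp (x * Complex.I)‖ = 1 := Complex.norm_exp_ofReal_mul_I x
    have h2 : ‖(x : ℂ) * Complex.I‖ = |x| := by simp
    have h3 : ‖(x : ℂ) ^ 2 / 2‖ = |x| ^ 2 / 2 := by simp
    have := norm_sub_le (Complex.exp (x * Complex.I)) (1 + x * Complex.I - x ^ 2 / 2)
    have h4 := norm_sub_le (1 + (x : ℂ) * Complex.I) (x ^ 2 / 2)
    have h5 := norm_add_le (1 : ℂ) ((x : ℂ) * Complex.I)
    have h6 : ‖(1 : ℂ)‖ = 1 := norm_one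
    nlinarith [mul_nonneg (abs_nonneg x) (sub_nonneg.2 hx),
      mul_nonneg (sq_nonneg |x|) (sub_nonneg.2 hx)]

/-- A centred probability density with variance close to `1`, bounded third absolute moment,
bounded on `[-2, ∞)`, whose Fourier transform is dominated by the Gaussian one up to `η`. -/
structure IsNearGaussian (w : ℝ → ℝ) (C η : ℝ) : Prop where
  nonneg : ∀ u, 0 ≤ w u
  integrable : Integrable w
  integral_eq_one : ∫ u, w u = 1
  integrable_cube : Integrable (fun u => |u| ^ 3 * w u)
  mean : ∫ u, u * w u = 0
  variance : |(∫ u, u ^ 2 * w u) - 1| ≤ η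
  cube_le : ∫ u, |u| ^ 3 * w u ≤ C
  le_of_ge : ∀ u, -2 ≤ u → w u ≤ C
  norm_fourierR_le : ∀ ξ, ‖fourierR w ξ‖ ≤ exp (-2 * π ^ 2 * ξ ^ 2) + η

lemma integrable_abs_pow_mul {w : ℝ → ℝ} (h : Integrable w)
    (h3 : Integrable (fun u => |u| ^ 3 * w u)) {j : ℕ} (hj : j ≤ 3) :
    Integrable (fun u => |u| ^ j * w u) := by
  refine (h.norm.add h3.norm).mono' ((Continuous.aestronglyMeasurable (by fun_prop)).mul h.1) ?_
  filter_upwards with u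
  simp only [Pi.add_apply, norm_mul, norm_pow, Real.norm_eq_abs, abs_abs]
  have : |u| ^ j ≤ 1 + |u| ^ 3 := by
    rcases le_total |u| 1 with hu | hu
    · linarith [pow_le_one₀ (n := j) (abs_nonneg u) hu, pow_nonneg (abs_nonneg u) 3]
    · linarith [pow_le_pow_right₀ hu hj]
  nlinarith [abs_nonneg (w u)]

namespace IsNearGaussian
variable {w : ℝ → ℝ} {C η : ℝ}

lemma integrable_id (h : IsNearGaussian w C η) : Integrable (fun u => u * w u) := by
  refine (integrable_abs_pow_mul h.integrable h.integrable_cube (j := 1) (by norm_num)).mono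
    ((Continuous.aestronglyMeasurable (by fun_prop)).mul h.integrable.1) ?_
  filter_upwards with u
  simp

lemma integrable_sq (h : IsNearGaussian w C η) : Integrable (fun u => u ^ 2 * w u) := by
  simpa using integrable_abs_pow_mul h.integrable h.integrable_cube (j := 2) (by norm_num)

lemma const_nonneg (h : IsNearGaussian w C η) : 0 ≤ C :=
  (h.nonneg 0).trans (h.le_of_ge 0 (by norm_num))

lemma fourierR_taylor (h : IsNearGaussian w C η) (ξ : ℝ) :
    ‖fourierR w ξ - (1 - 2 * π ^ 2 * ξ ^ 2 * ∫ u, u ^ 2 * w u : ℝ)‖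
      ≤ 4 * (2 * π) ^ 3 * C * |ξ| ^ 3 := by
  set A := -2 * π * ξ with hA
  have e0 : fourierR w ξ - (1 - 2 * π ^ 2 * ξ ^ 2 * ∫ u, u ^ 2 * w u : ℝ) =
      ∫ u, (Complex.exp (((A * u : ℝ) : ℂ) * Complex.I) -
        (1 + ((A * u : ℝ) : ℂ) * Complex.I - ((A * u : ℝ) : ℂ) ^ 2 / 2)) * w u := by
    have i1 : Integrable (fun u => (w u : ℂ)) := h.integrable.ofReal
    have i2 : Integrable (fun u => ((u * w u : ℝ) : ℂ)) := h.integrable_id.ofReal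
    have i3 : Integrable (fun u => ((u ^ 2 * w u : ℝ) : ℂ)) := h.integrable_sq.ofReal
    have i0 := integrable_exp_mul h.integrable ξ
    have e1 : ∀ u, (Complex.exp (((A * u : ℝ) : ℂ) * Complex.I) -
        (1 + ((A * u : ℝ) : ℂ) * Complex.I - ((A * u : ℝ) : ℂ) ^ 2 / 2)) * w u
        = Complex.exp (((A * u : ℝ) : ℂ) * Complex.I) * w u - (w u : ℂ)
          - (A * Complex.I) * ((u * w u : ℝ) : ℂ) + (A ^ 2 / 2) * ((u ^ 2 * w u : ℝ) : ℂ) := by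
      intro u; push_cast; ring
    simp_rw [e1]
    have i4 := i2.const_mul (A * Complex.I)
    have i5 := i3.const_mul ((A : ℂ) ^ 2 / 2)
    have j1 : Integrable (fun u => Complex.exp (((A * u : ℝ) : ℂ) * Complex.I) * w u - (w u : ℂ)) :=
      i0.sub i1
    have j2 : Integrable (fun u => Complex.exp (((A * u : ℝ) : ℂ) * Complex.I) * w u - (w u : ℂ)
          - (A * Complex.I) * ((u * w u : ℝ) : ℂ)) := j1.sub i4
    rw [integral_add j2 i5, integral_sub j1 i4, integral_sub i0 i1,
      integral_const_mul, integral_const_mul, integral_complex_ofReal, integral_complex_ofReal,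
      integral_complex_ofReal, h.mean, h.integral_eq_one, fourierR_apply]
    rw [hA]
    push_cast
    ring
  rw [e0]
  have hb : ∀ u, ‖(Complex.exp (((A * u : ℝ) : ℂ) * Complex.I) -
        (1 + ((A * u : ℝ) : ℂ) * Complex.I - ((A * u : ℝ) : ℂ) ^ 2 / 2)) * w u‖
      ≤ 4 * |A| ^ 3 * (|u| ^ 3 * w u) := by
    intro u
    rw [norm_mul, Complex.norm_real, norm_of_nonneg (h.nonneg u)]
    have := norm_exp_mul_I_sub_taylor_le (A * u)
    rw [abs_mul, mul_pow] at this
    calc _ ≤ (4 * (|A| ^ 3 * |u| ^ 3)) * w u := mul_le_mul_of_nonneg_right this (h.nonneg u)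
      _ = _ := by ring
  refine (norm_integral_le_of_norm_le (h.integrable_cube.const_mul _) (.of_forall hb)).trans ?_
  rw [integral_const_mul]
  have hA' : |A| = 2 * π * |ξ| := by
    rw [hA, abs_mul, abs_mul, abs_of_pos pi_pos]; norm_num
  rw [hA']
  have : 0 ≤ 4 * (2 * π * |ξ|) ^ 3 := by positivity
  nlinarith [mul_le_mul_of_nonneg_left h.cube_le this]

lemma norm_fourierR_le_one (h : IsNearGaussian w C η) (ξ : ℝ) : ‖fourierR w ξ‖ ≤ 1 :=
  (_root_.norm_fourierR_le h.nonneg ξ).trans_eq h.integral_eq_one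

/-- Gaussian decay of the Fourier transform near the origin. -/
lemma norm_fourierR_le_exp (h : IsNearGaussian w C η) (hη : η ≤ 1 / 4) {ξ : ℝ}
    (h1 : |ξ| ≤ 1 / 6) (h2 : 4 * (2 * π) ^ 3 * C * |ξ| ≤ π ^ 2 / 2) :
    ‖fourierR w ξ‖ ≤ exp (-π ^ 2 * ξ ^ 2) := by
  set m := ∫ u, u ^ 2 * w u with hm
  have hv := abs_le.1 (h.variance.trans hη)
  have ht := h.fourierR_taylor ξ
  have hpi : π ^ 2 ≤ 10 := by nlinarith [pi_lt_d2, pi_gt_three]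
  have hx : ξ ^ 2 ≤ 1 / 36 := by rw [← sq_abs]; nlinarith [abs_nonneg ξ]
  have hpx : π ^ 2 * ξ ^ 2 ≤ 10 / 36 := by nlinarith [sq_nonneg ξ, sq_nonneg π]
  have hpx0 : 0 ≤ π ^ 2 * ξ ^ 2 := by positivity
  have h0 : 0 ≤ 1 - 2 * π ^ 2 * ξ ^ 2 * m := by nlinarith
  have h3 : 4 * (2 * π) ^ 3 * C * |ξ| ^ 3 ≤ π ^ 2 / 2 * ξ ^ 2 := by
    rw [← sq_abs ξ]
    calc _ = (4 * (2 * π) ^ 3 * C * |ξ|) * |ξ| ^ 2 := by ring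
      _ ≤ _ := mul_le_mul_of_nonneg_right h2 (sq_nonneg _)
  have h4 : ‖((1 - 2 * π ^ 2 * ξ ^ 2 * m : ℝ) : ℂ)‖ = 1 - 2 * π ^ 2 * ξ ^ 2 * m := by
    rw [Complex.norm_real, norm_of_nonneg h0]
  have h5 := norm_le_norm_sub_add (fourierR w ξ) ((1 - 2 * π ^ 2 * ξ ^ 2 * m : ℝ) : ℂ)
  rw [h4] at h5
  have h6 := Real.add_one_le_exp (-π ^ 2 * ξ ^ 2)
  nlinarith

lemma integral_indicator_Iio_le (h : IsNearGaussian w C η) (hη : η ≤ 1 / 4) :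
    ∫ u, (Iio (-2)).indicator w u ≤ 1 / 2 := by
  have hv := abs_le.1 (h.variance.trans hη)
  have : ∫ u, (Iio (-2)).indicator w u ≤ ∫ u, (1 / 4) * (u ^ 2 * w u) := by
    refine integral_mono (h.integrable.indicator measurableSet_Iio)
      (h.integrable_sq.const_mul _) fun u => ?_
    by_cases hu : u < -2
    · rw [indicator_of_mem (by exact hu)]
      have := h.nonneg u
      have h4 : 4 ≤ u ^ 2 := by nlinarith
      change w u ≤ (1 / 4) * (u ^ 2 * w u)
      nlinarith
    · rw [indicator_of_notMem (by exact hu)]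
      have := h.nonneg u
      positivity
  rw [integral_const_mul] at this
  linarith

end IsNearGaussian

lemma norm_pow_sub_pow_le_mul {x y : ℂ} (hx : ‖x‖ ≤ 1) (hy : ‖y‖ ≤ 1) (n : ℕ) :
    ‖x ^ n - y ^ n‖ ≤ n * ‖x - y‖ := by
  induction n with
  | zero => simp
  | succ n ih =>
    have e : x ^ (n + 1) - y ^ (n + 1) = x * (x ^ n - y ^ n) + (x - y) * y ^ n := by ring
    rw [e]
    refine (norm_add_le _ _).trans ?_
    rw [norm_mul, norm_mul, norm_pow]
    have h1 : ‖x‖ * ‖x ^ n - y ^ n‖ ≤ 1 * ‖x ^ n - y ^ n‖ := by gcongr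
    have h2 : ‖x - y‖ * ‖y‖ ^ n ≤ ‖x - y‖ * 1 := by
      gcongr; exact pow_le_one₀ (norm_nonneg _) hy
    push_cast
    linarith

lemma norm_pow_sub_linear_le {x y : ℂ} {κ : ℝ} (hx : ‖x‖ ≤ κ) (hy : ‖y‖ ≤ κ) (k : ℕ) :
    ‖x ^ (k + 2) - y ^ (k + 2) - (k + 2 : ℕ) * ((x - y) * y ^ (k + 1))‖
      ≤ ((k + 2 : ℕ) : ℝ) ^ 2 * κ ^ k * ‖x - y‖ ^ 2 := by
  have hκ : 0 ≤ κ := (norm_nonneg x).trans hx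
  induction k with
  | zero =>
    have e : x ^ (0 + 2) - y ^ (0 + 2) - (0 + 2 : ℕ) * ((x - y) * y ^ (0 + 1)) = (x - y) ^ 2 := by
      push_cast; ring
    rw [e, norm_pow]
    push_cast
    nlinarith [sq_nonneg ‖x - y‖]
  | succ k ih =>
    have e : x ^ (k + 1 + 2) - y ^ (k + 1 + 2) - (k + 1 + 2 : ℕ) * ((x - y) * y ^ (k + 1 + 1)) =
      x * (x ^ (k + 2) - y ^ (k + 2) - (k + 2 : ℕ) * ((x - y) * y ^ (k + 1)))
        + (k + 2 : ℕ) * ((x - y) ^ 2 * y ^ (k + 1)) := by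
      push_cast; ring
    rw [e]
    refine (norm_add_le _ _).trans ?_
    rw [norm_mul, norm_mul, norm_mul, norm_pow, norm_pow, Complex.norm_natCast]
    have h1 := mul_le_mul hx ih (norm_nonneg _) hκ
    have h2 : ‖y‖ ^ (k + 1) ≤ κ ^ (k + 1) := pow_le_pow_left₀ (norm_nonneg _) hy _
    have h3 : ((k + 2 : ℕ) : ℝ) * (‖x - y‖ ^ 2 * ‖y‖ ^ (k + 1)) ≤
        ((k + 2 : ℕ) : ℝ) * (‖x - y‖ ^ 2 * κ ^ (k + 1)) := by gcongr
    refine (add_le_add h1 h3).trans ?_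
    have h4 : 0 ≤ κ ^ (k + 1) * ‖x - y‖ ^ 2 := by positivity
    have h5 : (0 : ℝ) ≤ k := Nat.cast_nonneg k
    have e2 : κ * (((k + 2 : ℕ) : ℝ) ^ 2 * κ ^ k * ‖x - y‖ ^ 2) +
      ((k + 2 : ℕ) : ℝ) * (‖x - y‖ ^ 2 * κ ^ (k + 1)) =
      (((k + 2 : ℕ) : ℝ) ^ 2 + ((k + 2 : ℕ) : ℝ)) * (κ ^ (k + 1) * ‖x - y‖ ^ 2) := by ring
    rw [e2, mul_assoc]
    refine mul_le_mul_of_nonneg_right ?_ h4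
    push_cast
    nlinarith

lemma tendsto_add_two_pow_three_mul_pow {r : ℝ} (h0 : 0 < r) (h1 : r < 1) :
    Tendsto (fun k : ℕ => ((k + 2 : ℕ) : ℝ) ^ 3 * r ^ k) atTop (𝓝 0) := by
  have h := tendsto_pow_const_mul_const_pow_of_abs_lt_one 3 (r := r) (by rwa [abs_of_pos h0])
  have h2 := ((tendsto_add_atTop_iff_nat 2).2 h).div_const (r ^ 2)
  rw [zero_div] at h2
  refine h2.congr fun k => ?_
  rw [pow_add]
  field_simp

/-- Convolution power with the contributions of at most one bounded factor removed. -/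
def mainConv (w : ℝ → ℝ) (k : ℕ) (v : ℝ) : ℝ :=
  convPow w (k + 2) v - convPow ((Iio (-2)).indicator w) (k + 2) v
    - (k + 2 : ℕ) * ∫ y, (Ici (-2)).indicator w y * convPow ((Iio (-2)).indicator w) (k + 1) (v - y)

lemma integrable_mainConv {w : ℝ → ℝ} (hw : Integrable w) (k : ℕ) : Integrable (mainConv w k) :=
  (((integrable_convPow hw _).sub (integrable_convPow (hw.indicator measurableSet_Iio) _)).sub
    ((integrable_conv (hw.indicator measurableSet_Ici)
      (integrable_convPow (hw.indicator measurableSet_Iio) _)).const_mul _))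

lemma fourierR_indicator_Ici {w : ℝ → ℝ} (hw : Integrable w) (ξ : ℝ) :
    fourierR ((Ici (-2)).indicator w) ξ =
      fourierR w ξ - fourierR ((Iio (-2)).indicator w) ξ := by
  rw [eq_sub_iff_add_eq, ← fourierR_add (hw.indicator measurableSet_Ici)
    (hw.indicator measurableSet_Iio)]
  congr 1
  funext x
  have := congrFun (indicator_compl_add_self (Iio (-2 : ℝ)) w) x
  rwa [compl_Iio] at this

lemma fourierR_mainConv {w : ℝ → ℝ} (hw : Integrable w) (k : ℕ) (ξ : ℝ) :
    fourierR (mainConv w k) ξ = fourierR w ξ ^ (k + 2)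
      - fourierR ((Iio (-2)).indicator w) ξ ^ (k + 2)
      - (k + 2 : ℕ) * ((fourierR w ξ - fourierR ((Iio (-2)).indicator w) ξ) *
        fourierR ((Iio (-2)).indicator w) ξ ^ (k + 1)) := by
  have hl : Integrable ((Iio (-2)).indicator w) := hw.indicator measurableSet_Iio
  have hr : Integrable ((Ici (-2)).indicator w) := hw.indicator measurableSet_Ici
  have i1 := integrable_convPow hw (k + 2)
  have i2 := integrable_convPow hl (k + 2)
  have i3 := integrable_conv hr (integrable_convPow hl (k + 1))
  have e : mainConv w k = fun v => (convPow w (k + 2) v +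
      (-1) * convPow ((Iio (-2)).indicator w) (k + 2) v) + (-(k + 2 : ℕ) : ℝ) *
      ∫ y, (Ici (-2)).indicator w y * convPow ((Iio (-2)).indicator w) (k + 1) (v - y) := by
    funext v; rw [mainConv]; ring
  have i4 : Integrable fun v => convPow w (k + 2) v +
      (-1) * convPow ((Iio (-2)).indicator w) (k + 2) v := i1.add (i2.const_mul _)
  rw [e, fourierR_add i4 (i3.const_mul _), fourierR_add i1 (i2.const_mul _),
    fourierR_const_mul, fourierR_const_mul, fourierR_conv hr (integrable_convPow hl _),
    fourierR_convPow hw (by omega), fourierR_convPow hl (by omega), fourierR_convPow hl (by omega),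
    fourierR_indicator_Ici hw]
  push_cast
  ring

namespace IsNearGaussian
variable {w : ℝ → ℝ} {C η : ℝ}

lemma norm_fourierR_left_le (h : IsNearGaussian w C η) (hη : η ≤ 1 / 4) (ξ : ℝ) :
    ‖fourierR ((Iio (-2)).indicator w) ξ‖ ≤ 1 / 2 :=
  (_root_.norm_fourierR_le (indicator_nonneg fun x _ => h.nonneg x) ξ).trans
    (h.integral_indicator_Iio_le hη)

lemma indicator_Ici_le (h : IsNearGaussian w C η) (u : ℝ) : (Ici (-2)).indicator w u ≤ C := by
  by_cases hu : -2 ≤ u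
  · rw [indicator_of_mem (by exact hu)]; exact h.le_of_ge u hu
  · rw [indicator_of_notMem (by exact hu)]; exact h.const_nonneg

lemma integral_indicator_Ici_le (h : IsNearGaussian w C η) :
    ∫ u, (Ici (-2)).indicator w u ≤ 1 := by
  rw [← h.integral_eq_one]
  exact integral_mono (h.integrable.indicator measurableSet_Ici) h.integrable
    fun u => indicator_le_self' (fun x _ => h.nonneg x) u

lemma norm_fourierR_right_le (h : IsNearGaussian w C η) (ξ : ℝ) :
    ‖fourierR w ξ - fourierR ((Iio (-2)).indicator w) ξ‖ ≤ 1 := by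
  rw [← fourierR_indicator_Ici h.integrable]
  exact (_root_.norm_fourierR_le (indicator_nonneg fun x _ => h.nonneg x) ξ).trans
    h.integral_indicator_Ici_le

lemma integral_norm_fourierR_right_sq_le (h : IsNearGaussian w C η) :
    Integrable (fun ξ => ‖fourierR w ξ - fourierR ((Iio (-2)).indicator w) ξ‖ ^ 2) ∧
      ∫ ξ, ‖fourierR w ξ - fourierR ((Iio (-2)).indicator w) ξ‖ ^ 2 ≤ C := by
  simp_rw [← fourierR_indicator_Ici h.integrable]
  have := fourierR_norm_sq_le (h.integrable.indicator measurableSet_Ici)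
    (indicator_nonneg fun x _ => h.nonneg x) h.indicator_Ici_le
  refine ⟨this.1, this.2.trans ?_⟩
  nlinarith [h.integral_indicator_Ici_le, h.const_nonneg]

lemma norm_fourierR_pow_sub_le (h : IsNearGaussian w C η) {ξ : ℝ} (hξ : |ξ| ≤ 1 / 6) (M : ℕ) :
    ‖fourierR w ξ ^ M - (exp (-2 * π ^ 2 * M * ξ ^ 2) : ℝ)‖ ≤
      M * (4 * (2 * π) ^ 3 * C * |ξ| ^ 3 + 2 * π ^ 2 * ξ ^ 2 * η + 4 * π ^ 4 * ξ ^ 4) := by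
  have hpi : π ^ 2 ≤ 10 := by nlinarith [pi_lt_d2, pi_gt_three]
  have hx : ξ ^ 2 ≤ 1 / 36 := by rw [← sq_abs]; nlinarith [abs_nonneg ξ]
  have hpx : π ^ 2 * ξ ^ 2 ≤ 10 / 36 := by nlinarith [sq_nonneg ξ, sq_nonneg π]
  have hpx0 : 0 ≤ π ^ 2 * ξ ^ 2 := by positivity
  set x := -2 * π ^ 2 * ξ ^ 2 with hxdef
  have e1 : ((exp (-2 * π ^ 2 * M * ξ ^ 2) : ℝ) : ℂ) = ((exp x : ℝ) : ℂ) ^ M := by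
    rw [← Complex.ofReal_pow, ← Real.exp_nat_mul]
    congr 2; rw [hxdef]; ring
  rw [e1]
  have hn : ‖((exp x : ℝ) : ℂ)‖ ≤ 1 := by
    rw [Complex.norm_real, norm_of_nonneg (exp_pos _).le, exp_le_one_iff, hxdef]
    linarith
  refine (norm_pow_sub_pow_le_mul (h.norm_fourierR_le_one ξ) hn M).trans ?_
  refine mul_le_mul_of_nonneg_left ?_ (Nat.cast_nonneg M)
  set m := ∫ u, u ^ 2 * w u with hm
  have e2 : fourierR w ξ - ((exp x : ℝ) : ℂ) =
      (fourierR w ξ - ((1 - 2 * π ^ 2 * ξ ^ 2 * m : ℝ) : ℂ)) +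
      ((-(2 * π ^ 2 * ξ ^ 2) * (m - 1) : ℝ) : ℂ) + ((-(exp x - 1 - x) : ℝ) : ℂ) := by
    rw [hxdef]; push_cast; ring
  rw [e2]
  refine (norm_add_le _ _).trans (add_le_add ((norm_add_le _ _).trans
    (add_le_add (h.fourierR_taylor ξ) ?_)) ?_)
  · rw [Complex.norm_real, norm_eq_abs, abs_mul, abs_neg, abs_of_nonneg (by positivity)]
    exact mul_le_mul_of_nonneg_left h.variance (by positivity)
  · rw [Complex.norm_real, norm_eq_abs, abs_neg]
    refine (Real.abs_exp_sub_one_sub_id_le (x := x) ?_).trans_eq (by rw [hxdef]; ring)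
    rw [hxdef, abs_le]; constructor <;> linarith

end IsNearGaussian

lemma integrable_exp_neg_pi_sq : Integrable fun x : ℝ => exp (-π ^ 2 * x ^ 2) := by
  have := integrable_exp_neg_mul_sq (b := π ^ 2) (by positivity)
  simpa using this

lemma integrable_exp_neg_two_pi_sq : Integrable fun x : ℝ => exp (-2 * π ^ 2 * x ^ 2) := by
  have := integrable_exp_neg_mul_sq (b := 2 * π ^ 2) (by positivity)
  simpa using this

/-- Central limit theorem for Fourier transforms on a fixed neighbourhood of the origin. -/
lemma tendsto_integral_norm_fourierR_pow_sub {w : ℕ → ℝ → ℝ} {C : ℝ} {η : ℕ → ℝ}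
    (hw : ∀ n, IsNearGaussian (w n) C (η n)) (hη : Tendsto η atTop (𝓝 0))
    {δ : ℝ} (hδ : δ ≤ 1 / 6) (hδC : 4 * (2 * π) ^ 3 * C * δ ≤ π ^ 2 / 2)
    {M : ℕ → ℕ} (hM : Tendsto M atTop atTop) :
    Tendsto (fun n => √(M n) * ∫ ξ, (Icc (-δ) δ).indicator
      (fun ξ => ‖fourierR (w n) ξ ^ (M n) - (exp (-2 * π ^ 2 * M n * ξ ^ 2) : ℝ)‖) ξ)
      atTop (𝓝 0) := by
  have hMr : Tendsto (fun n => (M n : ℝ)) atTop atTop := tendsto_natCast_atTop_atTop.comp hM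
  have hS : Tendsto (fun n => √(M n : ℝ)) atTop atTop := tendsto_sqrt_atTop.comp hMr
  have hC := (hw 0).const_nonneg
  have hpos : ∀ᶠ n in atTop, 0 < √(M n : ℝ) := hS.eventually_gt_atTop 0
  have hsmall : ∀ᶠ n in atTop, η n ≤ 1 / 4 := hη.eventually_le_const (by norm_num)
  set F : ℕ → ℝ → ℝ := fun n => (Icc (-δ) δ).indicator
      (fun ξ => ‖fourierR (w n) ξ ^ (M n) - (exp (-2 * π ^ 2 * M n * ξ ^ 2) : ℝ)‖) with hF
  have key : Tendsto (fun n => ∫ τ, F n (0 + (√(M n))⁻¹ * τ)) atTop (𝓝 (∫ _ : ℝ, (0 : ℝ))) := by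
    refine tendsto_integral_filter_of_dominated_convergence
      (fun τ => exp (-π ^ 2 * τ ^ 2) + exp (-2 * π ^ 2 * τ ^ 2)) ?_ ?_
      (integrable_exp_neg_pi_sq.add integrable_exp_neg_two_pi_sq) ?_
    · refine .of_forall fun n => Measurable.aestronglyMeasurable ?_
      have hm : Measurable (F n) := by
        refine Measurable.indicator ?_ measurableSet_Icc
        have := (continuous_fourierR (hw n).integrable)
        refine Continuous.measurable ?_
        fun_prop
      exact hm.comp (by fun_prop)
    · filter_upwards [hpos, hsmall] with n hn hηn
      filter_upwards with τ
      have hsq : √(M n : ℝ) ^ 2 = M n := Real.sq_sqrt (Nat.cast_nonneg _)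
      set ξ := 0 + (√(M n))⁻¹ * τ with hξ
      have hξ2 : (M n : ℝ) * ξ ^ 2 = τ ^ 2 := by
        rw [hξ, zero_add, mul_pow, inv_pow, hsq]
        have : (M n : ℝ) ≠ 0 := by rw [← hsq]; positivity
        field_simp
      rw [norm_of_nonneg (indicator_nonneg (fun _ _ => norm_nonneg _) _)]
      by_cases hmem : ξ ∈ Icc (-δ) δ
      · simp only [indicator_of_mem hmem]
        have hab : |ξ| ≤ δ := abs_le.2 hmem
        refine (norm_sub_le _ _).trans (add_le_add ?_ ?_)
        · rw [norm_pow]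
          refine (pow_le_pow_left₀ (norm_nonneg _) ((hw n).norm_fourierR_le_exp hηn
            (hab.trans hδ)
            ((mul_le_mul_of_nonneg_left hab (by positivity)).trans hδC)) _).trans_eq ?_
          rw [← Real.exp_nat_mul, ← hξ2]; congr 1; ring
        · rw [Complex.norm_real, norm_of_nonneg (exp_pos _).le, ← hξ2]
          exact (congrArg exp (by ring)).le
      · simp only [indicator_of_notMem hmem]; positivity
    · filter_upwards with τ
      have hlim : Tendsto (fun n => 4 * (2 * π) ^ 3 * C * |τ| ^ 3 * (√(M n : ℝ))⁻¹
          + 2 * π ^ 2 * τ ^ 2 * η n + 4 * π ^ 4 * τ ^ 4 * (M n : ℝ)⁻¹) atTop (𝓝 0) := by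
        have := ((hS.inv_tendsto_atTop.const_mul (4 * (2 * π) ^ 3 * C * |τ| ^ 3)).add
          (hη.const_mul (2 * π ^ 2 * τ ^ 2))).add
          (hMr.inv_tendsto_atTop.const_mul (4 * π ^ 4 * τ ^ 4))
        simpa using this
      refine tendsto_of_tendsto_of_tendsto_of_le_of_le' tendsto_const_nhds hlim
        (.of_forall fun n => indicator_nonneg (fun _ _ => norm_nonneg _) _) ?_
      filter_upwards [hpos] with n hn
      have hη0 : 0 ≤ η n := (abs_nonneg _).trans (hw n).variance
      have hsq : √(M n : ℝ) ^ 2 = M n := Real.sq_sqrt (Nat.cast_nonneg _)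
      set ξ := 0 + (√(M n))⁻¹ * τ with hξ
      by_cases hmem : ξ ∈ Icc (-δ) δ
      · simp only [hF, indicator_of_mem hmem]
        have hab : |ξ| ≤ δ := abs_le.2 hmem
        refine ((hw n).norm_fourierR_pow_sub_le (hab.trans hδ) (M n)).trans_eq ?_
        rw [hξ, zero_add, abs_mul, abs_inv, abs_of_pos hn]
        set s := √(M n : ℝ)
        rw [← hsq]
        field_simp
      · simp only [hF, indicator_of_notMem hmem]; positivity
  rw [integral_zero] at key
  refine key.congr' ?_
  filter_upwards [hpos] with n hn
  rw [integral_comp_affine (F n) (inv_pos.2 hn) 0, ← mul_assoc, mul_inv_cancel₀ hn.ne', one_mul]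

lemma integrable_exp_neg_two_pi_sq_mul {M : ℝ} (hM : 0 < M) :
    Integrable fun x : ℝ => exp (-2 * π ^ 2 * M * x ^ 2) := by
  have := integrable_exp_neg_mul_sq (b := 2 * π ^ 2 * M) (by positivity)
  simpa using this

lemma integrable_abs_mul_exp_neg_two_pi_sq_mul {M : ℝ} (hM : 0 < M) :
    Integrable fun x : ℝ => |x| * exp (-2 * π ^ 2 * M * x ^ 2) := by
  have := (integrable_mul_exp_neg_mul_sq (b := 2 * π ^ 2 * M) (by positivity)).norm
  refine this.congr (.of_forall fun x => ?_)
  simp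

namespace IsNearGaussian
variable {w : ℝ → ℝ} {C η : ℝ}

lemma norm_fourierR_mainConv_sub_le (h : IsNearGaussian w C η) (hη : η ≤ 1 / 4) {δ κ : ℝ}
    (hδ : 0 < δ) (hκ : 1 / 2 ≤ κ) (hκφ : ∀ ξ, δ < |ξ| → ‖fourierR w ξ‖ ≤ κ) (k : ℕ) (ξ : ℝ) :
    ‖fourierR (mainConv w k) ξ - (exp (-2 * π ^ 2 * (k + 2 : ℕ) * ξ ^ 2) : ℝ)‖ ≤
      (Icc (-δ) δ).indicator (fun ξ => ‖fourierR w ξ ^ (k + 2)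
        - (exp (-2 * π ^ 2 * (k + 2 : ℕ) * ξ ^ 2) : ℝ)‖) ξ
      + (Icc (-δ) δ).indicator (fun _ => (((k + 2 : ℕ) : ℝ) + 1) * (1 / 2) ^ (k + 1)) ξ
      + ((k + 2 : ℕ) : ℝ) ^ 2 * κ ^ k *
        ‖fourierR w ξ - fourierR ((Iio (-2)).indicator w) ξ‖ ^ 2
      + exp (-π ^ 2 * δ ^ 2) ^ k * exp (-π ^ 2 * ξ ^ 2) := by
  rw [fourierR_mainConv h.integrable]
  have hl := h.norm_fourierR_left_le hη ξ
  have hr := h.norm_fourierR_right_le ξ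
  set φ := fourierR w ξ
  set φl := fourierR ((Iio (-2)).indicator w) ξ
  set G : ℂ := ((exp (-2 * π ^ 2 * (k + 2 : ℕ) * ξ ^ 2) : ℝ) : ℂ) with hG
  have hκ0 : 0 ≤ κ := by linarith
  by_cases hmem : ξ ∈ Icc (-δ) δ
  · rw [indicator_of_mem hmem, indicator_of_mem hmem]
    have e : φ ^ (k + 2) - φl ^ (k + 2) - (k + 2 : ℕ) * ((φ - φl) * φl ^ (k + 1)) - G =
      (φ ^ (k + 2) - G) - (φl ^ (k + 2) + (k + 2 : ℕ) * ((φ - φl) * φl ^ (k + 1))) := by ring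
    rw [e]
    have h1 : ‖φl ^ (k + 2) + (k + 2 : ℕ) * ((φ - φl) * φl ^ (k + 1))‖ ≤
        (((k + 2 : ℕ) : ℝ) + 1) * (1 / 2) ^ (k + 1) := by
      refine (norm_add_le _ _).trans ?_
      rw [norm_mul, norm_mul, Complex.norm_natCast, norm_pow, norm_pow]
      have h2 : ‖φl‖ ^ (k + 1) ≤ (1 / 2) ^ (k + 1) := pow_le_pow_left₀ (norm_nonneg _) hl _
      have h3 : ‖φl‖ ^ (k + 2) ≤ (1 / 2) ^ (k + 1) := by
        rw [pow_succ]
        nlinarith [pow_nonneg (norm_nonneg φl) (k + 1), norm_nonneg φl]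
      have h4 : ((k + 2 : ℕ) : ℝ) * (‖φ - φl‖ * ‖φl‖ ^ (k + 1)) ≤
          ((k + 2 : ℕ) : ℝ) * (1 * (1 / 2) ^ (k + 1)) := by gcongr
      linarith
    have h5 := norm_sub_le (φ ^ (k + 2) - G)
      (φl ^ (k + 2) + (k + 2 : ℕ) * ((φ - φl) * φl ^ (k + 1)))
    have h6 : 0 ≤ ((k + 2 : ℕ) : ℝ) ^ 2 * κ ^ k * ‖φ - φl‖ ^ 2 := by positivity
    have h7 : 0 ≤ exp (-π ^ 2 * δ ^ 2) ^ k * exp (-π ^ 2 * ξ ^ 2) := by positivity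
    linarith
  · rw [indicator_of_notMem hmem, indicator_of_notMem hmem]
    have hlt : δ < |ξ| := by
      by_contra hcon
      exact hmem (abs_le.1 (not_lt.1 hcon))
    refine (norm_sub_le _ _).trans ?_
    have h1 := norm_pow_sub_linear_le (hκφ ξ hlt) (hl.trans hκ) k
    have h2 : ‖G‖ ≤ exp (-π ^ 2 * δ ^ 2) ^ k * exp (-π ^ 2 * ξ ^ 2) := by
      rw [hG, Complex.norm_real, norm_of_nonneg (exp_pos _).le, ← Real.exp_nat_mul, ← Real.exp_add,
        exp_le_exp]
      have h3 : δ ^ 2 ≤ ξ ^ 2 := by rw [← sq_abs ξ]; gcongr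
      have h4 : (k : ℝ) * π ^ 2 * δ ^ 2 ≤ k * π ^ 2 * ξ ^ 2 := by gcongr
      have h5 : 0 ≤ (k : ℝ) * π ^ 2 * ξ ^ 2 := by positivity
      have h6 : 0 ≤ π ^ 2 * ξ ^ 2 := by positivity
      push_cast
      nlinarith
    linarith

lemma integrable_bound (h : IsNearGaussian w C η) (δ : ℝ) (k : ℕ) :
    Integrable ((Icc (-δ) δ).indicator (fun ξ => ‖fourierR w ξ ^ (k + 2)
        - (exp (-2 * π ^ 2 * (k + 2 : ℕ) * ξ ^ 2) : ℝ)‖)) := by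
  rw [integrable_indicator_iff measurableSet_Icc]
  refine ContinuousOn.integrableOn_Icc (Continuous.continuousOn ?_)
  have := continuous_fourierR h.integrable
  fun_prop

lemma integrable_fourierR_mainConv_sub (h : IsNearGaussian w C η) (hη : η ≤ 1 / 4) {δ κ : ℝ}
    (hδ : 0 < δ) (hκ : 1 / 2 ≤ κ) (hκφ : ∀ ξ, δ < |ξ| → ‖fourierR w ξ‖ ≤ κ) (k : ℕ) :
    Integrable (fun ξ => fourierR (mainConv w k) ξ -
      (exp (-2 * π ^ 2 * (k + 2 : ℕ) * ξ ^ 2) : ℝ)) ∧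
    ∫ ξ, ‖fourierR (mainConv w k) ξ - (exp (-2 * π ^ 2 * (k + 2 : ℕ) * ξ ^ 2) : ℝ)‖ ≤
      (∫ ξ, (Icc (-δ) δ).indicator (fun ξ => ‖fourierR w ξ ^ (k + 2)
        - (exp (-2 * π ^ 2 * (k + 2 : ℕ) * ξ ^ 2) : ℝ)‖) ξ)
      + 2 * δ * ((((k + 2 : ℕ) : ℝ) + 1) * (1 / 2) ^ (k + 1))
      + ((k + 2 : ℕ) : ℝ) ^ 2 * κ ^ k * C
      + exp (-π ^ 2 * δ ^ 2) ^ k * ∫ ξ, exp (-π ^ 2 * ξ ^ 2) := by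
  have hκ0 : 0 ≤ κ := by linarith
  have i1 := h.integrable_bound δ k
  have i2 : Integrable ((Icc (-δ) δ).indicator
      (fun _ => (((k + 2 : ℕ) : ℝ) + 1) * (1 / 2) ^ (k + 1))) := by
    rw [integrable_indicator_iff measurableSet_Icc]
    exact continuousOn_const.integrableOn_Icc
  have i3 := h.integral_norm_fourierR_right_sq_le.1.const_mul (((k + 2 : ℕ) : ℝ) ^ 2 * κ ^ k)
  have i4 := integrable_exp_neg_pi_sq.const_mul (exp (-π ^ 2 * δ ^ 2) ^ k)
  have hb := h.norm_fourierR_mainConv_sub_le hη hδ hκ hκφ k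
  have j2 := i1.add i2
  have j3 := j2.add i3
  have j4 := j3.add i4
  have hInt : Integrable (fun ξ => fourierR (mainConv w k) ξ -
      (exp (-2 * π ^ 2 * (k + 2 : ℕ) * ξ ^ 2) : ℝ)) := by
    refine j4.mono' (Continuous.aestronglyMeasurable ?_) (.of_forall hb)
    have := continuous_fourierR (integrable_mainConv h.integrable k)
    fun_prop
  refine ⟨hInt, (integral_mono hInt.norm j4 hb).trans ?_⟩
  rw [integral_add' j3 i4, integral_add' j2 i3, integral_add' i1 i2, integral_const_mul,
    integral_const_mul, integral_indicator_const _ measurableSet_Icc]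
  have : volume.real (Icc (-δ) δ) = 2 * δ := by
    rw [Measure.real, Real.volume_Icc, ENNReal.toReal_ofReal (by linarith)]; ring
  rw [this, smul_eq_mul]
  gcongr
  exact h.integral_norm_fourierR_right_sq_le.2

/-- Inversion formula estimate for the main part of a convolution power. -/
lemma ae_abs_sqrt_mul_mainConv_sub_le (h : IsNearGaussian w C η) {k : ℕ}
    (hInt : Integrable (fun ξ => fourierR (mainConv w k) ξ -
      (exp (-2 * π ^ 2 * (k + 2 : ℕ) * ξ ^ 2) : ℝ))) :
    ∀ᵐ v, |√(k + 2 : ℕ) * mainConv w k v - ∫ τ, exp (-2 * π ^ 2 * τ ^ 2)| ≤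
      √(k + 2 : ℕ) * (∫ ξ, ‖fourierR (mainConv w k) ξ -
        (exp (-2 * π ^ 2 * (k + 2 : ℕ) * ξ ^ 2) : ℝ)‖) +
      2 * π * |v| * (∫ τ, |τ| * exp (-2 * π ^ 2 * τ ^ 2)) / √(k + 2 : ℕ) := by
  have hM : (0 : ℝ) < (k + 2 : ℕ) := by positivity
  set M : ℝ := ((k + 2 : ℕ) : ℝ) with hMdef
  have hS : 0 < √M := sqrt_pos.2 hM
  have hsq : √M ^ 2 = M := Real.sq_sqrt hM.le
  have iG := integrable_exp_neg_two_pi_sq_mul hM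
  have iG1 := integrable_abs_mul_exp_neg_two_pi_sq_mul hM
  have iGc : Integrable (fun ξ : ℝ => ((exp (-2 * π ^ 2 * M * ξ ^ 2) : ℝ) : ℂ)) := iG.ofReal
  have hVint : Integrable (fourierR (mainConv w k)) := by
    refine (hInt.add iGc).congr (.of_forall fun ξ => ?_)
    simp
  have e0 : ∫ τ, exp (-2 * π ^ 2 * τ ^ 2) = √M * ∫ ξ, exp (-2 * π ^ 2 * M * ξ ^ 2) := by
    rw [integral_comp_affine _ hS 0]
    congr 2 with ξ
    rw [zero_add, mul_pow, hsq]; ring_nf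
  have e1 : ∫ τ, |τ| * exp (-2 * π ^ 2 * τ ^ 2) = M * ∫ ξ, |ξ| * exp (-2 * π ^ 2 * M * ξ ^ 2) := by
    have e2 (I : ℝ) : M * I = √M * (√M * I) := by rw [← mul_assoc, ← sq, hsq]
    rw [e2, integral_comp_affine _ hS 0]
    refine congrArg (√M * ·) (Eq.trans (integral_congr_ae (.of_forall fun ξ => ?_))
      (integral_const_mul _ _))
    simp only []
    rw [zero_add, mul_pow, abs_mul, abs_of_pos hS, hsq]; ring_nf
  rw [e0, e1]
  filter_upwards [ae_eq_fourierInv_fourier (integrable_mainConv h.integrable k).ofReal hVint]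
    with v hv
  rw [Real.fourierInv_eq'] at hv
  have hv' : (mainConv w k v : ℂ) = ∫ ξ, Complex.exp (((2 * π * (v * ξ) : ℝ) : ℂ) * Complex.I) *
      fourierR (mainConv w k) ξ := by
    refine hv.trans (integral_congr_ae (.of_forall fun ξ => ?_))
    simp only [RCLike.inner_apply, conj_trivial, smul_eq_mul]
    rw [fourierR]
    congr 3
  have hunit : ∀ ξ : ℝ, ‖Complex.exp (((2 * π * (v * ξ) : ℝ) : ℂ) * Complex.I)‖ = 1 := fun ξ =>
    Complex.norm_exp_ofReal_mul_I _
  have ie : Integrable (fun ξ => Complex.exp (((2 * π * (v * ξ) : ℝ) : ℂ) * Complex.I) *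
      fourierR (mainConv w k) ξ) :=
    hVint.bdd_mul (c := 1) (Continuous.aestronglyMeasurable (by fun_prop))
      (.of_forall fun ξ => (hunit ξ).le)
  have e2 : ((mainConv w k v - ∫ ξ, exp (-2 * π ^ 2 * M * ξ ^ 2) : ℝ) : ℂ) =
      ∫ ξ, (Complex.exp (((2 * π * (v * ξ) : ℝ) : ℂ) * Complex.I) *
      fourierR (mainConv w k) ξ - ((exp (-2 * π ^ 2 * M * ξ ^ 2) : ℝ) : ℂ)) := by
    rw [integral_sub ie iGc, ← hv', integral_complex_ofReal]
    push_cast; rfl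
  have hbound : |mainConv w k v - ∫ ξ, exp (-2 * π ^ 2 * M * ξ ^ 2)| ≤
      (∫ ξ, ‖fourierR (mainConv w k) ξ - (exp (-2 * π ^ 2 * M * ξ ^ 2) : ℝ)‖) +
      2 * π * |v| * ∫ ξ, |ξ| * exp (-2 * π ^ 2 * M * ξ ^ 2) := by
    rw [← norm_eq_abs, ← Complex.norm_real, e2, ← integral_const_mul,
      ← integral_add hInt.norm (iG1.const_mul _)]
    refine norm_integral_le_of_norm_le (hInt.norm.add (iG1.const_mul _)) (.of_forall fun ξ => ?_)
    set E := Complex.exp (((2 * π * (v * ξ) : ℝ) : ℂ) * Complex.I) with hE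
    set G := exp (-2 * π ^ 2 * M * ξ ^ 2)
    have e3 : E * fourierR (mainConv w k) ξ - (G : ℂ) =
      E * (fourierR (mainConv w k) ξ - (G : ℂ)) + (E - 1) * (G : ℂ) := by ring
    rw [e3]
    refine (norm_add_le _ _).trans (add_le_add ?_ ?_)
    · rw [norm_mul, hunit, one_mul]
    · rw [norm_mul, Complex.norm_real, norm_of_nonneg (exp_pos _).le]
      have := Real.norm_exp_I_mul_ofReal_sub_one_le (x := 2 * π * (v * ξ))
      rw [mul_comm Complex.I, ← hE, norm_eq_abs, abs_mul, abs_mul, abs_mul, abs_of_pos pi_pos,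
        abs_two] at this
      refine (mul_le_mul_of_nonneg_right this (exp_pos _).le).trans_eq ?_
      change _ = 2 * π * |v| * (|ξ| * G)
      ring
  have e4 : √M * mainConv w k v - √M * ∫ ξ, exp (-2 * π ^ 2 * M * ξ ^ 2) =
    √M * (mainConv w k v - ∫ ξ, exp (-2 * π ^ 2 * M * ξ ^ 2)) := by ring
  rw [e4, abs_mul, abs_of_pos hS]
  refine (mul_le_mul_of_nonneg_left hbound hS.le).trans_eq ?_
  set I1 := ∫ ξ, |ξ| * exp (-2 * π ^ 2 * M * ξ ^ 2)
  rw [mul_add, add_right_inj, ← hsq]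
  rw [Real.sqrt_sq hS.le]
  field_simp

end IsNearGaussian

lemma tendsto_sqrt_mul_integral_fourierR_mainConv_sub {w : ℕ → ℝ → ℝ} {C : ℝ} {η : ℕ → ℝ}
    (hw : ∀ n, IsNearGaussian (w n) C (η n)) (hη : Tendsto η atTop (𝓝 0))
    {k : ℕ → ℕ} (hk : Tendsto k atTop atTop) :
    (∀ᶠ n in atTop, Integrable (fun ξ => fourierR (mainConv (w n) (k n)) ξ -
      (exp (-2 * π ^ 2 * (k n + 2 : ℕ) * ξ ^ 2) : ℝ))) ∧
    Tendsto (fun n => √(k n + 2 : ℕ) * ∫ ξ, ‖fourierR (mainConv (w n) (k n)) ξ -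
      (exp (-2 * π ^ 2 * (k n + 2 : ℕ) * ξ ^ 2) : ℝ)‖) atTop (𝓝 0) := by
  have hC := (hw 0).const_nonneg
  obtain ⟨δ, hδ0, hδ, hδC⟩ : ∃ δ > (0 : ℝ), δ ≤ 1 / 6 ∧ 4 * (2 * π) ^ 3 * C * δ ≤ π ^ 2 / 2 := by
    have hD : 0 < 4 * (2 * π) ^ 3 * (C + 1) := by positivity
    refine ⟨min (1 / 6) (π ^ 2 / 2 / (4 * (2 * π) ^ 3 * (C + 1))), by positivity,
      min_le_left _ _, ?_⟩
    calc _ ≤ 4 * (2 * π) ^ 3 * (C + 1) * (π ^ 2 / 2 / (4 * (2 * π) ^ 3 * (C + 1))) := by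
          gcongr
          · linarith
          · exact min_le_right _ _
      _ = _ := mul_div_cancel₀ _ hD.ne'
  set s := exp (-2 * π ^ 2 * δ ^ 2) with hs
  have hs1 : s < 1 := by
    rw [hs, exp_lt_one_iff]
    have : 0 < π ^ 2 * δ ^ 2 := by positivity
    linarith
  set κ := max (3 / 4) ((1 + s) / 2) with hκ
  have hκ1 : κ < 1 := max_lt (by norm_num) (by linarith)
  have hκh : 3 / 4 ≤ κ := le_max_left _ _
  set R := max κ (exp (-π ^ 2 * δ ^ 2)) with hR
  have hR1 : R < 1 := by
    refine max_lt hκ1 (exp_lt_one_iff.2 ?_)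
    have : 0 < π ^ 2 * δ ^ 2 := by positivity
    linarith
  have hκR : κ ≤ R := le_max_left _ _
  have hR0 : 0 < R := by linarith
  have hev : ∀ᶠ n in atTop, η n ≤ 1 / 4 ∧ ∀ ξ, δ < |ξ| → ‖fourierR (w n) ξ‖ ≤ κ := by
    filter_upwards [hη.eventually_le_const (show (0 : ℝ) < 1 / 4 by norm_num),
      hη.eventually_le_const (show 0 < (1 - s) / 2 by linarith)] with n h1 h2
    refine ⟨h1, fun ξ hξ => ((hw n).norm_fourierR_le ξ).trans ?_⟩
    have h3 : exp (-2 * π ^ 2 * ξ ^ 2) ≤ s := by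
      rw [hs, exp_le_exp]
      have h3 : δ ^ 2 ≤ ξ ^ 2 := by rw [← sq_abs ξ]; gcongr
      have : π ^ 2 * δ ^ 2 ≤ π ^ 2 * ξ ^ 2 := by gcongr
      linarith
    exact le_trans (by linarith) (le_max_right (3 / 4) ((1 + s) / 2))
  refine ⟨?_, ?_⟩
  · filter_upwards [hev] with n hn
    exact ((hw n).integrable_fourierR_mainConv_sub hn.1 hδ0 (by linarith) hn.2 _).1
  · set I0 := ∫ ξ, exp (-π ^ 2 * ξ ^ 2) with hI0
    have hI0' : 0 ≤ I0 := integral_nonneg fun _ => (exp_pos _).le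
    have hM : Tendsto (fun n => k n + 2) atTop atTop := (tendsto_add_atTop_nat 2).comp hk
    have lim := (tendsto_integral_norm_fourierR_pow_sub hw hη hδ hδC hM).add
      (((tendsto_add_two_pow_three_mul_pow hR0 hR1).comp hk).const_mul (4 * δ + C + I0))
    rw [mul_zero, add_zero] at lim
    refine tendsto_of_tendsto_of_tendsto_of_le_of_le' tendsto_const_nhds lim
      (.of_forall fun n => by positivity) ?_
    filter_upwards [hev] with n hn
    have hle := ((hw n).integrable_fourierR_mainConv_sub hn.1 hδ0 (by linarith) hn.2 (k n)).2
    refine (mul_le_mul_of_nonneg_left hle (sqrt_nonneg _)).trans ?_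
    rw [mul_add, mul_add, mul_add, add_assoc, add_assoc]
    refine add_le_add le_rfl ?_
    simp only [Function.comp]
    have hM1 : (1 : ℝ) ≤ (k n + 2 : ℕ) := by push_cast; linarith [(k n).cast_nonneg (α := ℝ)]
    set M : ℝ := ((k n + 2 : ℕ) : ℝ)
    have hS1 : √M ≤ M := by
      rw [Real.sqrt_le_left (by linarith)]; nlinarith
    have p1 : (1 / 2 : ℝ) ^ (k n + 1) ≤ R ^ (k n) := by
      rw [pow_succ]
      have : (1 / 2 : ℝ) ^ (k n) ≤ R ^ (k n) := pow_le_pow_left₀ (by norm_num) (by linarith) _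
      have h0 : (0 : ℝ) ≤ (1 / 2 : ℝ) ^ (k n) := by positivity
      linarith
    have p2 : κ ^ (k n) ≤ R ^ (k n) := pow_le_pow_left₀ (by linarith) hκR _
    have p3 : exp (-π ^ 2 * δ ^ 2) ^ (k n) ≤ R ^ (k n) :=
      pow_le_pow_left₀ (exp_pos _).le (le_max_right _ _) _
    set r := R ^ (k n)
    have hr : 0 ≤ r := by positivity
    have M2 : M ^ 2 ≤ M ^ 3 := pow_le_pow_right₀ hM1 (by norm_num)
    have M1 : M ≤ M ^ 3 := le_self_pow₀ hM1 (by norm_num)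
    have t1 : √M * (2 * δ * ((M + 1) * (1 / 2) ^ (k n + 1))) ≤ 4 * δ * (M ^ 3 * r) := by
      calc _ ≤ M * (2 * δ * ((M + 1) * r)) := by gcongr
        _ = 2 * δ * ((M ^ 2 + M) * r) := by ring
        _ ≤ 2 * δ * ((M ^ 3 + M ^ 3) * r) := by gcongr
        _ = _ := by ring
    have t2 : √M * (M ^ 2 * κ ^ (k n) * C) ≤ C * (M ^ 3 * r) := by
      calc _ ≤ M * (M ^ 2 * r * C) := by gcongr
        _ = _ := by ring
    have t3 : √M * (exp (-π ^ 2 * δ ^ 2) ^ (k n) * I0) ≤ I0 * (M ^ 3 * r) := by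
      calc _ ≤ M ^ 3 * (r * I0) := by gcongr; exact hS1.trans M1
        _ = _ := by ring
    linarith

namespace IsNearGaussian
variable {w : ℝ → ℝ} {C η : ℝ}

lemma integral_abs_mul_le (h : IsNearGaussian w C η) : ∫ u, |u| * w u ≤ 1 + C := by
  have h1 : Integrable (fun u => |u| * w u) := by
    simpa using integrable_abs_pow_mul h.integrable h.integrable_cube (j := 1) (by norm_num)
  have : ∫ u, |u| * w u ≤ ∫ u, (w u + |u| ^ 3 * w u) := by
    refine integral_mono h1 (h.integrable.add h.integrable_cube) fun u => ?_
    have : |u| ≤ 1 + |u| ^ 3 := by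
      rcases le_total |u| 1 with hu | hu
      · linarith [pow_nonneg (abs_nonneg u) 3]
      · linarith [le_self_pow₀ hu (n := 3) (by norm_num)]
    have h0 := h.nonneg u
    change |u| * w u ≤ w u + |u| ^ 3 * w u
    nlinarith
  rw [integral_add h.integrable h.integrable_cube, h.integral_eq_one] at this
  linarith [h.cube_le]

/-- Weighted distance between a normalized convolution power and its Gaussian value at `0`. -/
lemma integral_mul_abs_sqrt_mul_convPow_sub_le (h : IsNearGaussian w C η) (hη : η ≤ 1 / 4) {k : ℕ}
    (hInt : Integrable (fun ξ => fourierR (mainConv w k) ξ -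
      (exp (-2 * π ^ 2 * (k + 2 : ℕ) * ξ ^ 2) : ℝ))) :
    Integrable (fun u => w u * |√(k + 2 : ℕ) * convPow w (k + 2) (-u)
      - ∫ τ, exp (-2 * π ^ 2 * τ ^ 2)|) ∧
    ∫ u, w u * |√(k + 2 : ℕ) * convPow w (k + 2) (-u) - ∫ τ, exp (-2 * π ^ 2 * τ ^ 2)| ≤
      √(k + 2 : ℕ) * (∫ ξ, ‖fourierR (mainConv w k) ξ -
        (exp (-2 * π ^ 2 * (k + 2 : ℕ) * ξ ^ 2) : ℝ)‖) +
      2 * π * (1 + C) * (∫ τ, |τ| * exp (-2 * π ^ 2 * τ ^ 2)) / √(k + 2 : ℕ) +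
      2 * C * (((k + 2 : ℕ) : ℝ) ^ 3 * (1 / 2) ^ k) := by
  set wl := (Iio (-2)).indicator w with hwl
  have hl : Integrable wl := h.integrable.indicator measurableSet_Iio
  have hl0 : ∀ x, 0 ≤ wl x := indicator_nonneg fun x _ => h.nonneg x
  have hr0 : ∀ x, 0 ≤ (Ici (-2)).indicator w x := indicator_nonneg fun x _ => h.nonneg x
  have hC := h.const_nonneg
  have hM1 : (1 : ℝ) ≤ (k + 2 : ℕ) := by push_cast; linarith [k.cast_nonneg (α := ℝ)]
  have hmain := h.ae_abs_sqrt_mul_mainConv_sub_le hInt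
  set c1 := ∫ τ, |τ| * exp (-2 * π ^ 2 * τ ^ 2) with hc1
  have hc1' : 0 ≤ c1 := integral_nonneg fun _ => by positivity
  set E := ∫ ξ, ‖fourierR (mainConv w k) ξ - (exp (-2 * π ^ 2 * (k + 2 : ℕ) * ξ ^ 2) : ℝ)‖ with hE
  set c0 := ∫ τ, exp (-2 * π ^ 2 * τ ^ 2) with hc0
  have hconv : ∀ v, |((k + 2 : ℕ) : ℝ) * ∫ y, (Ici (-2)).indicator w y * convPow wl (k + 1) (v - y)|
      ≤ ((k + 2 : ℕ) : ℝ) * (C * (1 / 2) ^ k) := by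
    intro v
    have h1 := conv_le hr0 h.indicator_Ici_le (integrable_convPow hl (k + 1))
      (convPow_nonneg hl0 (k + 1)) v
    have h0 : 0 ≤ ∫ y, (Ici (-2)).indicator w y * convPow wl (k + 1) (v - y) :=
      integral_nonneg fun y => mul_nonneg (hr0 y) (convPow_nonneg hl0 _ _)
    rw [abs_of_nonneg (by positivity)]
    refine mul_le_mul_of_nonneg_left (h1.trans ?_) (by positivity)
    rw [integral_convPow hl (by omega)]
    refine mul_le_mul_of_nonneg_left ?_ hC
    refine (pow_le_pow_left₀ (integral_nonneg hl0) (h.integral_indicator_Iio_le hη) _).trans ?_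
    exact pow_le_pow_of_le_one (by norm_num) (by norm_num) (by omega)
  have hmain' : ∀ᵐ u, |√(k + 2 : ℕ) * mainConv w k (-u) - c0| ≤ √(k + 2 : ℕ) * E +
      2 * π * |u| * c1 / √(k + 2 : ℕ) := by
    have := (Measure.measurePreserving_neg (volume : Measure ℝ)).quasiMeasurePreserving.ae hmain
    simpa only [abs_neg] using this
  set M : ℝ := ((k + 2 : ℕ) : ℝ) with hM
  have hS : 0 < √M := sqrt_pos.2 (by linarith)
  set B : ℝ → ℝ := fun u => (√M * E) * w u + (2 * π * c1 / √M) * (|u| * w u) +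
    (√M * C) * convPow wl (k + 2) (-u) + (√M * (M * (C * (1 / 2) ^ k))) * w u with hB
  have h1 : Integrable (fun u => |u| * w u) := by
    simpa using integrable_abs_pow_mul h.integrable h.integrable_cube (j := 1) (by norm_num)
  have i1 := h.integrable.const_mul (√M * E)
  have i2 := h1.const_mul (2 * π * c1 / √M)
  have i3 := ((integrable_convPow hl (k + 2)).comp_neg).const_mul (√M * C)
  have i4 := h.integrable.const_mul (√M * (M * (C * (1 / 2) ^ k)))
  have j2 : Integrable fun u => (√M * E) * w u + (2 * π * c1 / √M) * (|u| * w u) := i1.add i2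
  have j3 : Integrable fun u => (√M * E) * w u + (2 * π * c1 / √M) * (|u| * w u) +
    (√M * C) * convPow wl (k + 2) (-u) := j2.add i3
  have hBint : Integrable B := j3.add i4
  have hle : ∀ᵐ u, w u * |√M * convPow w (k + 2) (-u) - c0| ≤ B u := by
    filter_upwards [hmain'] with u hu
    have hw0 := h.nonneg u
    have e : √M * convPow w (k + 2) (-u) - c0 = (√M * mainConv w k (-u) - c0) +
        √M * convPow wl (k + 2) (-u) + √M * (M * ∫ y, (Ici (-2)).indicator w y *
          convPow wl (k + 1) (-u - y)) := by
      rw [mainConv]; ring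
    have a1 : |√M * convPow w (k + 2) (-u) - c0| ≤ (√M * E + 2 * π * |u| * c1 / √M) +
        √M * convPow wl (k + 2) (-u) + √M * (M * (C * (1 / 2) ^ k)) := by
      rw [e]
      refine (abs_add_le _ _).trans (add_le_add ((abs_add_le _ _).trans (add_le_add hu ?_)) ?_)
      · rw [abs_mul, abs_of_pos hS, abs_of_nonneg (convPow_nonneg hl0 _ _)]
      · rw [abs_mul, abs_of_pos hS]
        exact mul_le_mul_of_nonneg_left (hconv _) hS.le
    have a2 : w u * convPow wl (k + 2) (-u) ≤ C * convPow wl (k + 2) (-u) := by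
      rcases le_total u 0 with hu0 | hu0
      · rw [convPow_eq_zero_of_nonneg (fun x hx => indicator_of_notMem
          (by simp only [mem_Iio, not_lt]; linarith) _) _ (by linarith : 0 ≤ -u)]
        simp
      · exact mul_le_mul_of_nonneg_right (h.le_of_ge u (by linarith)) (convPow_nonneg hl0 _ _)
    have a3 := mul_le_mul_of_nonneg_left a1 hw0
    have a4 := mul_le_mul_of_nonneg_left a2 hS.le
    refine a3.trans ?_
    have e5 : 2 * π * |u| * c1 / √M = (2 * π * c1 / √M) * |u| := by ring
    rw [hB, e5]
    simp only []
    linarith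
  have hF : Integrable (fun u => w u * |√M * convPow w (k + 2) (-u) - c0|) := by
    have hm : AEStronglyMeasurable (fun u => √M * convPow w (k + 2) (-u) - c0) volume :=
      (((integrable_convPow h.integrable (k + 2)).comp_neg).const_mul (√M)).1.sub
        aestronglyMeasurable_const
    refine hBint.mono' (h.integrable.1.mul (by exact hm.norm)) ?_
    · filter_upwards [hle] with u hu
      rwa [norm_of_nonneg (mul_nonneg (h.nonneg u) (abs_nonneg _))]
  refine ⟨hF, (integral_mono_ae hF hBint hle).trans ?_⟩
  have hIB : ∫ u, B u = √M * E + (2 * π * c1 / √M) * (∫ u, |u| * w u) +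
      (√M * C) * (∫ u, wl u) ^ (k + 2) + √M * (M * (C * (1 / 2) ^ k)) := by
    rw [hB, integral_add j3 i4, integral_add j2 i3, integral_add i1 i2,
      integral_const_mul, integral_const_mul,
      integral_const_mul, integral_const_mul, h.integral_eq_one,
      integral_neg_eq_self (fun u => convPow wl (k + 2) u), integral_convPow hl (by omega)]
    ring
  rw [hIB, add_assoc]
  have hS1 : √M ≤ M := by
    rw [Real.sqrt_le_left (by linarith)]; nlinarith
  have M2 : M ^ 2 ≤ M ^ 3 := pow_le_pow_right₀ hM1 (by norm_num)
  have M1 : M ≤ M ^ 3 := le_self_pow₀ hM1 (by norm_num)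
  have p0 : (∫ u, wl u) ^ (k + 2) ≤ (1 / 2) ^ k :=
    (pow_le_pow_left₀ (integral_nonneg hl0) (h.integral_indicator_Iio_le hη) _).trans
      (pow_le_pow_of_le_one (by norm_num) (by norm_num) (by omega))
  have q1 : (√M * C) * (∫ u, wl u) ^ (k + 2) ≤ C * (M ^ 3 * (1 / 2) ^ k) := by
    calc _ ≤ (M ^ 3 * C) * (1 / 2) ^ k :=
          mul_le_mul (mul_le_mul_of_nonneg_right (hS1.trans M1) hC) p0
            (pow_nonneg (integral_nonneg hl0) _) (by positivity)
      _ = _ := by ring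
  have q2 : √M * (M * (C * (1 / 2) ^ k)) ≤ C * (M ^ 3 * (1 / 2) ^ k) := by
    calc _ ≤ M * (M * (C * (1 / 2) ^ k)) := by gcongr
      _ = C * (M ^ 2 * (1 / 2) ^ k) := by ring
      _ ≤ _ := by gcongr
  have q3 : (2 * π * c1 / √M) * (∫ u, |u| * w u) ≤ 2 * π * (1 + C) * c1 / √M := by
    calc _ ≤ (2 * π * c1 / √M) * (1 + C) := by gcongr; exact h.integral_abs_mul_le
      _ = _ := by ring
  linarith

end IsNearGaussian

/-- Conditioning on the sum of many independent, uniformly nearly Gaussian variables being equal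
to its mean asymptotically does not change the law of one of them. -/
theorem tendsto_integral_abs_conditioned_sub {w : ℕ → ℝ → ℝ} {C : ℝ} {η : ℕ → ℝ}
    (hw : ∀ n, IsNearGaussian (w n) C (η n)) (hη : Tendsto η atTop (𝓝 0))
    {k : ℕ → ℕ} (hk : Tendsto k atTop atTop) :
    Tendsto (fun n => ∫ u, |w n u * convPow (w n) (k n + 2) (-u) / convPow (w n) (k n + 3) 0
      - w n u|) atTop (𝓝 0) := by
  obtain ⟨hInt, hlim⟩ := tendsto_sqrt_mul_integral_fourierR_mainConv_sub hw hη hk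
  set c0 := ∫ τ, exp (-2 * π ^ 2 * τ ^ 2) with hc0
  set c1 := ∫ τ, |τ| * exp (-2 * π ^ 2 * τ ^ 2) with hc1
  have hc0pos : 0 < c0 := integral_exp_pos (f := fun τ => -2 * π ^ 2 * τ ^ 2)
    integrable_exp_neg_two_pi_sq
  set e : ℕ → ℝ := fun n => √(k n + 2 : ℕ) * (∫ ξ, ‖fourierR (mainConv (w n) (k n)) ξ -
        (exp (-2 * π ^ 2 * (k n + 2 : ℕ) * ξ ^ 2) : ℝ)‖) +
      2 * π * (1 + C) * c1 / √(k n + 2 : ℕ) +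
      2 * C * (((k n + 2 : ℕ) : ℝ) ^ 3 * (1 / 2) ^ (k n)) with he
  have hS : Tendsto (fun n => √((k n + 2 : ℕ) : ℝ)) atTop atTop :=
    tendsto_sqrt_atTop.comp (tendsto_natCast_atTop_atTop.comp
      ((tendsto_add_atTop_nat 2).comp hk))
  have helim : Tendsto e atTop (𝓝 0) := by
    have h2 := hS.const_div_atTop (2 * π * (1 + C) * c1)
    have h3 := ((tendsto_add_two_pow_three_mul_pow (r := 1 / 2) (by norm_num)
      (by norm_num)).comp hk).const_mul (2 * C)
    have := (hlim.add h2).add h3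
    rwa [mul_zero, add_zero, add_zero] at this
  have hfin := helim.const_mul (4 / c0)
  rw [mul_zero] at hfin
  refine tendsto_of_tendsto_of_tendsto_of_le_of_le' tendsto_const_nhds hfin
    (.of_forall fun n => integral_nonneg fun u => abs_nonneg _) ?_
  filter_upwards [hInt, hη.eventually_le_const (show (0 : ℝ) < 1 / 4 by norm_num),
    helim.eventually_le_const (show 0 < c0 / 2 by linarith)] with n hn hηn hen
  obtain ⟨iw, hwle⟩ := (hw n).integral_mul_abs_sqrt_mul_convPow_sub_le hηn hn
  change Integrable (fun u => w n u * |√(k n + 2 : ℕ) * convPow (w n) (k n + 2) (-u) - c0|) at iw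
  have hwe : ∫ u, w n u * |√(k n + 2 : ℕ) * convPow (w n) (k n + 2) (-u) - c0| ≤ e n := hwle
  have hM : (0 : ℝ) < (k n + 2 : ℕ) := by positivity
  set s := √((k n + 2 : ℕ) : ℝ) with hs
  have hs0 : 0 < s := sqrt_pos.2 hM
  set D := s * convPow (w n) (k n + 3) 0 with hD
  have hw1 := (hw n).integrable
  have iwf : Integrable (fun u => w n u * (s * convPow (w n) (k n + 2) (-u) - c0)) := by
    refine iw.mono (hw1.1.mul ?_) (.of_forall fun u => ?_)
    · exact (((integrable_convPow hw1 (k n + 2)).comp_neg).const_mul s).1.sub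
        aestronglyMeasurable_const
    · simp
  have hDe : D - c0 = ∫ u, w n u * (s * convPow (w n) (k n + 2) (-u) - c0) := by
    have e1 : D = ∫ u, s * (w n u * convPow (w n) (k n + 2) (0 - u)) := by
      rw [hD, convPow_succ _ (by omega), integral_const_mul]
    have e2 : D = ∫ u, (w n u * (s * convPow (w n) (k n + 2) (-u) - c0) + c0 * w n u) := by
      rw [e1]
      refine integral_congr_ae (.of_forall fun u => ?_)
      simp only [zero_sub]; ring
    rw [e2, integral_add iwf (hw1.const_mul _), integral_const_mul, (hw n).integral_eq_one]
    ring
  have hDabs : |D - c0| ≤ e n := by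
    rw [hDe]
    refine (abs_integral_le_integral_abs).trans (le_of_eq_of_le ?_ hwe)
    refine integral_congr_ae (.of_forall fun u => ?_)
    simp only [abs_mul, abs_of_nonneg ((hw n).nonneg u)]
  have hDpos : c0 / 2 ≤ D := by linarith [(abs_le.1 hDabs).1]
  have hD0 : 0 < D := by linarith
  have hpt : ∀ u, |w n u * convPow (w n) (k n + 2) (-u) / convPow (w n) (k n + 3) 0 - w n u| ≤
      2 / c0 * (w n u * |s * convPow (w n) (k n + 2) (-u) - c0| + e n * w n u) := by
    intro u
    have hc : convPow (w n) (k n + 3) 0 = D / s := by rw [hD]; field_simp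
    have e1 : w n u * convPow (w n) (k n + 2) (-u) / convPow (w n) (k n + 3) 0 - w n u =
        w n u * ((s * convPow (w n) (k n + 2) (-u) - c0) - (D - c0)) / D := by
      rw [hc]; field_simp; ring
    have hw0 := (hw n).nonneg u
    rw [e1, abs_div, abs_mul, abs_of_pos hD0, abs_of_nonneg hw0]
    have h3 := abs_sub (s * convPow (w n) (k n + 2) (-u) - c0) (D - c0)
    have h4 : w n u * |s * convPow (w n) (k n + 2) (-u) - c0 - (D - c0)| ≤
      w n u * |s * convPow (w n) (k n + 2) (-u) - c0| + e n * w n u := by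
      nlinarith
    have h5 : 1 / D ≤ 2 / c0 := by
      rw [div_le_div_iff₀ hD0 hc0pos]; linarith
    calc _ = w n u * |s * convPow (w n) (k n + 2) (-u) - c0 - (D - c0)| * (1 / D) := by ring
      _ ≤ (w n u * |s * convPow (w n) (k n + 2) (-u) - c0| + e n * w n u) * (2 / c0) :=
        mul_le_mul h4 h5 (by positivity) ((mul_nonneg hw0 (abs_nonneg _)).trans h4)
      _ = _ := by ring
  refine (integral_mono_of_nonneg (.of_forall fun u => abs_nonneg _)
    ((iw.add (hw1.const_mul (e n))).const_mul (2 / c0)) (.of_forall hpt)).trans ?_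
  rw [integral_const_mul, integral_add' iw (hw1.const_mul _), integral_const_mul,
    (hw n).integral_eq_one]
  have : 0 ≤ 2 / c0 := by positivity
  calc _ ≤ 2 / c0 * (e n + e n * 1) := by gcongr
    _ = _ := by ring

/-- Location `X t` and scale `S t` for which `g` has an asymptotically quadratic expansion around
the point `X t` where `g' = h` equals `t`; moreover `h` is monotone on `[A, ∞)`. -/
structure LaplaceScale (g h X S : ℝ → ℝ) (A : ℝ) : Prop where
  nonneg : 0 ≤ A
  mono : MonotoneOn h (Ici A)
  tendsto_X : Tendsto X atTop atTop
  S_pos : ∀ᶠ t in atTop, 0 < S t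
  ratio : Tendsto (fun t => X t / S t) atTop atTop
  crit : ∀ᶠ t in atTop, h (X t) = t
  quad : ∀ z, Tendsto (fun t => g (X t + S t * z) - g (X t) - t * (S t * z)) atTop (𝓝 (z ^ 2 / 2))

/-- The tilted density in the coordinate `z`, normalized to be close to `exp (-z ^ 2 / 2)`. -/
def laplaceKernel (p g : ℝ → ℝ) (c X S t z : ℝ) : ℝ := p (X + S * z) * exp (t * (S * z) + g X) / c

namespace LaplaceScale
variable {g h X S : ℝ → ℝ} {A : ℝ}

lemma of_le (H : LaplaceScale g h X S A) {A' : ℝ} (hA : A ≤ A') : LaplaceScale g h X S A' :=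
  { H with nonneg := H.nonneg.trans hA, mono := H.mono.mono (Ici_subset_Ici.2 hA) }

lemma tendsto_h (H : LaplaceScale g h X S A) : Tendsto h atTop atTop := by
  refine tendsto_atTop.2 fun b => ?_
  obtain ⟨t, ht1, ht2, ht3⟩ := ((H.crit.and ((H.tendsto_X.eventually_ge_atTop A).and
    (eventually_ge_atTop b)))).exists
  filter_upwards [eventually_ge_atTop (X t)] with x hx
  have := H.mono ht2 (ht2.trans hx : A ≤ x) hx
  linarith

lemma tendsto_add_mul (H : LaplaceScale g h X S A) (z : ℝ) :
    Tendsto (fun t => X t + S t * z) atTop atTop := by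
  have h1 : ∀ᶠ t in atTop, X t / 2 ≤ X t + S t * z := by
    filter_upwards [H.S_pos, H.ratio.eventually_ge_atTop (2 * |z|)] with t h1 h2
    rw [le_div_iff₀ h1] at h2
    have := neg_abs_le z
    nlinarith
  exact tendsto_atTop_mono' _ h1 (H.tendsto_X.atTop_div_const (by norm_num))

lemma quad_nonneg (H : LaplaceScale g h X S A) (hg : ∀ x, HasDerivAt g (h x) x) {x y : ℝ}
    (hx : A ≤ x) (hy : A ≤ y) : 0 ≤ g y - g x - h x * (y - x) := by
  have hcont : Continuous g := continuous_iff_continuousAt.2 fun x => (hg x).continuousAt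
  rcases lt_trichotomy x y with hxy | rfl | hxy
  · obtain ⟨ζ, hζ, e⟩ := exists_hasDerivAt_eq_slope g h hxy hcont.continuousOn fun u _ => hg u
    have h1 := H.mono hx (hx.trans hζ.1.le : A ≤ ζ) hζ.1.le
    rw [e, le_div_iff₀ (by linarith)] at h1
    linarith
  · simp
  · obtain ⟨ζ, hζ, e⟩ := exists_hasDerivAt_eq_slope g h hxy hcont.continuousOn fun u _ => hg u
    have h1 := H.mono (hy.trans hζ.1.le : A ≤ ζ) hx hζ.2.le
    rw [e, div_le_iff₀ (by linarith)] at h1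
    linarith

lemma convexOn (H : LaplaceScale g h X S A) (hg : ∀ x, HasDerivAt g (h x) x) :
    ConvexOn ℝ (Ici A) g := by
  have hcont : Continuous g := continuous_iff_continuousAt.2 fun x => (hg x).continuousAt
  refine MonotoneOn.convexOn_of_deriv (convex_Ici A) hcont.continuousOn
    (fun x _ => (hg x).differentiableAt.differentiableWithinAt) ?_
  have : deriv g = h := funext fun x => (hg x).deriv
  rw [this]
  exact H.mono.mono interior_subset

/-- Linear lower bound for the rescaled exponent. -/
lemma eventually_le_quad (H : LaplaceScale g h X S A) (hg : ∀ x, HasDerivAt g (h x) x) :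
    ∀ᶠ t in atTop, ∀ z, A ≤ X t + S t * z →
      (|z| - 1) / 4 ≤ g (X t + S t * z) - g (X t) - t * (S t * z) := by
  have q1 := (H.quad 1).eventually_const_le (u := 1 / 4) (by norm_num)
  have q2 := (H.quad (-1)).eventually_const_le (u := 1 / 4) (by norm_num)
  filter_upwards [q1, q2, H.S_pos, H.crit, H.tendsto_X.eventually_ge_atTop A,
    (H.tendsto_add_mul (-1)).eventually_ge_atTop A] with t q1 q2 hS ht hX hX1 z hz
  have key : ∀ e : ℝ, 1 ≤ z * e → e ^ 2 = 1 →
      1 / 4 ≤ g (X t + S t * e) - g (X t) - t * (S t * e) →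
      (|z| - 1) / 4 ≤ g (X t + S t * z) - g (X t) - t * (S t * z) := by
    intro e he1 he2 hq
    set r := z * e with hr
    have hr0 : 0 < r := by linarith
    have hze : z = r * e := by rw [hr, mul_assoc, ← sq, he2, mul_one]
    have habs : |z| = r := by
      have : |e| = 1 := by rw [← sq_eq_sq₀ (abs_nonneg _) zero_le_one, sq_abs, he2]; norm_num
      rw [hze, abs_mul, this, mul_one, abs_of_pos hr0]
    have hcv := (H.convexOn hg).2 (show X t ∈ Ici A from hX) (show X t + S t * z ∈ Ici A from hz)
      (show 0 ≤ 1 - 1 / r by rw [sub_nonneg, div_le_one hr0]; exact he1)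
      (show 0 ≤ 1 / r by positivity) (by ring)
    simp only [smul_eq_mul] at hcv
    have e3 : (1 - 1 / r) * X t + 1 / r * (X t + S t * z) = X t + S t * e := by
      rw [hze]; field_simp; ring
    rw [e3] at hcv
    have e4 : (1 - 1 / r) * g (X t) + 1 / r * g (X t + S t * z) - g (X t) - t * (S t * e)
        = 1 / r * (g (X t + S t * z) - g (X t) - t * (S t * z)) := by
      rw [hze]; field_simp; ring
    have h5 : 1 / 4 ≤ 1 / r * (g (X t + S t * z) - g (X t) - t * (S t * z)) := by
      rw [← e4]; linarith
    rw [one_div_mul_eq_div, le_div_iff₀ hr0] at h5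
    rw [habs]
    linarith
  rcases le_total 1 |z| with h1 | h1
  · rcases le_total 0 z with h0 | h0
    · exact key 1 (by rwa [abs_of_nonneg h0, ← mul_one z] at h1) (by norm_num) q1
    · exact key (-1) (by rw [abs_of_nonpos h0] at h1; linarith) (by norm_num) q2
  · have := H.quad_nonneg hg hX hz
    rw [ht] at this
    have e : t * (X t + S t * z - X t) = t * (S t * z) := by ring
    rw [e] at this
    linarith

end LaplaceScale

lemma integrable_one_add_cube_mul_exp_neg_abs :
    Integrable fun z : ℝ => (1 + |z| ^ 3) * exp (1 - (|z| - 1) / 4) := by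
  have h1 : IntegrableOn (fun z : ℝ => (1 + |z| ^ 3) * exp (1 - (|z| - 1) / 4)) (Ioi 0) := by
    have i0 := integrableOn_rpow_mul_exp_neg_mul_rpow (p := 1) (s := 0) (b := 1 / 4)
      (by norm_num) (by norm_num) (by norm_num)
    have i3 := integrableOn_rpow_mul_exp_neg_mul_rpow (p := 1) (s := 3) (b := 1 / 4)
      (by norm_num) (by norm_num) (by norm_num)
    have i : IntegrableOn _ (Ioi (0 : ℝ)) volume := (i0.add i3).const_mul (exp (5 / 4))
    refine i.congr_fun (fun z hz => ?_) measurableSet_Ioi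
    have hz : 0 < z := hz
    simp only [Pi.add_apply]
    rw [abs_of_pos hz, rpow_one, rpow_zero, show (3 : ℝ) = ((3 : ℕ) : ℝ) by norm_num,
      rpow_natCast]
    have e : exp (1 - (z - 1) / 4) = exp (5 / 4) * exp (-(1 / 4) * z) := by
      rw [← Real.exp_add]; congr 1; ring
    rw [e]; ring
  have h2 := (integrable_indicator_iff measurableSet_Ioi).2 h1
  refine (h2.add h2.comp_neg).congr ?_
  filter_upwards [Measure.ae_ne volume (0 : ℝ)] with z hz
  rcases hz.lt_or_gt with hz | hz
  · simp only [Pi.add_apply]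
    rw [indicator_of_notMem (by simpa using hz.le), indicator_of_mem (by simpa using hz), abs_neg,
      zero_add]
  · simp only [Pi.add_apply]
    rw [indicator_of_mem (by simpa using hz), indicator_of_notMem (by simpa using hz.le), add_zero]

lemma integrable_one_add_cube_mul_gaussian :
    Integrable fun z : ℝ => (1 + |z| ^ 3) * exp (-z ^ 2 / 2) := by
  refine (integrable_one_add_cube_mul_exp_neg_abs).mono' (Continuous.aestronglyMeasurable
    (by fun_prop)) (.of_forall fun z => ?_)
  rw [norm_of_nonneg (by positivity)]
  gcongr
  rw [← sq_abs]
  nlinarith [sq_nonneg (|z| - 1 / 4)]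

lemma laplaceKernel_eq {p g q : ℝ → ℝ} {c : ℝ} (hc : 0 < c)
    (hp : ∀ x ≥ (0 : ℝ), p x = c * exp (-(g x - q x))) {X S t z : ℝ} (hz : 0 ≤ X + S * z) :
    laplaceKernel p g c X S t z =
      exp (-(g (X + S * z) - g X - t * (S * z)) + q (X + S * z)) := by
  rw [laplaceKernel, hp _ hz, mul_assoc, ← Real.exp_add, mul_div_cancel_left₀ _ hc.ne']
  congr 1; ring

lemma laplaceKernel_nonneg {p : ℝ → ℝ} (g : ℝ → ℝ) {c : ℝ} (hc : 0 < c) (hp : ∀ x, 0 ≤ p x)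
    (X S t z : ℝ) : 0 ≤ laplaceKernel p g c X S t z :=
  div_nonneg (mul_nonneg (hp _) (exp_pos _).le) hc.le

lemma integrable_comp_affine {p : ℝ → ℝ} (hp : Integrable p) {σ : ℝ} (hσ : 0 < σ) (a : ℝ) :
    Integrable fun u => p (a + σ * u) :=
  (hp.comp_add_left a).comp_mul_left' hσ.ne'

lemma aestronglyMeasurable_laplaceKernel {p : ℝ → ℝ} (g : ℝ → ℝ) (c : ℝ) (hp : Integrable p)
    {X S t : ℝ} (hS : 0 < S) : AEStronglyMeasurable (laplaceKernel p g c X S t) volume := by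
  have h1 := (integrable_comp_affine hp hS X).1
  have h2 : AEStronglyMeasurable (fun z => exp (t * (S * z) + g X)) volume :=
    Continuous.aestronglyMeasurable (by fun_prop)
  exact (by exact h1.mul h2 : AEStronglyMeasurable
    (fun z => p (X + S * z) * exp (t * (S * z) + g X)) volume).mul_const c⁻¹

lemma tendsto_one_add_cube_mul_self_mul_exp_neg :
    Tendsto (fun y : ℝ => (1 + y ^ 3) * y * exp (-(y / 8))) atTop (𝓝 0) := by
  have h1 := (Real.tendsto_pow_mul_exp_neg_atTop_nhds_zero 1).comp
    (tendsto_id.atTop_div_const (r := (8 : ℝ)) (by norm_num))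
  have h4 := (Real.tendsto_pow_mul_exp_neg_atTop_nhds_zero 4).comp
    (tendsto_id.atTop_div_const (r := (8 : ℝ)) (by norm_num))
  have := (h1.const_mul 8).add (h4.const_mul (8 ^ 4))
  rw [mul_zero, mul_zero, add_zero] at this
  refine this.congr fun y => ?_
  simp only [Function.comp, id]
  ring

namespace LaplaceScale
variable {p g q h X S : ℝ → ℝ} {A c : ℝ}

lemma eventually_laplaceKernel_le (H : LaplaceScale g h X S A) (hg : ∀ x, HasDerivAt g (h x) x)
    (hc : 0 < c) (hp : ∀ x ≥ (0 : ℝ), p x = c * exp (-(g x - q x)))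
    (hq1 : ∀ x ≥ A, |q x| ≤ 1) :
    ∀ᶠ t in atTop, ∀ z, A ≤ X t + S t * z →
      laplaceKernel p g c (X t) (S t) t z ≤ exp (1 - (|z| - 1) / 4) := by
  filter_upwards [H.eventually_le_quad hg] with t ht z hz
  rw [laplaceKernel_eq hc hp (H.nonneg.trans hz), exp_le_exp]
  linarith [ht z hz, (abs_le.1 (hq1 _ hz)).2]

lemma eventually_laplaceKernel_le_const (H : LaplaceScale g h X S A)
    (hg : ∀ x, HasDerivAt g (h x) x)
    (hc : 0 < c) (hp : ∀ x ≥ (0 : ℝ), p x = c * exp (-(g x - q x)))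
    (hq1 : ∀ x ≥ A, |q x| ≤ 1) :
    ∀ᶠ t in atTop, ∀ z ≥ -3, laplaceKernel p g c (X t) (S t) t z ≤ 8 := by
  filter_upwards [H.eventually_laplaceKernel_le hg hc hp hq1, H.S_pos,
    (H.tendsto_add_mul (-3)).eventually_ge_atTop A] with t ht hS hA z hz
  refine (ht z (hA.trans (by gcongr))).trans ?_
  have e2 : exp 2 ≤ 8 := by
    have : exp 2 = exp 1 * exp 1 := by rw [← Real.exp_add]; norm_num
    rw [this]
    nlinarith [Real.exp_one_lt_d9, exp_pos 1]
  refine (exp_le_exp.2 ?_).trans e2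
  linarith [abs_nonneg z]

/-- The part of the tilted density on `[A, ∞)` is close to the Gaussian one. -/
lemma tendsto_integral_indicator_laplaceKernel_sub (H : LaplaceScale g h X S A)
    (hg : ∀ x, HasDerivAt g (h x) x) (hc : 0 < c)
    (hp : ∀ x ≥ (0 : ℝ), p x = c * exp (-(g x - q x))) (hpint : Integrable p)
    (hq0 : Tendsto q atTop (𝓝 0)) (hq1 : ∀ x ≥ A, |q x| ≤ 1) :
    Tendsto (fun t => ∫ z, (1 + |z| ^ 3) * |{z | A ≤ X t + S t * z}.indicator
      (laplaceKernel p g c (X t) (S t) t) z - exp (-z ^ 2 / 2)|) atTop (𝓝 0) := by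
  have key : Tendsto (fun t => ∫ z, (1 + |z| ^ 3) * |{z | A ≤ X t + S t * z}.indicator
      (laplaceKernel p g c (X t) (S t) t) z - exp (-z ^ 2 / 2)|) atTop
      (𝓝 (∫ _ : ℝ, (0 : ℝ))) := by
    refine tendsto_integral_filter_of_dominated_convergence
      (fun z => (1 + |z| ^ 3) * exp (1 - (|z| - 1) / 4) + (1 + |z| ^ 3) * exp (-z ^ 2 / 2)) ?_ ?_
      (integrable_one_add_cube_mul_exp_neg_abs.add integrable_one_add_cube_mul_gaussian) ?_
    · filter_upwards [H.S_pos] with t hS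
      have hm : AEStronglyMeasurable (fun z => {z | A ≤ X t + S t * z}.indicator
          (laplaceKernel p g c (X t) (S t) t) z - exp (-z ^ 2 / 2)) volume :=
        ((aestronglyMeasurable_laplaceKernel g c hpint hS).indicator
          (measurableSet_le (by fun_prop) (by fun_prop))).sub
          (Continuous.aestronglyMeasurable (by fun_prop))
      exact (Continuous.aestronglyMeasurable (by fun_prop)).mul (by exact hm.norm)
    · filter_upwards [H.eventually_laplaceKernel_le hg hc hp hq1] with t ht
      filter_upwards with z
      rw [norm_of_nonneg (by positivity), ← mul_add]
      refine mul_le_mul_of_nonneg_left ((abs_sub _ _).trans (add_le_add ?_ (abs_exp _).le))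
        (by positivity)
      by_cases hz : A ≤ X t + S t * z
      · rw [indicator_of_mem (by exact hz), laplaceKernel_eq hc hp (H.nonneg.trans hz), abs_exp,
          ← laplaceKernel_eq hc hp (H.nonneg.trans hz)]
        exact ht z hz
      · rw [indicator_of_notMem (by exact hz), abs_zero]
        exact (exp_pos _).le
    · filter_upwards with z
      have l1 : Tendsto (fun t => exp (-(g (X t + S t * z) - g (X t) - t * (S t * z)) +
          q (X t + S t * z))) atTop (𝓝 (exp (-z ^ 2 / 2))) := by
        have := (H.quad z).neg.add (hq0.comp (H.tendsto_add_mul z))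
        rw [add_zero, ← neg_div] at this
        exact (continuous_exp.tendsto _).comp this
      have l2 := ((l1.sub_const (exp (-z ^ 2 / 2))).abs.const_mul (1 + |z| ^ 3))
      rw [sub_self, abs_zero, mul_zero] at l2
      refine l2.congr' ?_
      filter_upwards [(H.tendsto_add_mul z).eventually_ge_atTop A] with t hz
      rw [indicator_of_mem (by exact hz), laplaceKernel_eq hc hp (H.nonneg.trans hz)]
  rwa [integral_zero] at key

lemma eventually_compl_le (H : LaplaceScale g h X S A)
    (hg : ∀ x, HasDerivAt g (h x) x) (hc : 0 < c)
    (hp : ∀ x ≥ (0 : ℝ), p x = c * exp (-(g x - q x))) (hp0 : ∀ x < (0 : ℝ), p x = 0) :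
    ∀ᶠ t in atTop, ∀ z, (1 + |z| ^ 3) * {z | A ≤ X t + S t * z}ᶜ.indicator
      (laplaceKernel p g c (X t) (S t) t) z ≤
      (1 + (X t / S t) ^ 3) * (exp (g A + 1 / 4) / c * exp (-(X t / S t / 8))) *
        p (X t + S t * z) := by
  have hpn : ∀ x, 0 ≤ p x := fun x => by
    rcases lt_or_ge x 0 with hx | hx
    · rw [hp0 x hx]
    · rw [hp x hx]; positivity
  filter_upwards [H.eventually_le_quad hg, H.S_pos, eventually_ge_atTop 0,
    H.tendsto_X.eventually_ge_atTop (2 * A)] with t hq hS ht hX z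
  have hA := H.nonneg
  by_cases hz : A ≤ X t + S t * z
  · rw [indicator_of_notMem (by simpa using hz), mul_zero]
    have := hpn (X t + S t * z)
    have : 0 ≤ X t := by linarith
    positivity
  · rw [indicator_of_mem (by simpa using hz)]
    rw [not_le] at hz
    rcases lt_or_ge (X t + S t * z) 0 with h0 | h0
    · rw [laplaceKernel, hp0 _ h0]; simp
    · have hz0 : z ≤ 0 := by
        by_contra hcon
        have : 0 < S t * z := by rw [not_le] at hcon; positivity
        linarith
      have habs : |z| ≤ X t / S t := by
        rw [abs_of_nonpos hz0, le_div_iff₀ hS]; linarith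
      have hzA : X t + S t * ((A - X t) / S t) = A := by field_simp; ring
      have hq' := hq ((A - X t) / S t) hzA.ge
      rw [hzA] at hq'
      have h3 : X t / S t / 2 ≤ |(A - X t) / S t| := by
        rw [abs_div, abs_of_pos hS, abs_of_nonpos (by linarith)]
        rw [div_div, mul_comm, ← div_div]
        gcongr; linarith
      have h4 : S t * ((A - X t) / S t) = A - X t := by field_simp
      rw [h4] at hq'
      have hk : laplaceKernel p g c (X t) (S t) t z ≤
          exp (g A + 1 / 4) / c * exp (-(X t / S t / 8)) * p (X t + S t * z) := by
        have h5 : exp (t * (S t * z) + g (X t)) ≤ exp (g A + 1 / 4) * exp (-(X t / S t / 8)) := by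
          rw [← Real.exp_add, exp_le_exp]
          have : t * (S t * z) ≤ t * (A - X t) := by gcongr; linarith
          linarith
        rw [laplaceKernel, div_le_iff₀ hc]
        calc _ ≤ p (X t + S t * z) * (exp (g A + 1 / 4) * exp (-(X t / S t / 8))) := by
              gcongr; exact hpn _
          _ = _ := by field_simp
      rw [mul_assoc]
      have hXS : 0 ≤ X t / S t := (abs_nonneg z).trans habs
      have hk0 := laplaceKernel_nonneg g hc hpn (X t) (S t) t z
      exact mul_le_mul (by gcongr) hk hk0 (by positivity)

/-- Laplace approximation of the tilted density, with third moments. -/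
lemma tendsto_integral_laplaceKernel_sub (H : LaplaceScale g h X S A)
    (hg : ∀ x, HasDerivAt g (h x) x) (hc : 0 < c)
    (hp : ∀ x ≥ (0 : ℝ), p x = c * exp (-(g x - q x))) (hp0 : ∀ x < (0 : ℝ), p x = 0)
    (hpint : Integrable p) (hq0 : Tendsto q atTop (𝓝 0)) (hq1 : ∀ x ≥ A, |q x| ≤ 1) :
    (∀ᶠ t in atTop, Integrable
      (fun z => (1 + |z| ^ 3) * laplaceKernel p g c (X t) (S t) t z)) ∧
    Tendsto (fun t => ∫ z, (1 + |z| ^ 3) *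
      |laplaceKernel p g c (X t) (S t) t z - exp (-z ^ 2 / 2)|) atTop (𝓝 0) := by
  have hpn : ∀ x, 0 ≤ p x := fun x => by
    rcases lt_or_ge x 0 with hx | hx
    · rw [hp0 x hx]
    · rw [hp x hx]; positivity
  set B : ℝ → ℝ := fun t =>
    (1 + (X t / S t) ^ 3) * (exp (g A + 1 / 4) / c * exp (-(X t / S t / 8))) with hB
  have hInt : ∀ᶠ t in atTop, Integrable
      (fun z => (1 + |z| ^ 3) * laplaceKernel p g c (X t) (S t) t z) := by
    filter_upwards [H.eventually_compl_le hg hc hp hp0, H.eventually_laplaceKernel_le hg hc hp hq1,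
      H.S_pos, H.tendsto_X.eventually_ge_atTop 0] with t h1 h2 hS hX
    refine (integrable_one_add_cube_mul_exp_neg_abs.add
      ((integrable_comp_affine hpint hS (X t)).const_mul (B t))).mono'
      ((Continuous.aestronglyMeasurable (by fun_prop)).mul
        (aestronglyMeasurable_laplaceKernel g c hpint hS)) (.of_forall fun z => ?_)
    have hk := laplaceKernel_nonneg g hc hpn (X t) (S t) t z
    have hB0 : 0 ≤ B t * p (X t + S t * z) := by
      have := hpn (X t + S t * z)
      positivity
    rw [norm_of_nonneg (by positivity)]
    simp only [Pi.add_apply]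
    by_cases hz : A ≤ X t + S t * z
    · have := mul_le_mul_of_nonneg_left (h2 z hz) (show 0 ≤ 1 + |z| ^ 3 by positivity)
      linarith
    · have := h1 z
      rw [indicator_of_mem (by simpa using hz)] at this
      have h0 : 0 ≤ (1 + |z| ^ 3) * exp (1 - (|z| - 1) / 4) := by positivity
      change _ ≤ B t * _ at this
      linarith
  refine ⟨hInt, ?_⟩
  have hBlim : Tendsto (fun t => exp (g A + 1 / 4) / c * (∫ x, p x) *
      ((1 + (X t / S t) ^ 3) * (X t / S t) * exp (-(X t / S t / 8)))) atTop (𝓝 0) := by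
    have := (tendsto_one_add_cube_mul_self_mul_exp_neg.comp H.ratio).const_mul
      (exp (g A + 1 / 4) / c * (∫ x, p x))
    rwa [mul_zero] at this
  have hlim := (H.tendsto_integral_indicator_laplaceKernel_sub hg hc hp hpint hq0 hq1).add hBlim
  rw [add_zero] at hlim
  refine tendsto_of_tendsto_of_tendsto_of_le_of_le' tendsto_const_nhds hlim
    (.of_forall fun t => integral_nonneg fun z => by positivity) ?_
  filter_upwards [hInt, H.eventually_compl_le hg hc hp hp0, H.S_pos,
    H.tendsto_X.eventually_ge_atTop 1] with t hi h1 hS hX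
  set k := laplaceKernel p g c (X t) (S t) t with hk
  have hms : MeasurableSet {z | A ≤ X t + S t * z} := measurableSet_le (by fun_prop) (by fun_prop)
  have hkn : ∀ z, 0 ≤ k z := laplaceKernel_nonneg g hc hpn (X t) (S t) t
  have ip := (integrable_comp_affine hpint hS (X t)).const_mul (B t)
  have i1 : Integrable (fun z => (1 + |z| ^ 3) * |{z | A ≤ X t + S t * z}.indicator
      k z - exp (-z ^ 2 / 2)|) := by
    have : Integrable (fun z => (1 + |z| ^ 3) * ({z | A ≤ X t + S t * z}.indicator
      k z - exp (-z ^ 2 / 2))) := by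
      refine ((hi.indicator hms).sub integrable_one_add_cube_mul_gaussian).congr
        (.of_forall fun z => ?_)
      simp only [Pi.sub_apply, indicator]
      split_ifs <;> ring
    refine this.abs.congr (.of_forall fun z => ?_)
    simp only [abs_mul]
    rw [abs_of_nonneg (show 0 ≤ 1 + |z| ^ 3 by positivity)]
  have hpt : ∀ z, (1 + |z| ^ 3) * |k z - exp (-z ^ 2 / 2)| ≤
      (1 + |z| ^ 3) * |{z | A ≤ X t + S t * z}.indicator k z - exp (-z ^ 2 / 2)| +
        B t * p (X t + S t * z) := by
    intro z
    have h2 := h1 z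
    refine le_trans ?_ (add_le_add le_rfl h2)
    rw [← mul_add]
    refine mul_le_mul_of_nonneg_left ?_ (by positivity)
    have e : k z - exp (-z ^ 2 / 2) = ({z | A ≤ X t + S t * z}.indicator k z - exp (-z ^ 2 / 2)) +
        {z | A ≤ X t + S t * z}ᶜ.indicator k z := by
      have := congrFun (indicator_self_add_compl {z | A ≤ X t + S t * z} k) z
      simp only [Pi.add_apply] at this
      linarith
    rw [e]
    refine (abs_add_le _ _).trans_eq ?_
    rw [abs_of_nonneg (indicator_nonneg (fun z _ => hkn z) z)]
  refine (integral_mono_of_nonneg (.of_forall fun z => by positivity) (i1.add ip)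
    (.of_forall hpt)).trans ?_
  rw [integral_add' i1 ip, integral_const_mul]
  refine add_le_add le_rfl ?_
  have e1 := integral_comp_affine p hS (X t)
  have hI : 0 ≤ ∫ u, p (X t + S t * u) := integral_nonneg fun u => hpn _
  have h3 : ∫ u, p (X t + S t * u) ≤ X t / S t * ∫ x, p x := by
    rw [e1, div_mul_eq_mul_div, le_div_iff₀ hS]
    have : 0 ≤ S t * ∫ u, p (X t + S t * u) := by positivity
    nlinarith
  calc B t * ∫ u, p (X t + S t * u) ≤ B t * (X t / S t * ∫ x, p x) := by gcongr
    _ = _ := by rw [hB]; ring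

end LaplaceScale

lemma integral_exp_neg_sq_half : ∫ z : ℝ, exp (-z ^ 2 / 2) = √(2 * π) := by
  have := integral_gaussian (1 / 2)
  rw [show π / (1 / 2) = 2 * π by ring] at this
  rw [← this]
  congr with z
  congr 1; ring

lemma integral_id_mul_exp_neg_sq_half : ∫ z : ℝ, z * exp (-z ^ 2 / 2) = 0 := by
  have := integral_neg_eq_self (fun z : ℝ => z * exp (-z ^ 2 / 2)) volume
  simp only [neg_sq, neg_mul, integral_neg] at this
  linarith

lemma integral_sq_mul_exp_neg_sq_half : ∫ z : ℝ, z ^ 2 * exp (-z ^ 2 / 2) = √(2 * π) := by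
  have h1 := ProbabilityTheory.variance_fun_id_gaussianReal (μ := 0) (v := 1)
  rw [ProbabilityTheory.variance_eq_integral (by fun_prop),
    ProbabilityTheory.integral_id_gaussianReal,
    ProbabilityTheory.integral_gaussianReal_eq_integral_smul (by norm_num)] at h1
  simp only [ProbabilityTheory.gaussianPDFReal, smul_eq_mul, NNReal.coe_one, mul_one, sub_zero]
    at h1
  have h2 : (√(2 * π))⁻¹ * ∫ z : ℝ, z ^ 2 * exp (-z ^ 2 / 2) = 1 := by
    rw [← h1, ← integral_const_mul]
    congr with z
    ring
  rwa [inv_mul_eq_one₀ (by positivity), eq_comm] at h2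

lemma norm_fourierR_exp_neg_sq_half (ξ : ℝ) :
    ‖fourierR (fun z => exp (-z ^ 2 / 2)) ξ‖ = √(2 * π) * exp (-2 * π ^ 2 * ξ ^ 2) := by
  have hb : 0 < (((1 / (2 * π) : ℝ)) : ℂ).re := by rw [Complex.ofReal_re]; positivity
  have h1 := congrFun (fourier_gaussian_pi hb) ξ
  have e : (fun x : ℝ => Complex.exp (-π * ((1 / (2 * π) : ℝ) : ℂ) * x ^ 2)) =
      fun z : ℝ => ((exp (-z ^ 2 / 2) : ℝ) : ℂ) := by
    funext z
    rw [Complex.ofReal_exp]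
    congr 1
    push_cast
    have : (π : ℂ) ≠ 0 := by exact_mod_cast Real.pi_ne_zero
    field_simp
  rw [e] at h1
  rw [fourierR, h1]
  have e2 : Complex.exp (-π / ((1 / (2 * π) : ℝ) : ℂ) * ξ ^ 2) =
      ((exp (-2 * π ^ 2 * ξ ^ 2) : ℝ) : ℂ) := by
    rw [Complex.ofReal_exp]
    congr 1
    push_cast
    have : (π : ℂ) ≠ 0 := by exact_mod_cast Real.pi_ne_zero
    field_simp
  have e3 : (((1 / (2 * π) : ℝ)) : ℂ) ^ (1 / 2 : ℂ) = (((1 / (2 * π)) ^ (1 / 2 : ℝ) : ℝ) : ℂ) := by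
    rw [Complex.ofReal_cpow (by positivity)]
    push_cast; rfl
  rw [e2, e3, ← Real.sqrt_eq_rpow, norm_mul, norm_div, norm_one, Complex.norm_real,
    Complex.norm_real, norm_of_nonneg (by positivity), norm_of_nonneg (by positivity),
    Real.sqrt_div zero_le_one, Real.sqrt_one, one_div_one_div]

lemma norm_fourierR_le_integral_abs (f : ℝ → ℝ) (ξ : ℝ) : ‖fourierR f ξ‖ ≤ ∫ x, |f x| := by
  rw [fourierR_apply]
  refine (norm_integral_le_integral_norm _).trans_eq ?_
  congr with x
  rw [norm_mul, Complex.norm_exp_ofReal_mul_I, one_mul, Complex.norm_real, Real.norm_eq_abs]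

lemma norm_fourierR_comp_add (f : ℝ → ℝ) (b ξ : ℝ) :
    ‖fourierR (fun u => f (u + b)) ξ‖ = ‖fourierR f ξ‖ := by
  rw [fourierR_apply, fourierR_apply]
  rw [← integral_add_right_eq_self
    (fun x => Complex.exp (((-2 * π * ξ * x : ℝ) : ℂ) * Complex.I) * f x) b]
  have : ∀ x, Complex.exp (((-2 * π * ξ * (x + b) : ℝ) : ℂ) * Complex.I) * (f (x + b) : ℂ) =
      Complex.exp (((-2 * π * ξ * b : ℝ) : ℂ) * Complex.I) *
      (Complex.exp (((-2 * π * ξ * x : ℝ) : ℂ) * Complex.I) * (f (x + b) : ℂ)) := by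
    intro x
    rw [← mul_assoc, ← Complex.exp_add]
    congr 2
    push_cast; ring
  simp_rw [this]
  rw [integral_const_mul, norm_mul, Complex.norm_exp_ofReal_mul_I, one_mul]

lemma abs_sub_cube_le (z m : ℝ) : |z - m| ^ 3 ≤ 4 * (|z| ^ 3 + |m| ^ 3) := by
  refine (pow_le_pow_left₀ (abs_nonneg _) (abs_sub _ _) 3).trans ?_
  have := abs_nonneg z
  have := abs_nonneg m
  nlinarith [mul_nonneg (add_nonneg (abs_nonneg z) (abs_nonneg m)) (sq_nonneg (|z| - |m|))]

/-- Constant bounding the normalized kernels. -/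
def nearGaussianConst : ℝ := 4 + 4 * (∫ z : ℝ, |z| ^ 3 * exp (-z ^ 2 / 2))

/-- A nonnegative kernel close to `exp (-z ^ 2 / 2)`, once centred and normalized, is
near-Gaussian. -/
lemma isNearGaussian_of_integral_le {k : ℝ → ℝ} {ε : ℝ} (hk : ∀ z, 0 ≤ k z)
    (hi : Integrable fun z => (1 + |z| ^ 3) * k z) (hkm : AEStronglyMeasurable k volume)
    (hε : ∫ z, (1 + |z| ^ 3) * |k z - exp (-z ^ 2 / 2)| ≤ ε) (hε2 : ε ≤ 1 / 2)
    (hk8 : ∀ z ≥ -3, k z ≤ 8) :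
    2 ≤ ∫ z, k z ∧
    IsNearGaussian (fun u => k (u + (∫ z, z * k z) / ∫ z, k z) / ∫ z, k z)
      nearGaussianConst (2 * ε) := by
  have bound : ∀ {F f : ℝ → ℝ}, Integrable (fun z => (1 + |z| ^ 3) * F z) →
      AEStronglyMeasurable F volume → Continuous f → (∀ z, |f z| ≤ 1 + |z| ^ 3) →
      Integrable fun z => f z * F z := by
    intro F f h1 h2 h3 h4
    refine h1.mono (h3.aestronglyMeasurable.mul h2) (.of_forall fun z => ?_)
    rw [norm_mul, norm_mul]
    refine mul_le_mul_of_nonneg_right ((h4 z).trans (le_abs_self _)) (norm_nonneg _)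
  have hGm : AEStronglyMeasurable (fun z : ℝ => exp (-z ^ 2 / 2)) volume :=
    Continuous.aestronglyMeasurable (by fun_prop)
  have hid : Integrable fun z => (1 + |z| ^ 3) * |k z - exp (-z ^ 2 / 2)| := by
    refine (hi.sub integrable_one_add_cube_mul_gaussian).abs.congr (.of_forall fun z => ?_)
    simp only [Pi.sub_apply]
    rw [← mul_sub, abs_mul, abs_of_nonneg (show 0 ≤ 1 + |z| ^ 3 by positivity)]
  have diff : ∀ {f : ℝ → ℝ}, Continuous f → (∀ z, |f z| ≤ 1 + |z| ^ 3) →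
      |(∫ z, f z * k z) - ∫ z, f z * exp (-z ^ 2 / 2)| ≤ ε := by
    intro f h3 h4
    rw [← integral_sub (bound hi hkm h3 h4) (bound integrable_one_add_cube_mul_gaussian hGm h3 h4)]
    refine (abs_integral_le_integral_abs).trans (le_trans ?_ hε)
    refine integral_mono_of_nonneg (.of_forall fun z => abs_nonneg _) hid (.of_forall fun z => ?_)
    simp only []
    rw [← mul_sub, abs_mul]
    exact mul_le_mul_of_nonneg_right (h4 z) (abs_nonneg _)
  have b0 : ∀ z : ℝ, |(1 : ℝ)| ≤ 1 + |z| ^ 3 := fun z => by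
    rw [abs_one]; linarith [pow_nonneg (abs_nonneg z) 3]
  have bj : ∀ j ≤ 3, ∀ z : ℝ, |z ^ j| ≤ 1 + |z| ^ 3 := fun j hj z => by
    rw [abs_pow]
    rcases le_total |z| 1 with hu | hu
    · linarith [pow_le_one₀ (n := j) (abs_nonneg z) hu, pow_nonneg (abs_nonneg z) 3]
    · linarith [pow_le_pow_right₀ hu hj]
  have b1 : ∀ z : ℝ, |z| ≤ 1 + |z| ^ 3 := by simpa using bj 1 (by norm_num)
  have b2 := bj 2 (by norm_num)
  have b3 : ∀ z : ℝ, abs (|z| ^ 3) ≤ 1 + |z| ^ 3 := fun z => by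
    rw [abs_pow, abs_abs]; linarith
  have i0 : Integrable k := by simpa using bound hi hkm continuous_const b0
  have i1 := bound hi hkm continuous_id b1
  have i2 := bound hi hkm (f := fun z => z ^ 2) (by fun_prop) b2
  have i3 := bound hi hkm (f := fun z => |z| ^ 3) (by fun_prop) b3
  have d0 := diff continuous_const b0
  have d1 := diff continuous_id b1
  have d2 := diff (f := fun z => z ^ 2) (by fun_prop) b2
  have d3 := diff (f := fun z => |z| ^ 3) (by fun_prop) b3
  simp only [one_mul, id] at d0 d1 d2 d3 i1 i2 i3
  rw [integral_exp_neg_sq_half] at d0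
  rw [integral_id_mul_exp_neg_sq_half, sub_zero] at d1
  rw [integral_sq_mul_exp_neg_sq_half] at d2
  have I3 : 0 ≤ ∫ z : ℝ, |z| ^ 3 * exp (-z ^ 2 / 2) := integral_nonneg fun z => by positivity
  set Z := ∫ z, k z with hZ
  set M1 := ∫ z, z * k z with hM1
  set M2 := ∫ z, z ^ 2 * k z with hM2
  set M3 := ∫ z, |z| ^ 3 * k z with hM3
  have hs : 5 / 2 ≤ √(2 * π) := by
    refine Real.le_sqrt_of_sq_le ?_
    linarith [Real.pi_gt_d4]
  have hε0 : 0 ≤ ε := (abs_nonneg _).trans d0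
  have hZ2 : 2 ≤ Z := by linarith [(abs_le.1 d0).1]
  have hZ0 : 0 < Z := by linarith
  refine ⟨hZ2, ?_⟩
  set m := M1 / Z with hm
  have hmε : |m| ≤ ε / 2 := by
    rw [hm, abs_div, abs_of_pos hZ0, div_le_iff₀ hZ0]
    nlinarith
  have e1 : ∀ F : ℝ → ℝ, ∫ u, F u * (k (u + m) / Z) = (∫ z, F (z - m) * k z) / Z := by
    intro F
    rw [← integral_add_right_eq_self (fun z => F (z - m) * k z) m, ← integral_div]
    congr with u
    rw [add_sub_cancel_right, mul_div_assoc]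
  have hInt : ∫ u, k (u + m) / Z = 1 := by
    have := e1 fun _ => 1
    simp only [one_mul] at this
    rw [this, div_self hZ0.ne']
  have hcube : Integrable fun z => |z - m| ^ 3 * k z := by
    refine ((i3.add (i0.const_mul (|m| ^ 3))).const_mul 4).mono'
      ((Continuous.aestronglyMeasurable (by fun_prop)).mul hkm) (.of_forall fun z => ?_)
    rw [norm_of_nonneg (mul_nonneg (by positivity) (hk z))]
    have := mul_le_mul_of_nonneg_right (abs_sub_cube_le z m) (hk z)
    simp only [Pi.add_apply]
    linarith
  refine ⟨fun u => div_nonneg (hk _) hZ0.le, (i0.comp_add_right m).div_const Z, hInt, ?_, ?_, ?_,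
    ?_, ?_, ?_⟩
  · refine ((hcube.comp_add_right m).div_const Z).congr (.of_forall fun u => ?_)
    simp only [add_sub_cancel_right]
    ring
  · rw [e1 fun u => u]
    have : ∫ z, (z - m) * k z = 0 := by
      simp_rw [sub_mul]
      rw [integral_sub i1 (i0.const_mul m), integral_const_mul, hm]
      field_simp
      ring
    rw [this, zero_div]
  · rw [e1 fun u => u ^ 2]
    have : ∫ z, (z - m) ^ 2 * k z = M2 - m ^ 2 * Z := by
      have e : ∀ z, (z - m) ^ 2 * k z = z ^ 2 * k z - 2 * m * (z * k z) + m ^ 2 * k z := by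
        intro z; ring
      simp_rw [e]
      rw [integral_add (by exact i2.sub (i1.const_mul (2 * m))) (i0.const_mul _),
        integral_sub i2 (i1.const_mul (2 * m)), integral_const_mul, integral_const_mul,
        ← hM1, ← hM2, ← hZ]
      have : M1 = m * Z := by rw [hm]; field_simp
      rw [this]; ring
    rw [this]
    have e : (M2 - m ^ 2 * Z) / Z - 1 = (M2 - Z) / Z - m ^ 2 := by field_simp; ring
    rw [e]
    have h1 : |(M2 - Z) / Z| ≤ ε := by
      rw [abs_div, abs_of_pos hZ0, div_le_iff₀ hZ0]
      rw [abs_le] at d0 d2 ⊢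
      constructor <;> nlinarith
    have h2 : m ^ 2 ≤ ε := by
      rw [← sq_abs]
      nlinarith [abs_nonneg m]
    rw [abs_le] at h1 ⊢
    constructor <;> nlinarith [sq_nonneg m]
  · rw [e1 fun u => |u| ^ 3, div_le_iff₀ hZ0, nearGaussianConst]
    have h1 : ∫ z, |z - m| ^ 3 * k z ≤ ∫ z, 4 * (|z| ^ 3 * k z + |m| ^ 3 * k z) := by
      refine integral_mono hcube ((i3.add (i0.const_mul (|m| ^ 3))).const_mul 4) fun z => ?_
      have := mul_le_mul_of_nonneg_right (abs_sub_cube_le z m) (hk z)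
      simp only []
      linarith
    rw [integral_const_mul, integral_add i3 (i0.const_mul _), integral_const_mul, ← hM3, ← hZ] at h1
    have h2 : |m| ^ 3 ≤ 1 / 8 := by
      have : |m| ≤ 1 / 2 := by linarith
      exact (pow_le_pow_left₀ (abs_nonneg m) this 3).trans (by norm_num)
    have h3 := (abs_le.1 d3).2
    nlinarith
  · intro u hu
    rw [nearGaussianConst, div_le_iff₀ hZ0]
    have h1 := hk8 (u + m) (by linarith [(abs_le.1 hmε).1])
    nlinarith
  · intro ξ
    have e : (fun u => k (u + m) / Z) = fun u => Z⁻¹ * k (u + m) := by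
      funext u; rw [div_eq_inv_mul]
    rw [e, fourierR_const_mul Z⁻¹, norm_mul, norm_fourierR_comp_add k, Complex.norm_real,
      norm_of_nonneg (by positivity), inv_mul_le_iff₀ hZ0]
    have iG : Integrable fun z : ℝ => exp (-z ^ 2 / 2) := by
      simpa using bound integrable_one_add_cube_mul_gaussian hGm continuous_const b0
    have h1 : fourierR k ξ = fourierR (fun z => exp (-z ^ 2 / 2)) ξ +
        fourierR (fun z => k z - exp (-z ^ 2 / 2)) ξ := by
      rw [← fourierR_add iG (g := fun z => k z - exp (-z ^ 2 / 2)) (by exact i0.sub iG)]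
      congr 1
      funext z; ring
    have h2 : ‖fourierR (fun z => k z - exp (-z ^ 2 / 2)) ξ‖ ≤ ε := by
      refine (norm_fourierR_le_integral_abs _ _).trans (le_trans ?_ hε)
      refine integral_mono_of_nonneg (.of_forall fun z => abs_nonneg _) hid
        (.of_forall fun z => ?_)
      exact le_mul_of_one_le_left (abs_nonneg _) (by linarith [pow_nonneg (abs_nonneg z) 3])
    have h3 := norm_add_le (fourierR (fun z => exp (-z ^ 2 / 2)) ξ)
      (fourierR (fun z => k z - exp (-z ^ 2 / 2)) ξ)
    rw [← h1, norm_fourierR_exp_neg_sq_half] at h3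
    have h4 : exp (-2 * π ^ 2 * ξ ^ 2) ≤ 1 := by
      rw [exp_le_one_iff]; nlinarith [sq_nonneg (π * ξ)]
    have h5 := exp_pos (-2 * π ^ 2 * ξ ^ 2)
    have h6 := (abs_le.1 d0).1
    nlinarith

section Mean
variable {p : ℝ → ℝ}

lemma mgfFun_eq_integral (hp0 : ∀ x < (0 : ℝ), p x = 0) (t : ℝ) :
    mgfFun p t = ∫ x, exp (t * x) * p x := by
  refine setIntegral_eq_integral_of_forall_compl_eq_zero fun x hx => ?_
  rw [hp0 x (by simpa using hx), mul_zero]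

lemma integral_withDensity_ofReal (hpn : ∀ x, 0 ≤ p x) (hpm : AEMeasurable p volume) (F : ℝ → ℝ) :
    ∫ x, F x ∂(volume.withDensity fun x => ENNReal.ofReal (p x)) = ∫ x, F x * p x := by
  rw [integral_withDensity_eq_integral_toReal_smul₀ hpm.ennreal_ofReal
    (.of_forall fun x => ENNReal.ofReal_lt_top)]
  congr with x
  rw [ENNReal.toReal_ofReal (hpn x), smul_eq_mul, mul_comm]

lemma integrable_withDensity_ofReal (hpn : ∀ x, 0 ≤ p x) (hpm : AEMeasurable p volume) (F : ℝ → ℝ) :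
    Integrable F (volume.withDensity fun x => ENNReal.ofReal (p x)) ↔
      Integrable fun x => F x * p x := by
  rw [integrable_withDensity_iff_integrable_smul₀' hpm.ennreal_ofReal
    (.of_forall fun x => ENNReal.ofReal_lt_top)]
  refine integrable_congr (.of_forall fun x => ?_)
  simp only []
  rw [ENNReal.toReal_ofReal (hpn x), smul_eq_mul, mul_comm]

open ProbabilityTheory in
lemma mFun_eq_and_monotone (hpn : ∀ x, 0 ≤ p x) (hp0 : ∀ x < (0 : ℝ), p x = 0)
    (hpm : AEMeasurable p volume) (hInt : ∀ t, Integrable fun x => exp (t * x) * p x) :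
    (∀ t, mFun p t = (∫ x, x * (exp (t * x) * p x)) / mgfFun p t) ∧ Monotone (mFun p) := by
  set μ := volume.withDensity fun x => ENNReal.ofReal (p x) with hμ
  have hset : ∀ t, t ∈ interior (integrableExpSet id μ) := by
    have : integrableExpSet id μ = univ :=
      eq_univ_of_forall fun t => (integrable_withDensity_ofReal hpn hpm _).2 (hInt t)
    simp [this]
  have hmgf : mgf id μ = mgfFun p := by
    funext t
    rw [mgfFun_eq_integral hp0, mgf, hμ, integral_withDensity_ofReal hpn hpm]
    rfl
  have hm : deriv (cgf id μ) = mFun p := by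
    have : cgf id μ = fun t => log (mgfFun p t) := by rw [← hmgf]; rfl
    rw [this]; rfl
  constructor
  · intro t
    rw [← hm, deriv_cgf (hset t), hmgf, hμ, integral_withDensity_ofReal hpn hpm]
    congr 2 with x
    simp only [id]
    ring
  · have hd : Differentiable ℝ (deriv (cgf id μ)) := by
      intro t
      have h := ((analyticAt_cgf (hset t)).deriv).differentiableAt
      exact h
    rw [← hm]
    refine monotone_of_deriv_nonneg hd fun t => ?_
    have := iteratedDeriv_two_cgf_eq_integral (hset t)
    rw [iteratedDeriv_succ, iteratedDeriv_one] at this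
    rw [this]
    refine div_nonneg (integral_nonneg fun x => ?_) mgf_nonneg
    exact mul_nonneg (sq_nonneg _) (exp_pos _).le

end Mean

lemma integral_abs_condDensity_sub_tilt (p : ℝ → ℝ) (a : ℕ → ℝ) (n : ℕ) (t : ℝ) {σ : ℝ}
    (hσ : 0 < σ) (hn : 3 ≤ n) (hΦ : mgfFun p t ≠ 0) :
    ∫ y, |condDensity p a n y - tilt p t y| =
      ∫ u, |(fun v => σ * tilt p t (a n + σ * v)) u *
        convPow (fun v => σ * tilt p t (a n + σ * v)) (n - 1) (-u) /
        convPow (fun v => σ * tilt p t (a n + σ * v)) n 0 - σ * tilt p t (a n + σ * u)| := by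
  rw [integral_comp_affine _ hσ (a n), ← integral_const_mul]
  congr with u
  rw [← abs_of_pos hσ, ← abs_mul, abs_of_pos hσ]
  congr 1
  simp only [tilt]
  rw [convPow_tilt p hσ (a n) t (mgfFun p t) (by omega),
    convPow_tilt p hσ (a n) t (mgfFun p t) (by omega), condDensity, mul_sub]
  congr 1
  have e0 : ((n - 1 : ℕ) : ℝ) = n - 1 := by rw [Nat.cast_sub (by omega)]; simp
  have e1 : ((n - 1 : ℕ) : ℝ) * a n + σ * -u = n * a n - (a n + σ * u) := by rw [e0]; ring
  have e2 : exp (t * (n * a n)) =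
      exp (t * (a n + σ * u)) * exp (t * (n * a n - (a n + σ * u))) := by
    rw [← Real.exp_add]; congr 1; ring
  have e3 : mgfFun p t ^ n = mgfFun p t * mgfFun p t ^ (n - 1) := by
    rw [← pow_succ']; congr 1; omega
  rw [e1, mul_zero, add_zero, e2, e3]
  rcases eq_or_ne (convPow p n (n * a n)) 0 with h | h
  · simp [h]
  · have := (exp_pos (t * (a n + σ * u))).ne'
    have := (exp_pos (t * (n * a n - (a n + σ * u)))).ne'
    field_simp

/-- The tilted density, centred at its mean, is near-Gaussian on the scale `S`. -/
lemma isNearGaussian_tilt {p g : ℝ → ℝ} {c X S t ε : ℝ} (hc : 0 < c) (hS : 0 < S)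
    (hpn : ∀ x, 0 ≤ p x) (hp0 : ∀ x < (0 : ℝ), p x = 0) (hpint : Integrable p)
    (hInt : ∀ t, Integrable fun x => exp (t * x) * p x)
    (hi : Integrable fun z => (1 + |z| ^ 3) * laplaceKernel p g c X S t z)
    (hε : ∫ z, (1 + |z| ^ 3) * |laplaceKernel p g c X S t z - exp (-z ^ 2 / 2)| ≤ ε)
    (hε2 : ε ≤ 1 / 2) (hk8 : ∀ z ≥ -3, laplaceKernel p g c X S t z ≤ 8) :
    IsNearGaussian (fun u => S * tilt p t (mFun p t + S * u)) nearGaussianConst (2 * ε) ∧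
      mgfFun p t ≠ 0 := by
  obtain ⟨hZ, hw⟩ := isNearGaussian_of_integral_le
    (laplaceKernel_nonneg g hc hpn X S t) hi (aestronglyMeasurable_laplaceKernel g c hpint hS)
    hε hε2 hk8
  set D := exp (g X - t * X) / c with hD
  have hD0 : 0 < D := by positivity
  have hker : ∀ z, laplaceKernel p g c X S t z = D * (exp (t * (X + S * z)) * p (X + S * z)) := by
    intro z
    rw [laplaceKernel, hD]
    have : exp (t * (S * z) + g X) = exp (g X - t * X) * exp (t * (X + S * z)) := by
      rw [← Real.exp_add]; congr 1; ring
    rw [this]; ring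
  have hInt0 : S * ∫ z, laplaceKernel p g c X S t z = D * mgfFun p t := by
    simp_rw [hker]
    rw [integral_const_mul, mul_left_comm, mgfFun_eq_integral hp0,
      integral_comp_affine (fun x => exp (t * x) * p x) hS X]
  set Z := ∫ z, laplaceKernel p g c X S t z with hZdef
  have hΦ : 0 < mgfFun p t := by
    have : 0 < D * mgfFun p t := by rw [← hInt0]; nlinarith
    exact (pos_iff_pos_of_mul_pos this).1 hD0
  have hk1 : Integrable fun z => z * laplaceKernel p g c X S t z := by
    refine hi.mono ((Continuous.aestronglyMeasurable (by fun_prop)).mul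
      (aestronglyMeasurable_laplaceKernel g c hpint hS)) (.of_forall fun z => ?_)
    rw [norm_mul, norm_mul]
    refine mul_le_mul_of_nonneg_right ?_ (norm_nonneg _)
    rw [Real.norm_eq_abs, norm_of_nonneg (by positivity)]
    rcases le_total |z| 1 with h | h
    · linarith [pow_nonneg (abs_nonneg z) 3]
    · linarith [le_self_pow₀ h (show 3 ≠ 0 by norm_num)]
  have hk0 : Integrable (laplaceKernel p g c X S t) := by
    have : Integrable fun z => D * (exp (t * (X + S * z)) * p (X + S * z)) :=
      (integrable_comp_affine (hInt t) hS X).const_mul D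
    exact this.congr (.of_forall fun z => (hker z).symm)
  have hmean : X + S * ((∫ z, z * laplaceKernel p g c X S t z) / Z) = mFun p t := by
    rw [(mFun_eq_and_monotone hpn hp0 hpint.1.aemeasurable hInt).1 t, eq_div_iff hΦ.ne']
    have h1 : D * ∫ x, x * (exp (t * x) * p x) =
        S * (X * Z + S * ∫ z, z * laplaceKernel p g c X S t z) := by
      have e : ∫ z, (X * laplaceKernel p g c X S t z + S * (z * laplaceKernel p g c X S t z)) =
          X * Z + S * ∫ z, z * laplaceKernel p g c X S t z := by
        rw [integral_add (hk0.const_mul X) (hk1.const_mul S), integral_const_mul,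
          integral_const_mul]
      rw [integral_comp_affine (fun x => x * (exp (t * x) * p x)) hS X, mul_left_comm, ← e,
        ← integral_const_mul]
      congr 2 with z
      rw [hker]; ring
    have hZ0 : Z ≠ 0 := by linarith
    refine mul_left_cancel₀ hD0.ne' ?_
    rw [h1, mul_left_comm, ← hInt0]
    field_simp
  refine ⟨?_, hΦ.ne'⟩
  convert hw using 2 with u
  rw [hker, ← hmean, tilt]
  have e : X + S * (u + (∫ z, z * laplaceKernel p g c X S t z) / Z) =
    X + S * ((∫ z, z * laplaceKernel p g c X S t z) / Z) + S * u := by ring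
  rw [e]
  rw [mul_div_assoc', div_eq_div_iff hΦ.ne' (by linarith)]
  linear_combination (exp (t * (X + S * ((∫ z, z * laplaceKernel p g c X S t z) / Z) + S * u)) *
    p (X + S * ((∫ z, z * laplaceKernel p g c X S t z) / Z) + S * u)) * hInt0

/-- The Gibbs conditioning principle, given a Laplace scale. -/
lemma LaplaceScale.tendsto_integral_abs_condDensity_sub_tilt {p g q h X S : ℝ → ℝ} {A c : ℝ}
    (H : LaplaceScale g h X S A) (hg : ∀ x, HasDerivAt g (h x) x) (hc : 0 < c)
    (hp : ∀ x ≥ (0 : ℝ), p x = c * exp (-(g x - q x))) (hp0 : ∀ x < (0 : ℝ), p x = 0)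
    (hInt : ∀ t, Integrable fun x => exp (t * x) * p x)
    (hq0 : Tendsto q atTop (𝓝 0)) {a tseq : ℕ → ℝ} (ha : Tendsto a atTop atTop)
    (htm : ∀ n, mFun p (tseq n) = a n) :
    Tendsto (fun n : ℕ => ∫ y, |condDensity p a n y - tilt p (tseq n) y|) atTop (𝓝 0) := by
  have hpint : Integrable p := by simpa using hInt 0
  have hpn : ∀ x, 0 ≤ p x := fun x => by
    rcases lt_or_ge x 0 with hx | hx
    · rw [hp0 x hx]
    · rw [hp x hx]; positivity
  obtain ⟨B, hB⟩ := eventually_atTop.1 ((hq0.abs).eventually_le_const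
    (show |(0 : ℝ)| < 1 by simp))
  replace H := H.of_le (le_max_left A B)
  have hq1 : ∀ x ≥ max A B, |q x| ≤ 1 := fun x hx => hB x ((le_max_right _ _).trans hx)
  obtain ⟨hI, hL⟩ := H.tendsto_integral_laplaceKernel_sub hg hc hp hp0 hpint hq0 hq1
  set ε : ℝ → ℝ := fun t => ∫ z, (1 + |z| ^ 3) *
    |laplaceKernel p g c (X t) (S t) t z - exp (-z ^ 2 / 2)| with hεdef
  have ht : Tendsto tseq atTop atTop := by
    refine tendsto_atTop.2 fun b => ?_
    filter_upwards [ha.eventually_gt_atTop (mFun p b)] with n hn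
    by_contra hcon
    have := (mFun_eq_and_monotone hpn hp0 hpint.1.aemeasurable hInt).2 (not_le.1 hcon).le
    rw [htm] at this
    linarith
  have hnear : ∀ᶠ t in atTop,
      (IsNearGaussian (fun u => S t * tilt p t (mFun p t + S t * u)) nearGaussianConst (2 * ε t) ∧
      mgfFun p t ≠ 0) ∧ 0 < S t := by
    filter_upwards [hI, H.eventually_laplaceKernel_le_const hg hc hp hq1, H.S_pos,
      hL.eventually_le_const (show (0 : ℝ) < 1 / 2 by norm_num)] with t h1 h2 h3 h4
    exact ⟨isNearGaussian_tilt hc h3 hpn hp0 hpint hInt h1 le_rfl h4 h2, h3⟩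
  obtain ⟨N, hN⟩ := eventually_atTop.1 (ht.eventually hnear)
  rw [← tendsto_add_atTop_iff_nat (N + 3)]
  have key := tendsto_integral_abs_conditioned_sub
    (w := fun n u => S (tseq (n + (N + 3))) *
      tilt p (tseq (n + (N + 3))) (a (n + (N + 3)) + S (tseq (n + (N + 3))) * u))
    (C := nearGaussianConst) (η := fun n => 2 * ε (tseq (n + (N + 3)))) (k := fun n => n + N)
    (fun n => by
      have := (hN (n + (N + 3)) (by omega)).1.1
      rwa [htm] at this) (by
      have := ((hL.comp ht).const_mul 2).comp (tendsto_add_atTop_nat (N + 3))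
      rwa [mul_zero] at this) (tendsto_add_atTop_nat N)
  refine key.congr fun n => ?_
  rw [integral_abs_condDensity_sub_tilt p a _ _ (hN (n + (N + 3)) (by omega)).2 (by omega)
    (hN (n + (N + 3)) (by omega)).1.2]
  rfl

/-- Second-order Taylor formula with Lagrange remainder, for increments of either sign. -/
lemma exists_sub_sub_eq_second_deriv {g h h₂ : ℝ → ℝ} {x d : ℝ}
    (hg : ∀ x, HasDerivAt g (h x) x)
    (hh : ∀ θ ∈ Icc (0 : ℝ) 1, HasDerivAt h (h₂ (x + θ * d)) (x + θ * d)) :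
    ∃ θ ∈ Ioo (0 : ℝ) 1, g (x + d) - g x - h x * d = d ^ 2 / 2 * h₂ (x + θ * d) := by
  have hline : ∀ θ, HasDerivAt (fun θ => x + θ * d) d θ := fun θ => by
    simpa using ((hasDerivAt_id θ).mul_const d).const_add x
  have hF : ∀ θ, HasDerivAt (fun θ => g (x + θ * d) - h x * d * θ)
      (h (x + θ * d) * d - h x * d) θ := fun θ => by
    have := ((hg (x + θ * d)).comp θ (hline θ)).sub ((hasDerivAt_id θ).const_mul (h x * d))
    rw [mul_one] at this
    exact this
  have hG : ∀ θ : ℝ, HasDerivAt (fun θ => θ ^ 2) (2 * θ) θ := fun θ => by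
    simpa using hasDerivAt_pow 2 θ
  obtain ⟨α, hα, e1⟩ := exists_ratio_hasDerivAt_eq_ratio_slope _ _ zero_lt_one
    (fun θ _ => (hF θ).continuousAt.continuousWithinAt) (fun θ _ => hF θ) _ _
    (fun θ _ => (hG θ).continuousAt.continuousWithinAt) (fun θ _ => hG θ)
  have hH : ∀ θ ∈ Icc 0 α, HasDerivAt (fun θ => h (x + θ * d)) (h₂ (x + θ * d) * d) θ :=
    fun θ hθ => (hh θ ⟨hθ.1, hθ.2.trans hα.2.le⟩).comp θ (hline θ)
  obtain ⟨θ, hθ, e2⟩ := exists_hasDerivAt_eq_slope _ _ hα.1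
    (fun θ hθ => (hH θ hθ).continuousAt.continuousWithinAt)
    (fun θ hθ => hH θ ⟨hθ.1.le, hθ.2.le⟩)
  refine ⟨θ, ⟨hθ.1, hθ.2.trans hα.2⟩, ?_⟩
  have hα0 := hα.1
  rw [eq_div_iff (by linarith)] at e2
  simp only [one_mul, zero_mul, add_zero, mul_one, mul_zero, sub_zero] at e1 e2
  have : (g (x + d) - g x - h x * d) * (2 * α) = d ^ 2 / 2 * h₂ (x + θ * d) * (2 * α) := by
    linear_combination -e1 + (-d) * e2
  exact mul_right_cancel₀ (by positivity) this

/-- A second-derivative criterion for Laplace scales: `h' = h₂` should be asymptotically constant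
on the scale `S = 1 / √(h₂ X)` around `X`. -/
lemma exists_laplaceScale_of_second_deriv {g h h₂ X S : ℝ → ℝ} (hg : ∀ x, HasDerivAt g (h x) x)
    (hh : ∀ᶠ x in atTop, HasDerivAt h (h₂ x) x) (hpos : ∀ᶠ x in atTop, 0 < h₂ x)
    (hX : Tendsto X atTop atTop) (hcrit : ∀ᶠ t in atTop, h (X t) = t)
    (hSpos : ∀ᶠ t in atTop, 0 < S t) (hS : ∀ᶠ t in atTop, S t ^ 2 * h₂ (X t) = 1)
    (hratio : Tendsto (fun t => X t / S t) atTop atTop)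
    (hr : ∀ (ζ : ℝ → ℝ) (K : ℝ), (∀ᶠ t in atTop, |ζ t - X t| ≤ K * S t) →
      Tendsto (fun t => h₂ (ζ t) / h₂ (X t)) atTop (𝓝 1)) :
    ∃ A, LaplaceScale g h X S A := by
  obtain ⟨B, hB⟩ := eventually_atTop.1 (hh.and hpos)
  have hpos' : ∀ x ≥ max B 0, HasDerivAt h (h₂ x) x ∧ 0 < h₂ x :=
    fun x hx => hB x ((le_max_left _ _).trans hx)
  refine ⟨max B 0, le_max_right _ _, ?_, hX, hSpos, hratio, hcrit, ?_⟩
  · refine monotoneOn_of_deriv_nonneg (convex_Ici _)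
      (fun x hx => (hpos' x hx).1.continuousAt.continuousWithinAt)
      (fun x hx => (hpos' x (interior_subset hx)).1.differentiableAt.differentiableWithinAt)
      fun x hx => ?_
    rw [(hpos' x (interior_subset hx)).1.deriv]
    exact (hpos' x (interior_subset hx)).2.le
  · intro z
    have hex : ∀ t, ∃ θ, (max B 0 ≤ X t - S t * |z| → 0 < S t → θ ∈ Ioo (0 : ℝ) 1 ∧
        g (X t + S t * z) - g (X t) - h (X t) * (S t * z) =
          (S t * z) ^ 2 / 2 * h₂ (X t + θ * (S t * z))) := by
      intro t
      by_cases hc : max B 0 ≤ X t - S t * |z| ∧ 0 < S t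
      · obtain ⟨θ, h1, h2⟩ := exists_sub_sub_eq_second_deriv (h₂ := h₂) (x := X t) (d := S t * z)
          hg fun θ hθ => (hpos' _ (by
            refine hc.1.trans ?_
            have h3 : |θ * (S t * z)| ≤ S t * |z| := by
              rw [abs_mul, abs_mul, abs_of_nonneg hθ.1, abs_of_pos hc.2]
              exact mul_le_of_le_one_left (by have := hc.2; positivity) hθ.2
            have := neg_abs_le (θ * (S t * z))
            linarith)).1
        exact ⟨θ, fun _ _ => ⟨h1, h2⟩⟩
      · exact ⟨0, fun h1 h2 => absurd ⟨h1, h2⟩ hc⟩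
    choose θ hθ using hex
    have hlarge : ∀ᶠ t in atTop, max B 0 ≤ X t - S t * |z| := by
      filter_upwards [hSpos, hratio.eventually_ge_atTop (2 * |z|),
        hX.eventually_ge_atTop (2 * max B 0)] with t h1 h2 h3
      rw [le_div_iff₀ h1] at h2
      nlinarith
    have hlim := (hr (fun t => X t + θ t * (S t * z)) |z| (by
      filter_upwards [hlarge, hSpos] with t h1 h2
      have h3 := (hθ t h1 h2).1
      rw [add_sub_cancel_left, abs_mul, abs_mul, abs_of_pos h3.1, abs_of_pos h2, mul_comm |z|]
      exact mul_le_of_le_one_left (by positivity) h3.2.le)).const_mul (z ^ 2 / 2)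
    rw [mul_one] at hlim
    refine hlim.congr' ?_
    filter_upwards [hlarge, hSpos, hS, hcrit, hX.eventually_ge_atTop (max B 0)] with
      t h1 h2 h3 h4 h5
    have h6 := (hθ t h1 h2).2
    rw [h4] at h6
    rw [h6]
    have h7 := (hpos' _ h5).2.ne'
    generalize h₂ (X t + θ t * (S t * z)) = w
    field_simp
    linear_combination (-(z ^ 2 * w)) * h3

lemma hasDerivAt_exp_integral {ε : ℝ → ℝ} (hε : Continuous ε) {f : ℝ → ℝ}
    (hf : ∀ x ≥ (1 : ℝ), f x = exp (∫ u in (1 : ℝ)..x, ε u / u)) {x : ℝ} (hx : 1 < x) :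
    HasDerivAt f (f x * ε x / x) x := by
  have hc : ContinuousOn (fun u => ε u / u) (Ioi 0) :=
    hε.continuousOn.div continuousOn_id fun u hu => (show (0 : ℝ) < u from hu).ne'
  have h1 : HasDerivAt (fun x => ∫ u in (1 : ℝ)..x, ε u / u) (ε x / x) x := by
    refine intervalIntegral.integral_hasDerivAt_right ?_ ?_ ?_
    · refine ContinuousOn.intervalIntegrable (hc.mono fun u hu => ?_)
      rw [uIcc_of_le hx.le] at hu
      exact zero_lt_one.trans_le hu.1
    · exact hc.stronglyMeasurableAtFilter isOpen_Ioi x (zero_lt_one.trans hx)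
    · exact hc.continuousAt (Ioi_mem_nhds (zero_lt_one.trans hx))
  have h2 := h1.exp
  rw [← hf x hx.le, ← mul_div_assoc] at h2
  refine h2.congr_of_eventuallyEq ?_
  filter_upwards [Ioi_mem_nhds hx] with y hy using hf y (le_of_lt hy)

/-- Mean value bound on `[b, ∞)`. -/
lemma abs_sub_le_of_hasDerivAt {f f' : ℝ → ℝ} {b M x y : ℝ} (hf : ∀ u ≥ b, HasDerivAt f (f' u) u)
    (hM : ∀ u ≥ b, |f' u| ≤ M) (hx : b ≤ x) (hy : b ≤ y) : |f y - f x| ≤ M * |y - x| :=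
  (convex_Ici b).norm_image_sub_le_of_norm_hasDerivWithin_le
    (fun u hu => (hf u hu).hasDerivWithinAt) (fun u hu => hM u hu) hx hy

/-- Regularly varying `h` admits a Laplace scale. -/
lemma MemRbeta.exists_laplaceScale {g h : ℝ → ℝ} {β : ℝ} (hβ : MemRbeta h β)
    (hg : ∀ x, HasDerivAt g (h x) x) : ∃ X S A, LaplaceScale g h X S A := by
  obtain ⟨hβ0, l, ε, ε', -, ⟨hε, -, hε0, hl⟩, hh, -, -⟩ := hβ
  have hεc : Continuous ε := continuous_iff_continuousAt.2 fun x => (hε x).continuousAt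
  have hsmall : ∀ᶠ x in atTop, |ε x| ≤ β / 2 :=
    hε0.abs.eventually_le_const (by rw [abs_zero]; positivity)
  obtain ⟨B, hB⟩ := eventually_atTop.1 (hh.and (hsmall.and (eventually_gt_atTop 1)))
  have hB1 : 1 < B := (hB B le_rfl).2.2
  set h₂ : ℝ → ℝ := fun x => h x * ((β + ε x) / x) with hh₂
  have hhpos : ∀ x ≥ B, 0 < h x := fun x hx => by
    rw [(hB x hx).1, hl x (hB x hx).2.2.le]
    have : 0 < x := by linarith
    positivity
  have hεb : ∀ x ≥ B, β / 2 ≤ β + ε x ∧ β + ε x ≤ 2 * β := fun x hx => by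
    have := abs_le.1 (hB x hx).2.1
    constructor <;> linarith
  have hder : ∀ x > B, HasDerivAt h (h₂ x) x := fun x hx => by
    have hx0 : 0 < x := by linarith
    have h1 := (hasDerivAt_rpow_const (x := x) (p := β) (Or.inl hx0.ne')).mul
      (hasDerivAt_exp_integral hεc hl (x := x) (by linarith))
    have h2 : HasDerivAt h (β * x ^ (β - 1) * l x + x ^ β * (l x * ε x / x)) x := by
      refine h1.congr_of_eventuallyEq ?_
      filter_upwards [Ioi_mem_nhds hx] with y hy using (hB y (le_of_lt hy)).1
    refine h2.congr_deriv ?_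
    simp only [hh₂]
    rw [(hB x hx.le).1, rpow_sub_one hx0.ne']
    field_simp
  have hlog : ∀ x > B, HasDerivAt (fun x => log (h x)) ((β + ε x) / x) x := fun x hx => by
    refine ((hder x hx).log (hhpos x hx.le).ne').congr_deriv ?_
    simp only [hh₂]
    rw [mul_div_cancel_left₀ _ (hhpos x hx.le).ne']
  have hpos₂ : ∀ x ≥ B, 0 < h₂ x := fun x hx => by
    have := (hεb x hx).1
    exact mul_pos (hhpos x hx) (div_pos (by linarith) (by linarith))
  have hmono : MonotoneOn h (Ici (B + 1)) := by
    refine monotoneOn_of_deriv_nonneg (convex_Ici _)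
      (fun x (hx : B + 1 ≤ x) => (hder x (by linarith)).continuousAt.continuousWithinAt)
      (fun x hx => (hder x (lt_of_lt_of_le (lt_add_one B)
        (interior_subset hx))).differentiableAt.differentiableWithinAt) fun x hx => ?_
    have hx' : B + 1 ≤ x := interior_subset hx
    rw [(hder x (by linarith)).deriv]
    exact (hpos₂ x (by linarith)).le
  have hlim : Tendsto h atTop atTop := by
    have hm : MonotoneOn (fun x => log (h x) - β / 2 * log x) (Ici (B + 1)) := by
      have hd : ∀ x ≥ B + 1, HasDerivAt (fun x => log (h x) - β / 2 * log x)
          ((β + ε x) / x - β / 2 * x⁻¹) x := fun x hx =>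
        (hlog x (by linarith)).sub ((hasDerivAt_log (by linarith)).const_mul _)
      refine monotoneOn_of_deriv_nonneg (convex_Ici _)
        (fun x hx => (hd x hx).continuousAt.continuousWithinAt)
        (fun x hx => (hd x (interior_subset hx)).differentiableAt.differentiableWithinAt)
        fun x hx => ?_
      have hx' : B + 1 ≤ x := interior_subset hx
      rw [(hd x hx').deriv]
      have hx0 : 0 < x := by linarith
      rw [← div_eq_mul_inv, ← sub_div]
      exact div_nonneg (by linarith [(hεb x (by linarith)).1]) hx0.le
    have h1 : Tendsto (fun x => log (h (B + 1)) - β / 2 * log (B + 1) + β / 2 * log x) atTop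
        atTop := tendsto_atTop_add_const_left _ _
          (tendsto_log_atTop.const_mul_atTop (by positivity))
    have h2 : Tendsto (fun x => log (h x)) atTop atTop := by
      refine tendsto_atTop_mono' _ ?_ h1
      filter_upwards [eventually_ge_atTop (B + 1)] with x hx
      have := hm self_mem_Ici hx hx
      simp only at this
      linarith
    refine (tendsto_exp_atTop.comp h2).congr' ?_
    filter_upwards [eventually_ge_atTop B] with x hx using exp_log (hhpos x hx)
  have hex : ∀ t, ∃ x, h (B + 1) ≤ t → B + 1 ≤ x ∧ h x = t := by
    intro t
    by_cases ht : h (B + 1) ≤ t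
    · obtain ⟨y, hy1, hy2⟩ := ((hlim.eventually_ge_atTop t).and
        (eventually_ge_atTop (B + 1))).exists
      obtain ⟨x, hx1, hx2⟩ := intermediate_value_Icc hy2
        (fun x hx => (hder x (by linarith [hx.1])).continuousAt.continuousWithinAt) ⟨ht, hy1⟩
      exact ⟨x, fun _ => ⟨hx1.1, hx2⟩⟩
    · exact ⟨0, fun h => absurd h ht⟩
  choose X hX using hex
  have hXlim : Tendsto X atTop atTop := by
    refine tendsto_atTop.2 fun M => ?_
    filter_upwards [eventually_ge_atTop (h (B + 1)), eventually_gt_atTop (h (max M (B + 1)))] with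
      t h1 h2
    by_contra hcon
    have h3 := hmono (hX t h1).1 (le_max_right M (B + 1))
      ((not_le.1 hcon).le.trans (le_max_left _ _))
    rw [(hX t h1).2] at h3
    linarith
  have hSpos : ∀ᶠ t in atTop, 0 < 1 / √(h₂ (X t)) := by
    filter_upwards [hXlim.eventually_ge_atTop B] with t ht
    have := hpos₂ _ ht
    positivity
  have hratio : Tendsto (fun t => X t / (1 / √(h₂ (X t)))) atTop atTop := by
    have h1 : Tendsto (fun t => √(β / 2 * t)) atTop atTop :=
      tendsto_sqrt_atTop.comp (tendsto_id.const_mul_atTop (by positivity))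
    refine tendsto_atTop_mono' _ ?_ h1
    filter_upwards [hXlim.eventually_ge_atTop B, eventually_ge_atTop (h (B + 1)),
      eventually_ge_atTop 0] with t h2 h3 h4
    have hX1 : 1 < X t := by linarith
    have h5 := (hεb _ h2).1
    rw [div_div_eq_mul_div, div_one, ← Real.sqrt_sq (show 0 ≤ X t by linarith),
      ← Real.sqrt_mul (sq_nonneg _)]
    refine Real.sqrt_le_sqrt ?_
    rw [Real.sqrt_sq (show 0 ≤ X t by linarith)]
    simp only [hh₂]
    rw [(hX t h3).2]
    have e : X t ^ 2 * (t * ((β + ε (X t)) / X t)) = X t * ((β + ε (X t)) * t) := by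
      field_simp
    rw [e]
    have h6 : β / 2 * t ≤ (β + ε (X t)) * t := by gcongr
    have h7 : 0 ≤ (β + ε (X t)) * t := le_trans (by positivity) h6
    nlinarith
  refine ⟨X, fun t => 1 / √(h₂ (X t)), exists_laplaceScale_of_second_deriv (h₂ := h₂) hg ?_ ?_ hXlim
    ?_ hSpos ?_ hratio ?_⟩
  · filter_upwards [eventually_gt_atTop B] with x hx using hder x hx
  · filter_upwards [eventually_gt_atTop B] with x hx using hpos₂ x hx.le
  · filter_upwards [eventually_ge_atTop (h (B + 1))] with t ht using (hX t ht).2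
  · filter_upwards [hXlim.eventually_ge_atTop B] with t ht
    have := hpos₂ _ ht
    rw [div_pow, Real.sq_sqrt this.le]
    field_simp
  · intro ζ K hζ
    have hS0 : Tendsto (fun t => K * (1 / √(h₂ (X t))) / X t) atTop (𝓝 0) := by
      have := (tendsto_inv_atTop_zero.comp hratio).const_mul K
      rw [mul_zero] at this
      refine this.congr fun t => ?_
      simp only [Function.comp, inv_div]
      ring
    have hdist : Tendsto (fun t => (ζ t - X t) / X t) atTop (𝓝 0) := by
      refine squeeze_zero_norm' ?_ hS0
      filter_upwards [hζ, hXlim.eventually_gt_atTop 0] with t h1 h2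
      rw [norm_div, Real.norm_eq_abs, norm_of_nonneg h2.le]
      gcongr
    have hquot : Tendsto (fun t => ζ t / X t) atTop (𝓝 1) := by
      have := hdist.add_const 1
      rw [zero_add] at this
      refine this.congr' ?_
      filter_upwards [hXlim.eventually_gt_atTop 0] with t h2
      field_simp
      ring
    have hhalf : ∀ᶠ t in atTop, X t / 2 ≤ ζ t := by
      filter_upwards [hquot.eventually_const_le (show (1 / 2 : ℝ) < 1 by norm_num),
        hXlim.eventually_gt_atTop 0] with t h1 h2
      rw [le_div_iff₀ h2] at h1
      linarith
    have hζlim : Tendsto ζ atTop atTop :=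
      tendsto_atTop_mono' _ hhalf (hXlim.atTop_div_const (by norm_num))
    have hlogdiff : Tendsto (fun t => log (h (ζ t)) - log (h (X t))) atTop (𝓝 0) := by
      have h0 := hdist.abs.const_mul (4 * β)
      rw [abs_zero, mul_zero] at h0
      refine squeeze_zero_norm' ?_ h0
      filter_upwards [hhalf, hXlim.eventually_ge_atTop (2 * (B + 1))] with t h1 h2
      have hX0 : 0 < X t := by linarith
      have h3 := abs_sub_le_of_hasDerivAt (f := fun x => log (h x)) (b := X t / 2)
        (M := 4 * β / X t) (x := X t) (y := ζ t) (fun u hu => hlog u (by linarith))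
        (fun u hu => by
          have hb := hεb u (by linarith)
          have hu0 : 0 < u := by linarith
          rw [abs_of_nonneg (div_nonneg (by linarith) hu0.le), div_le_div_iff₀ hu0 hX0]
          nlinarith) (by linarith) h1
      rw [Real.norm_eq_abs]
      refine h3.trans_eq ?_
      rw [abs_div, abs_of_pos hX0]
      ring
    have hhq : Tendsto (fun t => h (ζ t) / h (X t)) atTop (𝓝 1) := by
      have := (continuous_exp.tendsto 0).comp hlogdiff
      rw [exp_zero] at this
      refine this.congr' ?_
      filter_upwards [hζlim.eventually_ge_atTop B, hXlim.eventually_ge_atTop B] with t h1 h2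
      simp only [Function.comp]
      rw [Real.exp_sub, exp_log (hhpos _ h1), exp_log (hhpos _ h2)]
    have hεq : Tendsto (fun t => (β + ε (ζ t)) / (β + ε (X t))) atTop (𝓝 1) := by
      have h1 := (hε0.comp hζlim).const_add β
      have h2 := (hε0.comp hXlim).const_add β
      have := h1.div h2 (by rw [add_zero]; exact hβ0.ne')
      rw [add_zero, div_self hβ0.ne'] at this
      exact this
    have hfin := (hhq.mul hεq).mul (hquot.inv₀ one_ne_zero)
    rw [mul_one, inv_one, mul_one] at hfin
    refine hfin.congr fun t => ?_
    simp only [hh₂]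
    rw [mul_div_mul_comm, div_div_div_eq, inv_div, mul_assoc]
    congr 1
    generalize β + ε (ζ t) = u
    generalize β + ε (X t) = v
    ring

lemma bddBelow_of_geninv_pos {h : ℝ → ℝ} {u : ℝ} (hu : 0 < geninv h u) :
    BddBelow {x : ℝ | u ≤ h x} ∧ {x : ℝ | u ≤ h x}.Nonempty := by
  constructor
  · by_contra hb
    rw [geninv, Real.sInf_of_not_bddBelow hb] at hu
    exact lt_irrefl _ hu
  · by_contra hb
    rw [geninv, not_nonempty_iff_eq_empty.1 hb, Real.sInf_empty] at hu
    exact lt_irrefl _ hu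

lemma geninv_apply {h : ℝ → ℝ} (hm : StrictMonoOn h (Ici 0)) {y : ℝ} (hy : 0 ≤ y)
    (hpos : 0 < geninv h (h y)) : geninv h (h y) = y := by
  refine IsLeast.csInf_eq ⟨le_refl (h y), fun x hx => ?_⟩
  have hx0 : 0 ≤ x := hpos.le.trans (csInf_le (bddBelow_of_geninv_pos hpos).1 hx)
  exact (hm.le_iff_le hy hx0).1 hx

/-- Where the generalized inverse is eventually strictly increasing and unbounded, it is a
genuine right inverse. -/
lemma eventually_apply_geninv {h : ℝ → ℝ} {U : ℝ} (hm : StrictMonoOn h (Ici 0))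
    (hpos : ∀ u ≥ U, 0 < geninv h u) (hψ : StrictMonoOn (geninv h) (Ici U))
    (hlim : Tendsto (geninv h) atTop atTop) : ∀ᶠ u in atTop, h (geninv h u) = u := by
  obtain ⟨x₀, hx₀⟩ := (bddBelow_of_geninv_pos (hpos U le_rfl)).2
  have h0 : 0 ≤ x₀ := (hpos U le_rfl).le.trans
    (csInf_le (bddBelow_of_geninv_pos (hpos U le_rfl)).1 hx₀)
  filter_upwards [hlim.eventually_ge_atTop x₀, eventually_ge_atTop U] with u h1 h2
  have h3 : U ≤ h (geninv h u) :=
    le_trans hx₀ (hm.monotoneOn h0 (h0.trans h1) h1)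
  exact hψ.injOn h3 h2 (geninv_apply hm (hpos u h2).le (hpos _ h3))

lemma tendsto_atTop_of_eventually_apply {h ψ : ℝ → ℝ} (hm : MonotoneOn h (Ici 0))
    (hlim : Tendsto ψ atTop atTop) (hinv : ∀ᶠ u in atTop, h (ψ u) = u) :
    Tendsto h atTop atTop := by
  refine tendsto_atTop.2 fun M => ?_
  obtain ⟨u, h1, h2, h3⟩ := (hinv.and ((hlim.eventually_ge_atTop 0).and
    (eventually_ge_atTop M))).exists
  filter_upwards [eventually_ge_atTop (ψ u)] with x hx
  exact h3.trans (h1.symm.le.trans (hm h2 (h2.trans hx) hx))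

/-- Variation of `log (ψ')` for `ψ' u = ψ u * ε u / u` on the scale `t / (1 + ε t)`. -/
lemma abs_log_deriv_sub_le {ψ ε ε' : ℝ → ℝ} {U t u δ : ℝ} (hU : 0 < U)
    (hψ : ∀ u ≥ U, HasDerivAt ψ (ψ u * ε u / u) u) (hψ0 : ∀ u ≥ U, 0 < ψ u)
    (hε : ∀ u, HasDerivAt ε (ε' u) u) (hε0 : ∀ u ≥ U, 0 < ε u)
    (hε' : ∀ u ≥ U, |u * ε' u / ε u| ≤ 1 / 2) (ht : 2 * U ≤ t) (hδ : δ ≤ 1 / 2)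
    (hu : |u - t| ≤ δ * (t / (1 + ε t))) :
    |log (ψ u * ε u / u) - log (ψ t * ε t / t)| ≤ 4 * δ := by
  have ht0 : 0 < t := by linarith
  have hεt : 0 < ε t := hε0 t (by linarith)
  set w := t / (1 + ε t) with hw
  have hw0 : 0 < w := by positivity
  have hwt : w ≤ t := div_le_self ht0.le (by linarith)
  have hδ0 : 0 ≤ δ := by
    by_contra hcon
    have h1 := (abs_nonneg _).trans hu
    have h2 : 0 < w * (-δ) := mul_pos hw0 (by linarith)
    linarith
  have hδw : δ * w ≤ t / 2 := by nlinarith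
  have hball : ∀ v, |v - t| ≤ δ * w → t / 2 ≤ v := fun v hv => by
    linarith [(abs_le.1 hv).1]
  have hconv : Convex ℝ {v : ℝ | |v - t| ≤ δ * w} := by
    simpa [Metric.closedBall, Real.dist_eq] using convex_closedBall t (δ * w)
  have hmem : t ∈ {v : ℝ | |v - t| ≤ δ * w} := by
    simpa using (abs_nonneg _).trans hu
  have hε2 : ∀ v, |v - t| ≤ δ * w → ε v ≤ 2 * ε t := fun v hv => by
    have h1 := abs_sub_le_of_hasDerivAt (f := fun v => log (ε v)) (f' := fun v => ε' v / ε v)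
      (b := t / 2) (M := 1 / t) (x := t) (y := v)
      (fun s hs => (hε s).log (hε0 s (by linarith)).ne') (fun s hs => by
        have hs0 : 0 < s := by linarith
        have h2 := hε' s (by linarith)
        rw [mul_div_assoc, abs_mul, abs_of_pos hs0] at h2
        rw [le_div_iff₀ ht0]
        nlinarith [abs_nonneg (ε' s / ε s)]) (by linarith) (hball v hv)
    have h3 : 1 / t * |v - t| ≤ 1 / 2 := by
      rw [one_div_mul_eq_div, div_le_iff₀ ht0]
      linarith
    have h4 : log (ε v) ≤ log 2 + log (ε t) := by
      have := (abs_le.1 (h1.trans h3)).2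
      have := Real.log_two_gt_d9
      linarith
    rw [← Real.log_mul two_ne_zero hεt.ne'] at h4
    exact (Real.log_le_log_iff (hε0 v (by linarith [hball v hv])) (by positivity)).1 h4
  have hd : ∀ v, |v - t| ≤ δ * w → HasDerivAt (fun v => log (ψ v * ε v / v))
      ((ε v + v * ε' v / ε v - 1) / v) v := fun v hv => by
    have hvU : U ≤ v := by linarith [hball v hv]
    have hv0 : 0 < v := by linarith
    have h1 := hψ0 v hvU
    have h2 := hε0 v hvU
    have h3 : HasDerivAt (fun v => ψ v * ε v / v)
        (((ψ v * ε v / v * ε v + ψ v * ε' v) * v - ψ v * ε v * 1) / v ^ 2) v :=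
      ((hψ v hvU).mul (hε v)).div (hasDerivAt_id v) hv0.ne'
    refine (h3.log (by positivity)).congr_deriv ?_
    field_simp
  have hbd : ∀ v, |v - t| ≤ δ * w → |(ε v + v * ε' v / ε v - 1) / v| ≤ 4 / w := fun v hv => by
    have hvt := hball v hv
    have hv0 : 0 < v := by linarith
    have h1 := abs_le.1 (hε' v (by linarith))
    have h2 := hε2 v hv
    have h3 := hε0 v (by linarith)
    have h4 : |ε v + v * ε' v / ε v - 1| ≤ 2 * (1 + ε t) := by
      rw [abs_le]
      constructor <;> linarith
    rw [abs_div, abs_of_pos hv0, div_le_iff₀ hv0, hw]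
    refine h4.trans ?_
    have e : 4 / (t / (1 + ε t)) * v = (1 + ε t) * (4 * v / t) := by
      field_simp
    rw [e, mul_comm]
    gcongr
    rw [le_div_iff₀ ht0]
    linarith
  have hfin := hconv.norm_image_sub_le_of_norm_hasDerivWithin_le
    (fun v hv => (hd v hv).hasDerivWithinAt) (fun v hv => hbd v hv) hmem
    (show u ∈ {v : ℝ | |v - t| ≤ δ * w} from hu)
  refine hfin.trans ?_
  rw [Real.norm_eq_abs, div_mul_eq_mul_div, div_le_iff₀ hw0]
  nlinarith

/-- Increment of `ψ` over a step of relative size `δ / (1 + ε)`. -/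
lemma mul_le_sub_of_log_deriv {ψ D : ℝ → ℝ} {a b M : ℝ} (hab : a < b)
    (hψ : ∀ u ∈ Icc a b, HasDerivAt ψ (D u) u) (hD : ∀ u ∈ Icc a b, M ≤ D u) :
    M * (b - a) ≤ ψ b - ψ a := by
  obtain ⟨ξ, hξ, e⟩ := exists_hasDerivAt_eq_slope ψ D hab
    (fun u hu => (hψ u hu).continuousAt.continuousWithinAt)
    (fun u hu => hψ u ⟨hu.1.le, hu.2.le⟩)
  have h1 := hD ξ ⟨hξ.1.le, hξ.2.le⟩
  rw [e, le_div_iff₀ (by linarith)] at h1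
  exact h1

lemma tendsto_sqrt_deriv_mul {ψ ε ε' : ℝ → ℝ} {U c η : ℝ} (hU : 1 ≤ U)
    (hψ0 : ∀ u ≥ U, 0 < ψ u) (hψ : Tendsto ψ atTop atTop)
    (hε : ∀ u, HasDerivAt ε (ε' u) u) (hε0 : ∀ u ≥ U, 0 < ε u)
    (hε' : ∀ u ≥ U, |u * ε' u / ε u| ≤ 1 / 2) (hη : η ≤ 1) (hc : 0 < c)
    (hcε : ∀ u ≥ U, c ≤ u ^ η * ε u) :
    Tendsto (fun t => √(ψ t * ε t / t) * (t / (1 + ε t))) atTop atTop := by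
  have hanti : AntitoneOn (fun u => ε u / u) (Ici U) := by
    have hd : ∀ u ≥ U, HasDerivAt (fun u => ε u / u) ((ε' u * u - ε u * 1) / u ^ 2) u :=
      fun u hu => (hε u).div (hasDerivAt_id u) (show u ≠ 0 by linarith)
    refine antitoneOn_of_deriv_nonpos (convex_Ici _)
      (fun x hx => (hd x hx).continuousAt.continuousWithinAt)
      (fun x hx => (hd x (interior_subset hx)).differentiableAt.differentiableWithinAt)
      fun x hx => ?_
    have hx' : U ≤ x := interior_subset hx
    rw [(hd x hx').deriv]
    refine div_nonpos_of_nonpos_of_nonneg ?_ (sq_nonneg _)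
    have h1 := (abs_le.1 (hε' x hx')).2
    have h2 := hε0 x hx'
    rw [div_le_iff₀ h2] at h1
    linarith
  set C := ε U / U with hC
  have hC0 : 0 < C := div_pos (hε0 U le_rfl) (by linarith)
  set k := min (c / 4) (1 / (4 * C)) with hk
  have hk0 : 0 < k := lt_min (by positivity) (by positivity)
  refine tendsto_atTop_mono' _ ?_ (tendsto_sqrt_atTop.comp (hψ.const_mul_atTop hk0))
  filter_upwards [eventually_ge_atTop U] with t ht
  have ht1 : 1 ≤ t := hU.trans ht
  have ht0 : 0 < t := by linarith
  have h1 := hψ0 t ht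
  have h2 := hε0 t ht
  have h3 : c ≤ t * ε t := (hcε t ht).trans (by
    gcongr
    simpa using rpow_le_rpow_of_exponent_le ht1 hη)
  have h4 : ε t ≤ C * t := by
    have := hanti self_mem_Ici ht ht
    simp only at this
    rwa [div_le_iff₀ ht0] at this
  rw [Function.comp, ← Real.sqrt_sq (show 0 ≤ t / (1 + ε t) by positivity),
    ← Real.sqrt_mul (by positivity)]
  refine Real.sqrt_le_sqrt ?_
  have e : ψ t * ε t / t * (t / (1 + ε t)) ^ 2 = (t * ε t / (1 + ε t) ^ 2) * ψ t := by
    field_simp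
  rw [e]
  gcongr
  rw [le_div_iff₀ (by positivity)]
  rcases le_total (ε t) 1 with h5 | h5
  · have h6 : (1 + ε t) ^ 2 ≤ 4 := by nlinarith
    have h7 : k ≤ c / 4 := min_le_left _ _
    calc k * (1 + ε t) ^ 2 ≤ c / 4 * 4 := by gcongr
      _ ≤ _ := by linarith
  · have h6 : (1 + ε t) ^ 2 ≤ 4 * ε t ^ 2 := by nlinarith
    have h7 : k ≤ 1 / (4 * C) := min_le_right _ _
    calc k * (1 + ε t) ^ 2 ≤ 1 / (4 * C) * (4 * ε t ^ 2) := by gcongr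
      _ = ε t / C * ε t := by field_simp
      _ ≤ t * ε t := by
        gcongr
        rw [div_le_iff₀ hC0]
        linarith

/-- Rapidly varying `h` admits a Laplace scale. -/
lemma MemRinfty.exists_laplaceScale {g h : ℝ → ℝ} (hR : MemRinfty h)
    (hg : ∀ x, HasDerivAt g (h x) x) : ∃ X S A, LaplaceScale g h X S A := by
  obtain ⟨hm, ε, ε', -, hε, -, hrep, hlim, hlog, -, η, ⟨-, hη⟩, c, hc, hcε⟩ := hR
  have hεc : Continuous ε := continuous_iff_continuousAt.2 fun x => (hε x).continuousAt
  have hlog' : ∀ᶠ u in atTop, |u * ε' u / ε u| ≤ 1 / 2 :=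
    hlog.abs.eventually_le_const (by rw [abs_zero]; positivity)
  obtain ⟨U, hU⟩ := eventually_atTop.1 (hcε.and (hlog'.and (eventually_gt_atTop 1)))
  have hU1 : 1 < U := (hU U le_rfl).2.2
  set ψ := geninv h with hψdef
  have hψ0 : ∀ u ≥ 1, 0 < ψ u := fun u hu => by rw [hrep u hu]; exact exp_pos _
  have hψ0' : ∀ u ≥ U, 0 < ψ u := fun u hu => hψ0 u (by linarith)
  have hε0 : ∀ u ≥ U, 0 < ε u := fun u hu => by
    have h1 := hc.trans_le (hU u hu).1
    have hu0 : 0 < u := by linarith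
    exact pos_of_mul_pos_right h1 (by positivity)
  set D : ℝ → ℝ := fun u => ψ u * ε u / u with hD
  have hder : ∀ u ≥ U, HasDerivAt ψ (D u) u := fun u hu =>
    hasDerivAt_exp_integral hεc hrep (by linarith)
  have hD0 : ∀ u ≥ U, 0 < D u := fun u hu =>
    div_pos (mul_pos (hψ0' u hu) (hε0 u hu)) (by linarith)
  have hψm : StrictMonoOn ψ (Ici U) := by
    refine strictMonoOn_of_deriv_pos (convex_Ici _)
      (fun x hx => (hder x hx).continuousAt.continuousWithinAt) fun x hx => ?_
    rw [(hder x (interior_subset hx)).deriv]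
    exact hD0 x (interior_subset hx)
  have hinv := eventually_apply_geninv hm hψ0' hψm hlim
  have hhlim : Tendsto h atTop atTop := tendsto_atTop_of_eventually_apply hm.monotoneOn hlim hinv
  have hinv' : ∀ᶠ x in atTop, ψ (h x) = x := by
    filter_upwards [hhlim.eventually_ge_atTop 1, eventually_ge_atTop 0] with x h1 h2
    exact geninv_apply hm h2 (hψ0 _ h1)
  have hhcont : ∀ᶠ x in atTop, ContinuousAt h x := by
    obtain ⟨V, hV⟩ := eventually_atTop.1 (hinv.and (hlim.eventually_ge_atTop 0))
    filter_upwards [hhlim.eventually_gt_atTop V, eventually_gt_atTop 0] with x h1 h2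
    refine hm.continuousAt_of_image_mem_nhds (Ici_mem_nhds h2) ?_
    filter_upwards [Ioi_mem_nhds h1] with v hv
    exact ⟨ψ v, (hV v (le_of_lt hv)).2, (hV v (le_of_lt hv)).1⟩
  have hhder : ∀ᶠ x in atTop, HasDerivAt h (D (h x))⁻¹ x := by
    obtain ⟨V, hV⟩ := eventually_atTop.1 hinv'
    filter_upwards [hhcont, hhlim.eventually_ge_atTop U, eventually_gt_atTop V] with x h1 h2 h3
    refine HasDerivAt.of_local_left_inverse h1 (hder _ h2) (hD0 _ h2).ne' ?_
    filter_upwards [Ioi_mem_nhds h3] with y hy using hV y (le_of_lt hy)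
  have hR := tendsto_sqrt_deriv_mul (c := c) (η := η) hU1.le hψ0' hlim hε hε0
    (fun u hu => (hU u hu).2.1) (by linarith) hc (fun u hu => (hU u hu).1)
  refine ⟨ψ, fun t => √(D t), exists_laplaceScale_of_second_deriv
    (h₂ := fun x => (D (h x))⁻¹) hg hhder ?_ hlim hinv ?_ ?_ ?_ ?_⟩
  · filter_upwards [hhlim.eventually_ge_atTop U] with x hx using inv_pos.2 (hD0 _ hx)
  · filter_upwards [eventually_ge_atTop U] with t ht using Real.sqrt_pos.2 (hD0 t ht)
  · filter_upwards [hinv, eventually_ge_atTop U] with t h1 h2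
    rw [h1, Real.sq_sqrt (hD0 t h2).le, mul_inv_cancel₀ (hD0 t h2).ne']
  · refine tendsto_atTop_mono' _ ?_ hR
    filter_upwards [eventually_ge_atTop U] with t ht
    have ht0 : 0 < t := by linarith
    have h1 := hψ0' t ht
    have h2 := hε0 t ht
    rw [le_div_iff₀ (Real.sqrt_pos.2 (hD0 t ht)), mul_right_comm,
      Real.mul_self_sqrt (hD0 t ht).le]
    have e : ψ t * ε t / t * (t / (1 + ε t)) = ψ t * (ε t / (1 + ε t)) := by field_simp
    rw [e]
    exact mul_le_of_le_one_right h1.le ((div_le_one (by positivity)).2 (by linarith))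
  · intro ζ K hζ
    have hloc : ∀ {t u δ : ℝ}, 2 * U ≤ t → δ ≤ 1 / 2 → |u - t| ≤ δ * (t / (1 + ε t)) →
        |log (D u) - log (D t)| ≤ 4 * δ := fun ht hδ hu =>
      abs_log_deriv_sub_le (by linarith) hder hψ0' hε hε0 (fun u hu => (hU u hu).2.1) ht hδ hu
    obtain ⟨V, hV⟩ := eventually_atTop.1 hinv
    have hclose : ∀ δ > 0, δ ≤ 1 / 2 → ∀ᶠ t in atTop, |h (ζ t) - t| ≤ δ * (t / (1 + ε t)) := by
      intro δ hδ hδ2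
      filter_upwards [hζ, hR.eventually_gt_atTop (8 * K / δ), eventually_ge_atTop (2 * U),
        eventually_ge_atTop (2 * V)] with t h1 h2 h3 h4
      have ht0 : 0 < t := by linarith
      have hεt := hε0 t (by linarith)
      set w := t / (1 + ε t) with hw
      have hw0 : 0 < w := by positivity
      have hwt : w ≤ t := div_le_self ht0.le (by linarith)
      have hδw : δ * w ≤ t / 2 := by nlinarith
      have hδw0 : 0 < δ * w := by positivity
      have hDt := hD0 t (by linarith)
      have hlow : ∀ u, |u - t| ≤ δ * w → D t / 8 ≤ D u := fun u hu => by
        have hDu := hD0 u (by linarith [(abs_le.1 hu).1])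
        have h5 := (abs_le.1 (hloc h3 hδ2 hu)).1
        rw [← Real.log_le_log_iff (by positivity) hDu, Real.log_div hDt.ne' (by norm_num),
          show (8 : ℝ) = 2 ^ 3 by norm_num, Real.log_pow]
        have := Real.log_two_gt_d9
        push_cast
        linarith
      have hinc : K * √(D t) < D t / 8 * (δ * w) := by
        rw [div_lt_iff₀ hδ] at h2
        have h6 := Real.mul_self_sqrt hDt.le
        have h7 := Real.sqrt_pos.2 hDt
        nlinarith
      have hup := mul_le_sub_of_log_deriv (show t < t + δ * w by linarith)
        (fun u hu => hder u (by linarith [hu.1])) (fun u hu => hlow u (by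
          rw [abs_le]; constructor <;> linarith [hu.1, hu.2]))
      have hdn := mul_le_sub_of_log_deriv (show t - δ * w < t by linarith)
        (fun u hu => hder u (by linarith [hu.1])) (fun u hu => hlow u (by
          rw [abs_le]; constructor <;> linarith [hu.1, hu.2]))
      rw [add_sub_cancel_left] at hup
      rw [sub_sub_cancel] at hdn
      have h8 := abs_le.1 h1
      have hζ1 : ζ t ≤ ψ (t + δ * w) := by linarith
      have hζ2 : ψ (t - δ * w) ≤ ζ t := by linarith
      have hp1 := hψ0' (t - δ * w) (by linarith)
      have h9 := hm.monotoneOn hp1.le (hp1.le.trans hζ2) hζ2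
      have h10 := hm.monotoneOn (hp1.le.trans hζ2) (hp1.le.trans (hζ2.trans hζ1)) hζ1
      rw [hV _ (by linarith)] at h9 h10
      rw [abs_le]
      constructor <;> linarith
    have hlogD : Tendsto (fun t => log (D t) - log (D (h (ζ t)))) atTop (𝓝 0) := by
      rw [Metric.tendsto_nhds]
      intro e he
      set δ := min (1 / 2) (e / 8) with hδ
      have hδ0 : 0 < δ := lt_min (by norm_num) (by positivity)
      filter_upwards [hclose δ hδ0 (min_le_left _ _), eventually_ge_atTop (2 * U)] with t h1 h2
      have h3 := hloc h2 (min_le_left _ _) h1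
      have h4 : δ ≤ e / 8 := min_le_right _ _
      rw [Real.dist_eq, sub_zero, abs_sub_comm]
      linarith
    have hexp := (continuous_exp.tendsto 0).comp hlogD
    rw [exp_zero] at hexp
    refine hexp.congr' ?_
    filter_upwards [hclose (1 / 2) (by norm_num) le_rfl, hinv, eventually_ge_atTop (2 * U)] with
      t h1 h2 h3
    have ht0 : 0 < t := by linarith
    have hεt := hε0 t (by linarith)
    have hwt : t / (1 + ε t) ≤ t := div_le_self ht0.le (by linarith)
    have h4 : U ≤ h (ζ t) := by linarith [(abs_le.1 h1).1]
    simp only [Function.comp]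
    rw [← hψdef] at h2
    rw [h2, Real.exp_sub, exp_log (hD0 t (by linarith)), exp_log (hD0 _ h4), inv_div_inv]

/-- **Gibbs principle in variation norm.** Under the growth condition
`ψ(tₙ)²/√(n ψ'(tₙ)) → 0`, where `tₙ = m⁻¹(aₙ)`, the total variation distance between
the conditional law `P_{aₙ}` of `X₁` given `Sₙ = n aₙ` and the tilted law `G_{aₙ}`
tends to `0`; equivalently (Scheffé), `∫ |p_{aₙ} y - π^{aₙ} y| dy → 0`. -/
theorem gibbs_principle_variation_norm
    (p g q h : ℝ → ℝ) (c : ℝ) (hc : 0 < c)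
    (hpdef : ∀ x ≥ (0:ℝ), p x = c * Real.exp (-(g x - q x)))
    (hpzero : ∀ x < (0:ℝ), p x = 0)
    (hpdens : (∫ x in Set.Ici (0:ℝ), p x) = 1)
    (hgpos : ∀ x ≥ (0:ℝ), 0 < g x)
    (hglim : Tendsto (fun x => g x / x) atTop atTop)
    (hgderiv : ∀ x, HasDerivAt g (h x) x)
    (hq : ∃ ϑ > (0:ℝ), ∀ᶠ x in atTop, ∀ v, |v - x| < ϑ * x → |q v| ≤ 1 / Real.sqrt (x * h x))
    (hmem : MemFrakR h)
    (hPhi : ∀ t > (0:ℝ), IntegrableOn (fun x => Real.exp (t * x) * p x) (Set.Ici 0))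
    (a tseq : ℕ → ℝ) (ha : Tendsto a atTop atTop)
    (htm : ∀ n, mFun p (tseq n) = a n)
    (hgrowth : Tendsto
      (fun n : ℕ => geninv h (tseq n) ^ 2 / Real.sqrt ((n : ℝ) * deriv (geninv h) (tseq n)))
      atTop (𝓝 0)) :
    Tendsto (fun n : ℕ => ∫ y, |condDensity p a n y - tilt p (tseq n) y|) atTop (𝓝 0) := by
  have hscale : ∃ X S A, LaplaceScale g h X S A := by
    rcases hmem with ⟨β, hβ⟩ | hR
    · exact hβ.exists_laplaceScale hgderiv
    · exact hR.exists_laplaceScale hgderiv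
  obtain ⟨X, S, A, H⟩ := hscale
  have hpnn : ∀ x, 0 ≤ p x := fun x => by
    rcases lt_or_ge x 0 with hx | hx
    · rw [hpzero x hx]
    · rw [hpdef x hx]
      positivity
  have hext : ∀ t, IntegrableOn (fun x => exp (t * x) * p x) (Set.Ici 0) →
      Integrable fun x => exp (t * x) * p x := fun t ht =>
    (integrableOn_iff_integrable_of_support_subset fun x hx => by
      by_contra hx0
      exact hx (by simp [hpzero x (not_le.1 hx0)])).1 ht
  have hpi : IntegrableOn p (Set.Ici 0) := by
    by_contra hcon
    rw [integral_undef hcon] at hpdens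
    exact zero_ne_one hpdens
  have hInt : ∀ t, Integrable fun x => exp (t * x) * p x := by
    intro t
    rcases lt_or_ge 0 t with ht | ht
    · exact hext t (hPhi t ht)
    · refine hext t (hpi.mono' ?_ ?_)
      · exact (by fun_prop : Continuous fun x : ℝ => exp (t * x)).aestronglyMeasurable.mul
          hpi.aestronglyMeasurable
      · filter_upwards [ae_restrict_mem measurableSet_Ici] with x hx
        rw [Real.norm_of_nonneg (mul_nonneg (exp_pos _).le (hpnn x))]
        exact mul_le_of_le_one_left (hpnn x)
          (exp_le_one_iff.2 (mul_nonpos_of_nonpos_of_nonneg ht hx))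
  have hq0 : Tendsto q atTop (𝓝 0) := by
    obtain ⟨ϑ, hϑ, hq⟩ := hq
    have h1 : Tendsto (fun x => 1 / √(x * h x)) atTop (𝓝 0) := by
      simp only [one_div]
      exact tendsto_inv_atTop_zero.comp
        (tendsto_sqrt_atTop.comp (tendsto_id.atTop_mul_atTop₀ H.tendsto_h))
    refine squeeze_zero_norm' ?_ h1
    filter_upwards [hq, eventually_gt_atTop 0] with x hx hx0
    exact hx x (by rw [sub_self, abs_zero]; positivity)
  exact H.tendsto_integral_abs_condDensity_sub_tilt hgderiv hc hpdef hpzero hInt hq0 ha htm
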